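/- arXiv:0708.4409 — 3 statements merged into one kernel-verified Lean document; each statement's English description precedes it below -/
import Mathlib

section
/- An infinite word t over a finite alphabet A is episturmian in the wide sense (i.e., every factor of t is finite episturmian) if and only if there exists an infinite word u over A such that a·u ≤ min(t) in the lexicographic order for every acceptable pair (a, <) on A. -/
/-- The prefix of length `k` of an infinite word `t`. -/
def prefixList {A : Type*} (t : ℕ → A) (k : ℕ) : List A := (List.range k).map t

/-- `u` occurs as a factor of the infinite word `t` at position `i`. -/
def FactorAt {A : Type*} (t : ℕ → A) (u : List A) (i : ℕ) : Prop :=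
  u = (List.range u.length).map (fun j => t (i + j))

/-- `u` is a (finite) factor of the infinite word `t`. -/
def IsFactorInf {A : Type*} (t : ℕ → A) (u : List A) : Prop := ∃ i, FactorAt t u i

/-- An infinite word is recurrent if each of its factors occurs infinitely often. -/
def Recurrent {A : Type*} (t : ℕ → A) : Prop :=
  ∀ u, IsFactorInf t u → ∀ N, ∃ i, N ≤ i ∧ FactorAt t u i

/-- `u` is a right special factor of `t`. -/
def RightSpecial {A : Type*} (t : ℕ → A) (u : List A) : Prop :=
  ∃ a b : A, a ≠ b ∧ IsFactorInf t (u ++ [a]) ∧ IsFactorInf t (u ++ [b])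

/-- `u` is a left special factor of `t`. -/
def LeftSpecial {A : Type*} (t : ℕ → A) (u : List A) : Prop :=
  ∃ a b : A, a ≠ b ∧ IsFactorInf t (a :: u) ∧ IsFactorInf t (b :: u)

/-- An infinite word is episturmian if its set of factors is closed under reversal
and it has at most one right special factor of each length. -/
def Episturmian {A : Type*} (t : ℕ → A) : Prop :=
  (∀ u, IsFactorInf t u → IsFactorInf t u.reverse) ∧
  (∀ u v, RightSpecial t u → RightSpecial t v → u.length = v.length → u = v)

/-- A standard episturmian word: episturmian with all left special factors prefixes. -/
def StdEpisturmian {A : Type*} (t : ℕ → A) : Prop :=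
  Episturmian t ∧ ∀ u, LeftSpecial t u → u = prefixList t u.length

/-- A finite word is finite episturmian if it is a factor of some episturmian infinite word. -/
def FiniteEpisturmian {A : Type*} (w : List A) : Prop :=
  ∃ t : ℕ → A, Episturmian t ∧ IsFactorInf t w

/-- An acceptable pair: a strict total order `r` on `A` together with a letter `a`
that is minimal for `r`. -/
def AcceptablePair {A : Type*} (r : A → A → Prop) (a : A) : Prop :=
  IsStrictTotalOrder A r ∧ ∀ b, b ≠ a → r a b

/-- Non-strict lexicographic order on finite words induced by the order `r` on letters. -/
def listLe {A : Type*} (r : A → A → Prop) (u v : List A) : Prop := u = v ∨ List.Lex r u v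

/-- Non-strict lexicographic order on infinite words induced by the order `r` on letters. -/
def infLe {A : Type*} (r : A → A → Prop) (x y : ℕ → A) : Prop :=
  x = y ∨ ∃ i, (∀ j, j < i → x j = y j) ∧ r (x i) (y i)

/-- `m` is the lexicographically smallest factor of the finite word `w` of length `k`. -/
def IsMinFacLen {A : Type*} (r : A → A → Prop) (w : List A) (k : ℕ) (m : List A) : Prop :=
  m <:+: w ∧ m.length = k ∧ ∀ u, u <:+: w → u.length = k → listLe r m u

/-- `m` is the lexicographically greatest factor of the finite word `w` of length `k`. -/
def IsMaxFacLen {A : Type*} (r : A → A → Prop) (w : List A) (k : ℕ) (m : List A) : Prop :=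
  m <:+: w ∧ m.length = k ∧ ∀ u, u <:+: w → u.length = k → listLe r u m

/-- `m = min(w)`: for each `j ≤ |m|` the prefix of `m` of length `j` is `min(w|j)`,
and `|m|` is maximal with this chain property. -/
def IsMinFin {A : Type*} (r : A → A → Prop) (w m : List A) : Prop :=
  m ≠ [] ∧
  (∀ j, j ≤ m.length → IsMinFacLen r w j (m.take j)) ∧
  (∀ m', IsMinFacLen r w (m.length + 1) m' → ¬ m <+: m')

/-- `m = max(w)` (finite word version). -/
def IsMaxFin {A : Type*} (r : A → A → Prop) (w m : List A) : Prop :=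
  m ≠ [] ∧
  (∀ j, j ≤ m.length → IsMaxFacLen r w j (m.take j)) ∧
  (∀ m', IsMaxFacLen r w (m.length + 1) m' → ¬ m <+: m')

/-- `m = min(t)` for an infinite word `t`: each prefix of `m` is the lexicographically
smallest factor of `t` of its length. -/
def IsMinInf {A : Type*} (r : A → A → Prop) (t m : ℕ → A) : Prop :=
  ∀ k, IsFactorInf t (prefixList m k) ∧
    ∀ u, IsFactorInf t u → u.length = k → listLe r (prefixList m k) u

/-- `m = max(t)` for an infinite word `t`. -/
def IsMaxInf {A : Type*} (r : A → A → Prop) (t m : ℕ → A) : Prop :=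
  ∀ k, IsFactorInf t (prefixList m k) ∧
    ∀ u, IsFactorInf t u → u.length = k → listLe r u (prefixList m k)

/-- Prepend a letter to an infinite word. -/
def consInf {A : Type*} (a : A) (t : ℕ → A) : ℕ → A
  | 0 => a
  | n + 1 => t n

/-- Prepend a finite word to an infinite word. -/
def wordAppend {A : Type*} (v : List A) (t : ℕ → A) : ℕ → A :=
  fun n => if h : n < v.length then v.get ⟨n, h⟩ else t (n - v.length)

/-- The pure epistandard morphism `ψ_z` on finite words: it fixes `z` and sends
each letter `x ≠ z` to `zx`. -/
def psiW {A : Type*} [DecidableEq A] (z : A) (w : List A) : List A :=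
  (w.map (fun x => if x = z then [z] else [z, x])).flatten

/-- The finite word `u` is a prefix of the infinite word `t`. -/
def IsPrefixInf {A : Type*} (u : List A) (t : ℕ → A) : Prop := u = prefixList t u.length

/-- `y = f(t)`: the infinite word `y` is the image of the infinite word `t` under the
(non-erasing) morphism `f`, acting letter by letter. -/
def IsMorphImage {A : Type*} (f : List A → List A) (t y : ℕ → A) : Prop :=
  ∀ k, IsPrefixInf (f (prefixList t k)) y

/-- Pure epistandard morphisms: finite compositions of the morphisms `ψ_a`. -/
inductive PureEpistandard {A : Type*} [DecidableEq A] : (List A → List A) → Prop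
  | id : PureEpistandard _root_.id
  | comp (a : A) (f : List A → List A) : PureEpistandard f →
      PureEpistandard (fun w => psiW a (f w))

/-- An infinite word is episkew if it is non-recurrent and all of its factors
are finite episturmian. -/
def Episkew {A : Type*} (t : ℕ → A) : Prop :=
  ¬ Recurrent t ∧ ∀ u, IsFactorInf t u → FiniteEpisturmian u

/- Two-letter (Bool) notions: `false` plays the role of `a`, `true` of `b`,
with the order `false < true`. -/

/-- A finite binary word is balanced. -/
def BalancedList (w : List Bool) : Prop :=
  ∀ u v : List Bool, u <:+: w → v <:+: w → u.length = v.length →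
    |(u.count true : ℤ) - (v.count true : ℤ)| ≤ 1

/-- An infinite binary word is balanced. -/
def BalancedInf (t : ℕ → Bool) : Prop :=
  ∀ u v : List Bool, IsFactorInf t u → IsFactorInf t v → u.length = v.length →
    |(u.count true : ℤ) - (v.count true : ℤ)| ≤ 1

/-- The Sturmian word of slope `α` and intercept `ρ` defined via floors. -/
def SturmianFloor (α ρ : ℝ) (t : ℕ → Bool) : Prop :=
  ∀ n : ℕ, t n = true ↔ ⌊((n : ℝ) + 1) * α + ρ⌋ ≠ ⌊(n : ℝ) * α + ρ⌋

/-- The Sturmian word of slope `α` and intercept `ρ` defined via ceilings. -/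
def SturmianCeil (α ρ : ℝ) (t : ℕ → Bool) : Prop :=
  ∀ n : ℕ, t n = true ↔ ⌈((n : ℝ) + 1) * α + ρ⌉ ≠ ⌈(n : ℝ) * α + ρ⌉

/-- Aperiodic Sturmian words: those of irrational slope. -/
def IsAperiodicSturmian (t : ℕ → Bool) : Prop :=
  ∃ α ρ : ℝ, α ∈ Set.Icc (0 : ℝ) 1 ∧ ρ ∈ Set.Icc (0 : ℝ) 1 ∧ Irrational α ∧
    (SturmianFloor α ρ t ∨ SturmianCeil α ρ t)

/-- Standard Sturmian words: those with `ρ = α`. -/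
def IsStandardSturmian (t : ℕ → Bool) : Prop :=
  ∃ α : ℝ, α ∈ Set.Icc (0 : ℝ) 1 ∧ (SturmianFloor α α t ∨ SturmianCeil α α t)

/-- A fine infinite binary word: `(min(t), max(t)) = (a·s, b·s)` for some infinite word `s`. -/
def FineBool (t : ℕ → Bool) : Prop :=
  ∃ s : ℕ → Bool, IsMinInf (· < ·) t (consInf false s) ∧ IsMaxInf (· < ·) t (consInf true s)

/-- A periodic infinite word. -/
def PeriodicInf {A : Type*} (t : ℕ → A) : Prop := ∃ p, 0 < p ∧ ∀ i, t (i + p) = t i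

/-- An ultimately periodic infinite word. -/
def UltPeriodicInf {A : Type*} (t : ℕ → A) : Prop :=
  ∃ p, 0 < p ∧ ∃ m, ∀ i, m ≤ i → t (i + p) = t i

section EpiProof
variable {A : Type*}

/-- Recursive form of the morphism. -/
def ps [DecidableEq A] (c : A) : List A → List A
  | [] => []
  | x :: l => if x = c then c :: ps c l else c :: x :: ps c l

section Ps
variable [DecidableEq A] (c : A)

theorem ps_append (l r : List A) : ps c (l ++ r) = ps c l ++ ps c r := by
  induction l with
  | nil => rfl
  | cons x l ih => by_cases h : x = c <;> simp [ps, h, ih]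

theorem ps_head (l r : List A) : ∃ s, ps c l ++ c :: r = c :: s := by
  cases l with
  | nil => exact ⟨r, rfl⟩
  | cons x l => by_cases h : x = c <;> simp [ps, h]

theorem ps_cons_end (x : A) : ∃ s, ps c [x] = s ++ [x] := by
  by_cases h : x = c
  · exact ⟨[], by simp [ps, h]⟩
  · exact ⟨[c], by simp [ps, h]⟩

theorem ps_cons_start (x : A) (l : List A) : ∃ s, ps c (x :: l) ++ [c] = c :: x :: s := by
  by_cases h : x = c
  · obtain ⟨s, hs⟩ := ps_head c l []
    exact ⟨s, by simp [ps, h, hs]⟩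
  · simp [ps, h]

theorem ps_start {h : List A} {x : A} {r : List A} (e : ps c h ++ [c] = c :: x :: r) :
    ∃ h', h = x :: h' := by
  cases h with
  | nil => simp [ps] at e
  | cons y h =>
    obtain ⟨s, hs⟩ := ps_cons_start c y h
    rw [hs] at e
    simp at e
    exact ⟨h, by rw [e.1]⟩

theorem ps_inj {g h : List A} (e : ps c g = ps c h) : g = h := by
  induction g generalizing h with
  | nil =>
    cases h with
    | nil => rfl
    | cons y h => by_cases hy : y = c <;> simp [ps, hy] at e
  | cons x g ih =>
    have e' : ps c (x :: g) ++ [c] = ps c h ++ [c] := by rw [e]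
    obtain ⟨s, hs⟩ := ps_cons_start c x g
    rw [hs] at e'
    obtain ⟨h', rfl⟩ := ps_start c e'.symm
    congr 1
    apply ih
    by_cases hy : x = c <;> simpa [ps, hy] using e

theorem ps_cut {h l r : List A} (e : ps c h ++ [c] = l ++ c :: r) :
    ∃ h1 h2, h = h1 ++ h2 ∧ l = ps c h1 ∧ c :: r = ps c h2 ++ [c] := by
  induction h generalizing l with
  | nil =>
    cases l with
    | nil => exact ⟨[], [], rfl, rfl, by simpa using e.symm⟩
    | cons y l => simp [ps] at e
  | cons x h ih =>
    cases l with
    | nil => exact ⟨[], x :: h, rfl, rfl, by simpa using e.symm⟩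
    | cons y l =>
      by_cases hx : x = c
      · simp [ps, hx] at e
        obtain ⟨h1, h2, rfl, rfl, e3⟩ := ih e.2
        exact ⟨x :: h1, h2, rfl, by simp [ps, hx, e.1], e3⟩
      · cases l with
        | nil => simp [ps, hx] at e
        | cons z l =>
          simp [ps, hx] at e
          obtain ⟨rfl, rfl, e⟩ := e
          obtain ⟨h1, h2, rfl, rfl, e3⟩ := ih e
          exact ⟨x :: h1, h2, rfl, by simp [ps, hx], e3⟩

theorem ps_reverse (l : List A) : (ps c l ++ [c]).reverse = ps c l.reverse ++ [c] := by
  induction l with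
  | nil => rfl
  | cons x l ih =>
    have : (ps c (x :: l) ++ [c]).reverse = (ps c l ++ [c]).reverse ++ (ps c [x]).reverse := by
      rw [← List.reverse_append, ← List.append_assoc, ← ps_append]; rfl
    rw [this, ih, List.reverse_cons, ps_append]
    by_cases hx : x = c <;> simp [ps, hx]

theorem ps_inf_mono {g h : List A} (e : g <:+: h) : ps c g ++ [c] <:+: ps c h ++ [c] := by
  obtain ⟨l, r, rfl⟩ := e
  obtain ⟨s, hs⟩ := ps_head c r []
  exact ⟨ps c l, s, by simp [ps_append, hs]⟩

theorem ps_key_enc (a x : A) (g : List A) :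
    a :: (ps c g ++ [c, x]) <:+: ps c (a :: (g ++ [x])) ++ [c] := by
  obtain ⟨s, hs⟩ := ps_cons_end c a
  obtain ⟨r, hr⟩ := ps_cons_start c x []
  refine ⟨s, r, ?_⟩
  have : a :: (g ++ [x]) = [a] ++ (g ++ [x]) := rfl
  rw [this, ps_append, ps_append, hs]
  simp [hr]

theorem ps_key_dec {a x : A} {g h : List A}
    (e : a :: (ps c g ++ [c, x]) <:+: ps c h ++ [c]) : a :: (g ++ [x]) <:+: h := by
  obtain ⟨l, r, e⟩ := e
  obtain ⟨s, hs⟩ := ps_head c g (x :: r)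
  have e1 : ps c h ++ [c] = (l ++ [a]) ++ c :: s := by
    rw [← hs, ← e]; simp
  obtain ⟨h1, h2, rfl, e2, e3⟩ := ps_cut c e1
  rw [← hs] at e3
  obtain ⟨g', h3, rfl, e4, e5⟩ := ps_cut c e3.symm
  obtain rfl := ps_inj c e4
  obtain ⟨h4, rfl⟩ := ps_start c e5.symm
  rcases List.eq_nil_or_concat h1 with rfl | ⟨h1', b, rfl⟩
  · simp [ps] at e2
  · obtain ⟨q, hq⟩ := ps_cons_end c b
    rw [List.concat_eq_append, ps_append, hq, ← List.append_assoc] at e2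
    have := List.append_inj_right' e2 rfl
    simp at this
    subst this
    exact ⟨h1', h4, by simp⟩

/-- No two adjacent letters different from `c`. -/
def NoAdj (c : A) (l : List A) : Prop := ∀ x y, [x, y] <:+: l → x = c ∨ y = c

theorem NoAdj.mono {c : A} {l r : List A} (h : NoAdj c r) (e : l <:+: r) : NoAdj c l :=
  fun x y hx => h x y (hx.trans e)

theorem ps_exists (n : ℕ) (l : List A) (hn : l.length ≤ n) (h : NoAdj c l)
    (h0 : ∀ x r, l = x :: r → x = c) : ∃ g, l = ps c g := by
  induction n generalizing l with
  | zero => exact ⟨[], by simpa [ps] using hn⟩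
  | succ n ih =>
    cases l with
    | nil => exact ⟨[], rfl⟩
    | cons z l =>
      obtain rfl := h0 z l rfl
      cases l with
      | nil => exact ⟨[z], by simp [ps]⟩
      | cons x l =>
        by_cases hx : x = z
        · obtain ⟨g, hg⟩ := ih (x :: l) (by simpa using hn) (h.mono ⟨[z], [], by simp⟩)
            (by rintro y r ⟨⟩; exact hx)
          exact ⟨z :: g, by simp [ps, ← hg]⟩
        · obtain ⟨g, hg⟩ := ih l (by simp at hn; omega) (h.mono ⟨[z, x], [], by simp⟩)
            (by
              rintro y r rfl
              exact (h x y ⟨[z], r, by simp⟩).resolve_left hx)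
          exact ⟨x :: g, by simp [ps, hx, ← hg]⟩

theorem ps_noAdj (h : List A) : NoAdj c (ps c h ++ [c]) := by
  rintro x y ⟨l, r, e⟩
  induction h generalizing l with
  | nil =>
    have := congrArg List.length e
    simp [ps] at this
    omega
  | cons z h ih =>
    obtain ⟨s, hs⟩ := ps_head c h []
    by_cases hz : z = c
    · cases l with
      | nil => simp [ps, hz] at e; exact Or.inl e.1
      | cons b l => simp [ps, hz] at e; exact ih l (by simpa using e.2)
    · match l with
      | [] => simp [ps, hz] at e; exact Or.inl e.1
      | [b] => simp [ps, hz, hs] at e; exact Or.inr e.2.2.1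
      | b :: d :: l => simp [ps, hz] at e; exact ih l (by simpa using e.2.2)

theorem ps_count (h : List A) : (ps c h).count c = h.length := by
  induction h with
  | nil => rfl
  | cons z h ih => by_cases hz : z = c <;> simp [ps, hz, ih]

end Ps

/-! Forward direction: languages of episturmian words. -/

/-- Uniqueness of left special factors. -/
def LSU (F : List A → Prop) : Prop :=
  ∀ g x y a1 a2 b1 b2, a1 ≠ a2 → b1 ≠ b2 → F (a1 :: (g ++ [x])) → F (a2 :: (g ++ [x])) →
    F (b1 :: (g ++ [y])) → F (b2 :: (g ++ [y])) → x = y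

/-- Language version of episturmian. -/
structure EpiL (F : List A → Prop) : Prop where
  inf : ∀ {u v}, u <:+: v → F v → F u
  irr : ∀ u v, F u → F v → ∃ z, F (u ++ z ++ v)
  rev : ∀ u, F u → F u.reverse
  lsu : LSU F
  ne : ∃ x, F [x]

/-- The condition on the prefixes of `u`. -/
def LCond (F : List A → Prop) (u : List A) : Prop :=
  ∀ v d, v ++ [d] <+: u → ∀ a b, F (a :: (v ++ [b])) → a = d ∨ b = d

theorem EpiL.alt {F : List A → Prop} (hF : EpiL F) (c : A)
    (h1 : ∀ y, y ≠ c → ∀ a b, F [a, y] → F [b, y] → a = b) (z : List A) :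
    ∀ a b, a ≠ c → b ≠ c → F (a :: b :: z) → c ∉ z := by
  induction z with
  | nil => simp
  | cons y z ih =>
    intro a b ha hb h
    have e1 : F [b, y] := hF.inf ⟨[a], z, by simp⟩ h
    have e2 : F [a, b] := hF.inf ⟨[], y :: z, by simp⟩ h
    obtain rfl := h1 b hb y a (by simpa using hF.rev _ e1) e2
    have := ih b y hb ha (hF.inf ⟨[y], [], by simp⟩ h)
    simp [this, ha.symm]

theorem EpiL.sep {F : List A → Prop} (hF : EpiL F) :
    ∃ c, F [c] ∧ ∀ x y, F [x, y] → x = c ∨ y = c := by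
  obtain ⟨c, hc, h1⟩ : ∃ c, F [c] ∧ ∀ y, y ≠ c → ∀ a b, F [a, y] → F [b, y] → a = b := by
    by_cases h : ∃ c a b, a ≠ b ∧ F [a, c] ∧ F [b, c]
    · obtain ⟨c, a, b, hab, ha, hb⟩ := h
      refine ⟨c, hF.inf ⟨[a], [], rfl⟩ ha, fun y hy a' b' ha' hb' => ?_⟩
      by_contra hn
      exact hy (hF.lsu [] y c a' b' a b hn hab ha' hb' ha hb)
    · obtain ⟨c, hc⟩ := hF.ne
      refine ⟨c, hc, fun y _ a b ha hb => ?_⟩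
      by_contra hn
      exact h ⟨y, a, b, hn, ha, hb⟩
  refine ⟨c, hc, fun x y hxy => ?_⟩
  by_contra hn
  push Not at hn
  obtain ⟨z, hz⟩ := hF.irr _ _ hxy hc
  have := hF.alt c h1 (z ++ [c]) x y hn.1 hn.2 (by simpa using hz)
  simp at this

theorem EpiL.ext_right {F : List A → Prop} (hF : EpiL F) {w : List A} (h : F w) :
    ∃ x, F (w ++ [x]) := by
  obtain ⟨y, hy⟩ := hF.ne
  obtain ⟨z, hz⟩ := hF.irr _ _ h hy
  cases z with
  | nil => exact ⟨y, by simpa using hz⟩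
  | cons x z => exact ⟨x, hF.inf ⟨[], z ++ [y], by simp⟩ hz⟩

theorem EpiL.ext_left {F : List A → Prop} (hF : EpiL F) {w : List A} (h : F w) :
    ∃ x, F (x :: w) := by
  obtain ⟨x, hx⟩ := hF.ext_right (hF.rev _ h)
  exact ⟨x, by simpa using hF.rev _ hx⟩

theorem EpiL.key {F : List A → Prop} [DecidableEq A] (hF : EpiL F) (c : A)
    (hc : ∀ x y, F [x, y] → x = c ∨ y = c) (a x : A) (g : List A)
    (h : F (a :: (ps c g ++ [c, x]))) : F (ps c (a :: (g ++ [x])) ++ [c]) := by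
  have e1 : F (ps c [a] ++ ps c g ++ [c, x]) := by
    by_cases ha : a = c
    · simpa [ps, ha] using h
    · obtain ⟨y, hy⟩ := hF.ext_left h
      obtain rfl := (hc y a (hF.inf ⟨[], _, rfl⟩ hy)).resolve_right ha
      simpa [ps, ha] using hy
  have e2 : F (ps c [a] ++ ps c g ++ ps c [x] ++ [c]) := by
    by_cases hx : x = c
    · simpa [ps, hx] using e1
    · obtain ⟨y, hy⟩ := hF.ext_right e1
      obtain rfl := (hc x y (hF.inf ⟨ps c [a] ++ ps c g ++ [c], [], by simp⟩ hy)).resolve_left hx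
      simpa [ps, hx] using hy
  have : a :: (g ++ [x]) = [a] ++ g ++ [x] := rfl
  rw [this, ps_append, ps_append]
  exact e2

theorem EpiL.derive {F : List A → Prop} [DecidableEq A] (hF : EpiL F) (c : A) (h0 : F [c])
    (hc : ∀ x y, F [x, y] → x = c ∨ y = c) : EpiL (fun g => F (ps c g ++ [c])) where
  inf := fun e h => hF.inf (ps_inf_mono c e) h
  irr := by
    intro u v hu hv
    obtain ⟨z, hz⟩ := hF.irr _ _ hu hv
    obtain ⟨s, hs⟩ := ps_head c v []
    obtain ⟨g, hg⟩ := ps_exists c _ (c :: z) le_rfl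
      (fun x y h => hc x y (hF.inf (h.trans ⟨ps c u, ps c v ++ [c], by simp⟩) hz))
      (by rintro x r ⟨⟩; rfl)
    refine ⟨g, ?_⟩
    simpa [ps_append, ← hg] using hz
  rev := by
    intro u hu
    have := hF.rev _ hu
    rwa [ps_reverse] at this
  lsu := by
    intro g x y a1 a2 b1 b2 ha hb h1 h2 h3 h4
    have k : ∀ a x, F (ps c (a :: (g ++ [x])) ++ [c]) → F (a :: ((ps c g ++ [c]) ++ [x])) := by
      intro a x h
      simpa using hF.inf (ps_key_enc c a x g) h
    exact hF.lsu _ x y a1 a2 b1 b2 ha hb (k _ _ h1) (k _ _ h2) (k _ _ h3) (k _ _ h4)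
  ne := by
    obtain ⟨z, hz⟩ := hF.irr _ _ h0 h0
    obtain ⟨g, hg⟩ := ps_exists c _ (c :: z) le_rfl
      (fun x y h => hc x y (hF.inf (h.trans ⟨[], [c], by simp⟩) hz))
      (by rintro x r ⟨⟩; rfl)
    cases g with
    | nil => simp [ps] at hg
    | cons x g =>
      refine ⟨x, hF.inf (ps_inf_mono c (h := x :: g) ⟨[], g, by simp⟩) ?_⟩
      rw [← hg]; simpa using hz

theorem LCond.lift {F : List A → Prop} [DecidableEq A] (hF : EpiL F) (c : A)
    (hc : ∀ x y, F [x, y] → x = c ∨ y = c) (u : List A)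
    (hu : LCond (fun g => F (ps c g ++ [c])) u) : LCond F (ps c u ++ [c]) := by
  rintro v d ⟨r, e⟩ a b h
  rcases List.eq_nil_or_concat v with rfl | ⟨v0, z, rfl⟩
  · obtain ⟨s, hs⟩ := ps_head c u []
    rw [hs] at e
    simp at e
    rw [e.1]
    exact hc a b h
  · rw [List.concat_eq_append] at e h
    by_cases hz : z = c
    · subst hz
      have e' : ps z u ++ [z] = v0 ++ z :: (d :: r) := by rw [← e]; simp
      obtain ⟨h1, h2, rfl, rfl, e3⟩ := ps_cut z e'
      obtain ⟨h4, rfl⟩ := ps_start z e3.symm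
      exact hu h1 d ⟨h4, by simp⟩ a b (hF.key z hc a b h1 (by simpa using h))
    · have hd : d = c := (ps_noAdj c u z d ⟨v0, r, by rw [← e]; simp⟩).resolve_left hz
      have hb : b = c := (hc z b (hF.inf ⟨a :: v0, [], by simp⟩ h)).resolve_left hz
      exact Or.inr (hb.trans hd.symm)

theorem ps_length [DecidableEq A] (c : A) (h : List A) : h.length ≤ (ps c h).length := by
  rw [← ps_count c h]; exact List.count_le_length

theorem LCond.pre {F : List A → Prop} {u v : List A} (h : LCond F v) (e : u <+: v) :
    LCond F u := fun x d hx => h x d (hx.trans e)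

theorem LCond.sub {F G : List A → Prop} {u : List A} (h : LCond F u) (e : ∀ w, G w → F w) :
    LCond G u := fun x d hx a b hab => h x d hx a b (e _ hab)

theorem EpiL.exists_LCond (n : ℕ) : ∀ (F : List A → Prop), EpiL F →
    ∃ u : List A, u.length = n ∧ LCond F u := by
  classical
  induction n with
  | zero =>
    intro F _
    refine ⟨[], rfl, ?_⟩
    intro v d h
    simp at h
  | succ n ih =>
    intro F hF
    obtain ⟨c, h0, hc⟩ := hF.sep
    obtain ⟨u, hl, hu⟩ := ih _ (hF.derive c h0 hc)
    have h2 := LCond.lift hF c hc u hu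
    refine ⟨(ps c u ++ [c]).take (n+1), ?_, h2.pre (List.take_prefix _ _)⟩
    have := ps_length c u
    simp; omega

/-! Backward direction: periodic words. -/

/-- Powers of a word. -/
def pw (p : List A) : ℕ → List A
  | 0 => []
  | n + 1 => p ++ pw p n

/-- Factors of powers. -/
def PF (p : List A) (f : List A) : Prop := ∃ n, f <:+: pw p n

theorem ps_pw [DecidableEq A] (c : A) (p : List A) (n : ℕ) : ps c (pw p n) = pw (ps c p) n := by
  induction n with
  | zero => rfl
  | succ n ih => simp [pw, ps_append, ih]

theorem pw_succ' (p : List A) (n : ℕ) : pw p (n + 1) = pw p n ++ p := by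
  induction n with
  | zero => simp [pw]
  | succ n ih =>
    calc p ++ pw p (n + 1) = p ++ (pw p n ++ p) := by rw [ih]
      _ = _ := by simp [pw]

/-- Good periodic words. -/
structure GoodP (p : List A) : Prop where
  ne : p ≠ []
  rev : ∀ f, PF p f → PF p f.reverse
  lsu : LSU (PF p)

theorem PF.ps_mem [DecidableEq A] (c : A) {p : List A} (hp : p ≠ []) {f : List A} (h : PF p f) :
    PF (ps c p) (ps c f ++ [c]) := by
  obtain ⟨n, h⟩ := h
  refine ⟨n + 1, (ps_inf_mono c h).trans ?_⟩
  cases p with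
  | nil => exact absurd rfl hp
  | cons x p =>
    rw [pw_succ', ps_pw]
    obtain ⟨s, hs⟩ : ∃ s, ps c (x :: p) = c :: s := by by_cases hx : x = c <;> simp [ps, hx]
    exact ⟨[], s, by simp [hs]⟩

theorem PF.ps_dec [DecidableEq A] (c : A) {p : List A} {f : List A} (h : PF (ps c p) f) :
    ∃ g, PF p g ∧ f <:+: ps c g ++ [c] := by
  obtain ⟨n, h⟩ := h
  refine ⟨pw p n, ⟨n, List.infix_rfl⟩, ?_⟩
  rw [ps_pw]
  exact h.trans ⟨[], [c], by simp⟩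

theorem PF.inf {p u v : List A} (h : PF p v) (e : u <:+: v) : PF p u :=
  h.imp fun _ hn => e.trans hn

theorem GoodP.ps [DecidableEq A] (c : A) {p : List A} (hp : GoodP p) : GoodP (ps c p) where
  ne := by
    have := ps_length c p
    have h2 := List.length_pos_iff.2 hp.ne
    exact List.length_pos_iff.1 (by omega)
  rev := by
    intro f hf
    obtain ⟨g, hg, e⟩ := hf.ps_dec
    have := PF.ps_mem c hp.ne (hp.rev g hg)
    rw [← ps_reverse] at this
    exact this.inf (List.reverse_infix.2 e)
  lsu := by
    have hna : ∀ x y, PF (_root_.ps c p) [x, y] → x = c ∨ y = c := by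
      intro x y h
      obtain ⟨g, _, e⟩ := h.ps_dec
      exact ps_noAdj c g x y e
    have key : ∀ a g x, PF (_root_.ps c p) (a :: (_root_.ps c g ++ [c, x])) →
        PF p (a :: (g ++ [x])) := by
      intro a g x h
      obtain ⟨k, hk, e⟩ := h.ps_dec
      exact hk.inf (ps_key_dec c e)
    intro g x y a1 a2 b1 b2 ha hb h1 h2 h3 h4
    cases g with
    | nil =>
      by_contra hxy
      have hx : x = c := by
        by_contra hx
        exact ha (((hna _ _ h1).resolve_right hx).trans ((hna _ _ h2).resolve_right hx).symm)
      have hy : y = c := by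
        by_contra hx
        exact hb (((hna _ _ h3).resolve_right hx).trans ((hna _ _ h4).resolve_right hx).symm)
      exact hxy (hx.trans hy.symm)
    | cons z g =>
      have hz : z = c := by
        by_contra hz
        exact ha (((hna _ _ (h1.inf ⟨[], g ++ [x], by simp⟩)).resolve_right hz).trans
          ((hna _ _ (h2.inf ⟨[], g ++ [x], by simp⟩)).resolve_right hz).symm)
      obtain ⟨g0, e, he⟩ : ∃ g0 e, z :: g = g0 ++ [e] := by
        rcases List.eq_nil_or_concat (z :: g) with h | ⟨g0, e, h⟩
        · simp at h
        · exact ⟨g0, e, by simpa using h⟩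
      by_cases hec : e = c
      · subst hec
        obtain ⟨k, hk⟩ := ps_exists e _ g0 le_rfl
          (fun x' y' h => hna x' y' (h1.inf (h.trans ⟨[a1], [e, x], by rw [he]; simp⟩)))
          (by rintro x' r rfl; simp at he; rw [← he.1, hz])
        rw [he, hk] at h1 h2 h3 h4
        exact hp.lsu k x y a1 a2 b1 b2 ha hb (key _ _ _ (by simpa using h1))
          (key _ _ _ (by simpa using h2)) (key _ _ _ (by simpa using h3))
          (key _ _ _ (by simpa using h4))
      · rw [he] at h1 h3
        have hx := (hna e x (h1.inf ⟨a1 :: g0, [], by simp⟩)).resolve_left hec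
        have hy := (hna e y (h3.inf ⟨b1 :: g0, [], by simp⟩)).resolve_left hec
        exact hx.trans hy.symm

theorem mem_pw {p : List A} {n : ℕ} {x : A} (h : x ∈ pw p n) : x ∈ p := by
  induction n with
  | zero => simp [pw] at h
  | succ n ih => simp [pw] at h; exact h.elim id ih

theorem pw_single (x : A) (n : ℕ) : pw [x] n = List.replicate n x := by
  induction n with
  | zero => rfl
  | succ n ih => simp [pw, ih, List.replicate_succ]

theorem GoodP.single (x : A) : GoodP [x] where
  ne := by simp
  rev := by
    rintro f ⟨n, h⟩
    refine ⟨n, ?_⟩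
    have := List.reverse_infix.2 h
    simpa [pw_single] using this
  lsu := by
    rintro g u v a1 a2 b1 b2 ha _ ⟨n, h1⟩ ⟨m, h2⟩
    have e1 := mem_pw (h1.subset (List.mem_cons_self))
    have e2 := mem_pw (h2.subset (List.mem_cons_self))
    simp at e1 e2
    exact absurd (e1.trans e2.symm) ha

theorem infix_strip_left {c a : A} {f w : List A} (h : a :: c :: f <:+: c :: w)
    (hw : ∀ x r, w = x :: r → x ≠ c) : a :: c :: f <:+: w := by
  rcases List.infix_cons_iff.1 h with h | h
  · obtain ⟨r, h⟩ := h
    simp at h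
    exact absurd rfl (hw c _ h.2.symm)
  · exact h

theorem infix_strip_right {c b : A} {f w : List A} (h : f ++ [c, b] <:+: w ++ [c])
    (hw : ∀ x r, w = r ++ [x] → x ≠ c) : f ++ [c, b] <:+: w := by
  rw [← List.reverse_infix] at h ⊢
  simp only [List.reverse_append, List.reverse_cons, List.reverse_nil, List.nil_append,
    List.cons_append] at h ⊢
  refine infix_strip_left h ?_
  intro x r hx
  refine hw x r.reverse ?_
  have := congrArg List.reverse hx
  simpa using this

theorem exists_fix [DecidableEq A] (w : List A) (c : A) (u : List A) (hu : LCond (· <:+: w) (c :: u))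
    (hl : w.length ≤ (c :: u).length) (N : ℕ) :
    ∃ g, g.length = N ∧ LCond (· <:+: w) (ps c g ++ [c]) ∧
      ((ps c g ++ [c] <+: c :: u) ∨
        ∃ y, ∀ a b, a :: ((ps c g ++ [c]) ++ [b]) <:+: w → a = y) := by
  have hna : NoAdj c w := by
    intro x y h
    exact hu [] c ⟨u, rfl⟩ x y h
  -- extension step
  have step : ∀ g d, LCond (· <:+: w) (ps c g ++ [c]) →
      (∀ a b, a :: ((ps c g ++ [c]) ++ [b]) <:+: w → a = d ∨ b = d) →
      LCond (· <:+: w) (ps c (g ++ [d]) ++ [c]) := by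
    intro g d h1 h2
    have h3 : LCond (· <:+: w) (ps c g ++ [c] ++ [d]) := by
      intro v e hv a b hab
      rcases List.prefix_concat_iff.1 hv with hv | hv
      · obtain ⟨rfl, hv⟩ := List.append_inj' hv rfl
        simp at hv
        subst hv
        exact h2 a b hab
      · exact h1 v e hv a b hab
    rw [ps_append]
    by_cases hd : d = c
    · subst hd
      simpa [ps] using h3
    · have : ps c g ++ ps c [d] ++ [c] = (ps c g ++ [c] ++ [d]) ++ [c] := by simp [ps, hd]
      rw [this]
      intro v e hv a b hab
      rcases List.prefix_concat_iff.1 hv with hv | hv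
      · obtain ⟨rfl, hv⟩ := List.append_inj' hv rfl
        simp at hv
        subst hv
        right
        refine (hna d b (List.IsInfix.trans ⟨a :: (ps e g ++ [e]), [], by simp⟩ hab)).resolve_left hd
      · exact h3 v e hv a b hab
  induction N with
  | zero =>
    refine ⟨[], rfl, hu.pre ⟨u, rfl⟩, Or.inl ⟨u, rfl⟩⟩
  | succ N ih =>
    obtain ⟨g, hg, h1, h2⟩ := ih
    rcases h2 with ⟨s, h2⟩ | ⟨y, h2⟩
    · cases s with
      | nil =>
        refine ⟨g ++ [c], by simp [hg], step g c h1 ?_, Or.inr ⟨c, ?_⟩⟩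
        · intro a b hab
          have := hab.length_le
          rw [← h2] at hl
          simp at hl this
          omega
        · intro a b hab
          have := hab.length_le
          rw [← h2] at hl
          simp [ps_append] at hl this
          omega
      | cons d s =>
        have hd : ∀ a b, a :: ((ps c g ++ [c]) ++ [b]) <:+: w → a = d ∨ b = d :=
          hu _ d ⟨s, by simpa using h2⟩
        refine ⟨g ++ [d], by simp [hg], step g d h1 hd, ?_⟩
        by_cases hdc : d = c
        · left
          subst hdc
          exact ⟨s, by rw [← h2]; simp [ps_append, ps]⟩
        · cases s with
          | nil =>
            right
            refine ⟨c, ?_⟩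
            intro a b hab
            have := hab.length_le
            rw [← h2] at hl
            simp [ps_append, ps, hdc] at hl this
            omega
          | cons e s =>
            by_cases hec : e = c
            · left
              subst hec
              exact ⟨s, by rw [← h2]; simp [ps_append, ps, hdc]⟩
            · right
              refine ⟨e, ?_⟩
              intro a b hab
              refine (hu (ps c g ++ [c] ++ [d]) e ⟨s, by rw [← h2]; simp⟩ a c ?_).resolve_right
                (Ne.symm hec)
              exact List.IsInfix.trans ⟨[], [b], by simp [ps_append, ps, hdc]⟩ hab
    · refine ⟨g ++ [y], by simp [hg], step g y h1 fun a b h => Or.inl (h2 a b h), Or.inr ⟨y, ?_⟩⟩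
      intro a b hab
      by_cases hy : y = c
      · refine h2 a c (List.IsInfix.trans ⟨[], [b], ?_⟩ hab)
        simp [ps_append, ps, hy]
      · refine h2 a y (List.IsInfix.trans ⟨[], [c, b], ?_⟩ hab)
        simp [ps_append, ps, hy]

theorem exists_wprime [DecidableEq A] (w : List A) (c : A) (hna : NoAdj c w) (h2 : 2 ≤ w.length) :
    ∃ w', w'.length < w.length ∧ w <:+: ps c w' ++ [c] ∧
      ∀ a v b, a :: (v ++ [b]) <:+: w' → a :: ((ps c v ++ [c]) ++ [b]) <:+: w := by
  -- pad on the left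
  obtain ⟨x0, m, y0, rfl⟩ : ∃ x0 m y0, w = x0 :: (m ++ [y0]) := by
    cases w with
    | nil => simp at h2
    | cons x0 w =>
      rcases List.eq_nil_or_concat w with rfl | ⟨m, y0, rfl⟩
      · simp at h2
      · exact ⟨x0, m, y0, by simp⟩
  set w := x0 :: (m ++ [y0]) with hw
  obtain ⟨pre, hpre⟩ : ∃ pre : List A, (x0 = c ∧ pre = []) ∨ (x0 ≠ c ∧ pre = [c]) := by
    by_cases h : x0 = c
    · exact ⟨[], Or.inl ⟨h, rfl⟩⟩
    · exact ⟨[c], Or.inr ⟨h, rfl⟩⟩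
  obtain ⟨body, post, hb1, hb2⟩ : ∃ body post : List A, pre ++ w ++ post = body ++ [c] ∧
      ((y0 = c ∧ post = []) ∨ (y0 ≠ c ∧ post = [c])) := by
    by_cases h : y0 = c
    · exact ⟨pre ++ x0 :: m, [], by simp [hw, h], Or.inl ⟨h, rfl⟩⟩
    · exact ⟨pre ++ w, [c], by simp, Or.inr ⟨h, rfl⟩⟩
  have hbody : ∃ g, body = ps c g := by
    refine ps_exists c _ body le_rfl ?_ ?_
    · have hpw : NoAdj c (pre ++ w) := by
        rcases hpre with ⟨_, rfl⟩ | ⟨_, rfl⟩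
        · simpa using hna
        · intro x y h
          rcases List.infix_cons_iff.1 h with ⟨r, h⟩ | h
          · simp at h; exact Or.inl h.1
          · exact hna x y h
      refine hpw.mono ?_
      rcases hb2 with ⟨_, rfl⟩ | ⟨_, rfl⟩
      · exact ⟨[], [c], by simpa using hb1.symm⟩
      · have := List.append_inj_left' hb1 rfl
        rw [this]
    · rintro x r rfl
      rcases hpre with ⟨h, rfl⟩ | ⟨h, rfl⟩
      · simp [hw] at hb1; rw [← hb1.1, h]
      · simp [hw] at hb1; exact hb1.1.symm
  obtain ⟨g, rfl⟩ := hbody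
  refine ⟨g, ?_, ⟨pre, post, hb1⟩, ?_⟩
  · have hc := congrArg (List.count c) hb1
    have hle := List.count_le_length (a := c) (l := m)
    rw [List.count_append, List.count_append, List.count_append, ps_count] at hc
    rcases hpre with ⟨h, rfl⟩ | ⟨h, rfl⟩ <;> rcases hb2 with ⟨h', rfl⟩ | ⟨h', rfl⟩ <;>
      simp [hw, List.count_cons, h, h'] at hc ⊢ <;> omega
  · intro a v b h
    have h3 : a :: (ps c v ++ [c, b]) <:+: pre ++ w ++ post := by
      rw [hb1]
      exact (ps_key_enc c a b v).trans (ps_inf_mono c h)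
    have h4 : a :: (ps c v ++ [c, b]) <:+: pre ++ w := by
      rcases hb2 with ⟨h', rfl⟩ | ⟨h', rfl⟩
      · simpa using h3
      · refine infix_strip_right (f := a :: ps c v) h3 ?_
        rintro x r hx
        have : pre ++ w = (pre ++ x0 :: m) ++ [y0] := by simp [hw]
        rw [this] at hx
        have := List.append_inj_right' hx rfl
        simp at this
        rw [← this]; exact h'
    have h5 : a :: (ps c v ++ [c, b]) <:+: w := by
      rcases hpre with ⟨h', rfl⟩ | ⟨h', rfl⟩
      · simpa using h4
      · obtain ⟨s, hs⟩ := ps_head c v [b]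
        rw [hs] at h4 ⊢
        refine infix_strip_left h4 ?_
        rintro x r hx
        simp [hw] at hx
        rw [← hx.1]; exact h'
    simpa using h5

theorem exists_goodP [Nonempty A] (n : ℕ) : ∀ (w u : List A), w.length ≤ n →
    w.length ≤ u.length → LCond (· <:+: w) u → ∃ p, GoodP p ∧ PF p w := by
  classical
  induction n with
  | zero =>
    intro w u hn _ _
    obtain ⟨x⟩ := ‹Nonempty A›
    refine ⟨[x], GoodP.single x, 0, ?_⟩
    have : w = [] := by simpa using hn
    rw [this]; exact List.nil_infix
  | succ n ih =>
    intro w u hn hl hu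
    match w, u with
    | [], u =>
      obtain ⟨x⟩ := ‹Nonempty A›
      exact ⟨[x], GoodP.single x, 0, List.nil_infix⟩
    | [x], u => exact ⟨[x], GoodP.single x, 1, by simp [pw]⟩
    | x :: y :: w, [] => simp at hl
    | x :: y :: w, c :: u =>
      obtain ⟨w', h1, h2, h3⟩ := exists_wprime (x :: y :: w) c (hu [] c ⟨u, rfl⟩) (by simp)
      obtain ⟨g, hg, hL, _⟩ := exists_fix _ c u hu hl w'.length
      have hL' : LCond (· <:+: w') g := by
        rintro v d ⟨r, rfl⟩ a b hab
        obtain ⟨s, hs⟩ := ps_cons_start c d r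
        refine hL (ps c v ++ [c]) d ⟨s, ?_⟩ a b (h3 a v b hab)
        have : v ++ [d] ++ r = v ++ (d :: r) := by simp
        rw [this, ps_append, List.append_assoc (ps c v) (ps c (d :: r)), hs]
        simp
      obtain ⟨p, hp, hw⟩ := ih w' g (by omega) (by omega) hL'
      exact ⟨ps c p, hp.ps c, (PF.ps_mem c hp.ne hw).inf h2⟩

/-! Infinite words. -/

/-- Segment of an infinite word. -/
def seg (t : ℕ → A) (i n : ℕ) : List A := (List.range n).map fun j => t (i + j)

theorem seg_length (t : ℕ → A) (i n : ℕ) : (seg t i n).length = n := by simp [seg]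

theorem seg_add (t : ℕ → A) (i m n : ℕ) : seg t i (m + n) = seg t i m ++ seg t (i + m) n := by
  simp [seg, List.range_add, Function.comp_def, Nat.add_assoc]

theorem seg_one (t : ℕ → A) (i : ℕ) : seg t i 1 = [t i] := by simp [seg]

theorem prefixList_eq (t : ℕ → A) (k : ℕ) : prefixList t k = seg t 0 k := by
  simp [seg, prefixList]

theorem factorAt_iff (t : ℕ → A) (u : List A) (i : ℕ) :
    FactorAt t u i ↔ u = seg t i u.length := Iff.rfl

theorem isFactor_seg (t : ℕ → A) (i n : ℕ) : IsFactorInf t (seg t i n) :=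
  ⟨i, by rw [factorAt_iff, seg_length]⟩

theorem isFactor_iff (t : ℕ → A) (u : List A) : IsFactorInf t u ↔ ∃ i, u = seg t i u.length :=
  Iff.rfl

theorem seg_split {t : ℕ → A} {i k : ℕ} {l r : List A} (h : l ++ r = seg t i k) :
    l = seg t i l.length ∧ r = seg t (i + l.length) r.length := by
  have hk : k = l.length + r.length := by
    have := congrArg List.length h
    rw [seg_length] at this
    simpa using this.symm
  rw [hk, seg_add] at h
  exact List.append_inj h (by rw [seg_length])

theorem isFactor_inf {t : ℕ → A} {u v : List A} (e : u <:+: v) (h : IsFactorInf t v) :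
    IsFactorInf t u := by
  obtain ⟨i, h⟩ := h
  rw [factorAt_iff] at h
  obtain ⟨l, r, rfl⟩ := e
  obtain ⟨h1, _⟩ := seg_split h
  rw [List.length_append] at h1
  have h2 := seg_split (h1.trans rfl)
  exact ⟨_, h2.2⟩

theorem rev_recurrent {t : ℕ → A} (h : ∀ u, IsFactorInf t u → IsFactorInf t u.reverse)
    {f : List A} (hf : IsFactorInf t f) (N : ℕ) : ∃ i, N ≤ i ∧ f = seg t i f.length := by
  have key : ∀ f, IsFactorInf t f → ∃ i, N ≤ i ∧ f.reverse = seg t i f.reverse.length := by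
    rintro f ⟨i, hi⟩
    rw [factorAt_iff] at hi
    obtain ⟨j, hj⟩ := h _ (isFactor_seg t 0 (i + f.length + N))
    rw [factorAt_iff] at hj
    generalize (seg t 0 (i + f.length + N)).reverse.length = K at hj
    rw [seg_add, seg_add, Nat.zero_add, ← hi] at hj
    simp only [List.reverse_append] at hj
    have h2 := (seg_split hj).2
    rw [List.length_append] at h2
    have h3 := (seg_split h2).1
    refine ⟨_, ?_, h3⟩
    rw [List.length_reverse, seg_length]
    omega
  have := key _ (h _ hf)
  simpa using this

theorem Episturmian.lsu {t : ℕ → A} (h : Episturmian t) : LSU (IsFactorInf t) := by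
  intro g x y a1 a2 b1 b2 ha hb h1 h2 h3 h4
  have k : ∀ x a, IsFactorInf t (a :: (g ++ [x])) → IsFactorInf t ((g ++ [x]).reverse ++ [a]) := by
    intro x a h'
    have := h.1 _ h'
    rwa [List.reverse_cons] at this
  have := h.2 (g ++ [x]).reverse (g ++ [y]).reverse ⟨a1, a2, ha, k _ _ h1, k _ _ h2⟩
    ⟨b1, b2, hb, k _ _ h3, k _ _ h4⟩ (by simp)
  simpa using this

theorem Episturmian.epiL {t : ℕ → A} (h : Episturmian t) : EpiL (IsFactorInf t) where
  inf := isFactor_inf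
  irr := by
    rintro u v ⟨i, hu⟩ hv
    obtain ⟨j, hj, hv⟩ := rev_recurrent h.1 hv (i + u.length)
    rw [factorAt_iff] at hu
    refine ⟨seg t (i + u.length) (j - (i + u.length)), i, ?_⟩
    have : u ++ seg t (i + u.length) (j - (i + u.length)) ++ v
        = seg t i (u.length + (j - (i + u.length)) + v.length) := by
      rw [seg_add, seg_add, ← hu]
      have e : i + (u.length + (j - (i + u.length))) = j := by omega
      rw [e, ← hv]
    rw [factorAt_iff, this, seg_length]
  rev := h.1
  lsu := h.lsu
  ne := ⟨t 0, by rw [← seg_one]; exact isFactor_seg t 0 1⟩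

theorem prefix_diff {u v : List A} (h : u.length = v.length) (hne : u ≠ v) :
    ∃ g x y, x ≠ y ∧ g ++ [x] <+: u ∧ g ++ [y] <+: v := by
  induction u generalizing v with
  | nil => cases v with
    | nil => simp at hne
    | cons => simp at h
  | cons a u ih =>
    cases v with
    | nil => simp at h
    | cons b v =>
      by_cases hab : a = b
      · subst hab
        obtain ⟨g, x, y, hxy, h1, h2⟩ := ih (by simpa using h) (by simpa using hne)
        exact ⟨a :: g, x, y, hxy, by simpa using h1, by simpa using h2⟩
      · exact ⟨[], a, b, hab, by simp, by simp⟩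

theorem episturmian_of_lsu {t : ℕ → A} (h1 : ∀ u, IsFactorInf t u → IsFactorInf t u.reverse)
    (h2 : LSU (IsFactorInf t)) : Episturmian t := by
  refine ⟨h1, ?_⟩
  rintro u v ⟨a1, a2, ha, e1, e2⟩ ⟨b1, b2, hb, e3, e4⟩ hl
  by_contra hne
  obtain ⟨g, x, y, hxy, hu, hv⟩ := prefix_diff (u := u.reverse) (v := v.reverse) (by simpa using hl)
    (by simpa using hne)
  have k : ∀ u g x a, IsFactorInf t (u ++ [a]) → g ++ [x] <+: u.reverse →
      IsFactorInf t (a :: (g ++ [x])) := by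
    intro u g x a h hp
    have := h1 _ h
    rw [List.reverse_append] at this
    refine isFactor_inf ?_ this
    obtain ⟨r, hr⟩ := hp
    exact ⟨[], r, by rw [← hr]; simp⟩
  exact hxy (h2 g x y a1 a2 b1 b2 ha hb (k _ _ _ _ e1 hu) (k _ _ _ _ e2 hu) (k _ _ _ _ e3 hv)
    (k _ _ _ _ e4 hv))

theorem pw_seg {p : List A} {t : ℕ → A} (ht : ∀ k, seg t (k * p.length) p.length = p) (n : ℕ) :
    seg t 0 (n * p.length) = pw p n := by
  induction n with
  | zero => simp [seg, pw]
  | succ n ih => rw [Nat.succ_mul, seg_add, ih, pw_succ', Nat.zero_add, ht]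

theorem exists_periodic {p : List A} (hp : p ≠ []) :
    ∃ t : ℕ → A, ∀ f, IsFactorInf t f ↔ PF p f := by
  have hl := List.length_pos_iff.2 hp
  let t : ℕ → A := fun i => p[i % p.length]'(Nat.mod_lt _ hl)
  have ht : ∀ k, seg t (k * p.length) p.length = p := by
    intro k
    refine List.ext_getElem (by rw [seg_length]) ?_
    intro i h1 h2
    simp [seg, t, Nat.mod_eq_of_lt h2]
  refine ⟨t, fun f => ⟨?_, ?_⟩⟩
  · rintro ⟨i, hi⟩
    rw [factorAt_iff] at hi
    refine ⟨i + f.length, ?_⟩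
    rw [← pw_seg ht]
    obtain ⟨d, hd⟩ := Nat.exists_eq_add_of_le (Nat.le_mul_of_pos_right (i + f.length) hl)
    rw [hd, seg_add, seg_add, Nat.zero_add, ← hi]
    exact ⟨_, _, rfl⟩
  · rintro ⟨n, hn⟩
    rw [← pw_seg ht] at hn
    exact isFactor_inf hn (isFactor_seg _ _ _)

theorem finiteEpisturmian_of_LCond [Nonempty A] {w u : List A} (hl : w.length ≤ u.length)
    (h : LCond (· <:+: w) u) : FiniteEpisturmian w := by
  obtain ⟨p, hp, hw⟩ := exists_goodP _ w u le_rfl hl h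
  obtain ⟨t, ht⟩ := exists_periodic hp.ne
  have e : IsFactorInf t = PF p := by funext f; exact propext (ht f)
  refine ⟨t, episturmian_of_lsu ?_ ?_, (ht w).2 hw⟩
  · rw [e]; exact hp.rev
  · rw [e]; exact hp.lsu

/-- Order-free form of the lexicographic condition. -/
def LInf (t u : ℕ → A) : Prop := ∀ n, LCond (IsFactorInf t) (seg u 0 n)

theorem wide_of_LInf {t u : ℕ → A} (h : LInf t u) (w : List A) (hw : IsFactorInf t w) :
    FiniteEpisturmian w := by
  haveI : Nonempty A := ⟨t 0⟩
  exact finiteEpisturmian_of_LCond (u := seg u 0 w.length) (by rw [seg_length])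
    ((h _).sub fun v hv => isFactor_inf hv hw)

theorem LInf_of_wide [Finite A] {t : ℕ → A}
    (h : ∀ w, IsFactorInf t w → FiniteEpisturmian w) : ∃ u, LInf t u := by
  have h1 : ∀ n, ∃ u : ℕ → A, LCond (· <:+: seg t 0 n) (seg u 0 n) := by
    intro n
    obtain ⟨s, hs, hf⟩ := h _ (isFactor_seg t 0 n)
    obtain ⟨u, hu, hL⟩ := hs.epiL.exists_LCond n
    refine ⟨fun i => u.getD i (t 0), ?_⟩
    have : seg (fun i => u.getD i (t 0)) 0 n = u := by
      refine List.ext_getElem (by rw [seg_length, hu]) ?_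
      intro i h1 h2
      simp [seg, h2]
    rw [this]
    exact hL.sub fun v hv => isFactor_inf hv hf
  choose U hU using h1
  have h2 : ∀ k, ∃ x, ∀ᶠ n in (Filter.hyperfilter ℕ : Filter ℕ), U n k = x := by
    intro k
    obtain ⟨x, hx⟩ := ((Filter.hyperfilter ℕ).map fun n => U n k).eq_pure_of_finite
    refine ⟨x, ?_⟩
    have : ({x} : Set A) ∈ (Filter.hyperfilter ℕ).map fun n => U n k := by
      rw [hx]; exact rfl
    exact this
  choose u hu using h2
  refine ⟨u, fun n v d hv a b hab => ?_⟩
  obtain ⟨i, hi⟩ := hab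
  rw [factorAt_iff] at hi
  have h3 : ∀ᶠ m in (Filter.hyperfilter ℕ : Filter ℕ), ∀ k ∈ Finset.range n, U m k = u k := by
    rw [Filter.eventually_all_finset]
    exact fun k _ => hu k
  have h4 : ∀ᶠ m in (Filter.hyperfilter ℕ : Filter ℕ), n + i + (a :: (v ++ [b])).length ≤ m := by
    have : ∀ᶠ m in Filter.cofinite, n + i + (a :: (v ++ [b])).length ≤ m := by
      rw [Nat.cofinite_eq_atTop]; exact Filter.eventually_ge_atTop _
    exact Filter.hyperfilter_le_cofinite this
  obtain ⟨m, hm1, hm2⟩ := (h3.and h4).exists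
  have e : seg u 0 n = seg (U m) 0 n := by
    refine List.ext_getElem (by simp [seg_length]) ?_
    intro j h1 h2
    rw [seg_length] at h1
    simp [seg, hm1 j (Finset.mem_range.2 h1)]
  refine hU m v d ?_ a b ?_
  · refine hv.trans ?_
    rw [e]
    obtain ⟨q, rfl⟩ := Nat.exists_eq_add_of_le (show n ≤ m by omega)
    rw [seg_add]; exact ⟨_, rfl⟩
  · obtain ⟨q, hq⟩ := Nat.exists_eq_add_of_le (show i + (a :: (v ++ [b])).length ≤ m by omega)
    have : seg t 0 m = seg t 0 i ++ (a :: (v ++ [b])) ++ seg t (0 + (i + (a :: (v ++ [b])).length)) q := by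
      conv_lhs => rw [hq, seg_add, seg_add, Nat.zero_add, ← hi]
    show _ <:+: _
    rw [this]
    exact ⟨_, _, rfl⟩

/-! Orders. -/

theorem exists_order [Finite A] (a b d : A) (ha : d ≠ a) (hb : d ≠ b) :
    ∃ r : A → A → Prop, AcceptablePair r a ∧ r b d := by
  classical
  obtain ⟨n, ⟨e⟩⟩ := Finite.exists_equiv_fin A
  let f : A → ℕ := fun x => if x = a then 0 else if x = b then 1 else (e x : ℕ) + 2
  have hf : Function.Injective f := by
    intro x y h
    simp only [f] at h
    split_ifs at h with h1 h2 h3 h4 h5 h6 <;> try omega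
    · rw [h1, h2]
    · rw [h4, h6]
    · exact e.injective (Fin.ext (by omega))
  refine ⟨fun x y => f x < f y, ⟨?_, ?_⟩, ?_⟩
  · exact { trichotomous := fun x y h1 h2 => hf (by omega)
            irrefl := fun x => lt_irrefl _
            trans := fun x y z => lt_trans }
  · intro x hx
    simp only [f, hx, if_true, if_false]
    split_ifs <;> omega
  · simp only [f, ha, hb, if_false]
    split_ifs <;> omega

theorem listLe_total {r : A → A → Prop} (hr : IsStrictTotalOrder A r) {u v : List A}
    (h : u.length = v.length) : listLe r u v ∨ List.Lex r v u := by
  by_cases hne : u = v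
  · exact Or.inl (Or.inl hne)
  · obtain ⟨g, x, y, hxy, ⟨s, hs⟩, ⟨s', hs'⟩⟩ := prefix_diff h hne
    have key : ∀ g s s' (x y : A), r x y → List.Lex r (g ++ [x] ++ s) (g ++ [y] ++ s') := by
      intro g s s' x y hxy
      induction g with
      | nil => exact List.Lex.rel hxy
      | cons z g ih => exact List.Lex.cons ih
    rw [← hs, ← hs']
    by_cases h1 : r x y
    · exact Or.inl (Or.inr (key _ _ _ _ _ h1))
    · by_cases h2 : r y x
      · exact Or.inr (key _ _ _ _ _ h2)
      · exact absurd (hr.trichotomous x y h1 h2) hxy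

theorem lex_iff {r : A → A → Prop} {u v : List A} (h : u.length = v.length)
    (hL : List.Lex r u v) :
    ∃ g x y s s', r x y ∧ u = g ++ x :: s ∧ v = g ++ y :: s' := by
  induction hL with
  | nil => simp at h
  | cons _ ih =>
    obtain ⟨g, x, y, s, s', h1, rfl, rfl⟩ := ih (by simpa using h)
    exact ⟨_ :: g, x, y, s, s', h1, rfl, rfl⟩
  | rel h' => exact ⟨[], _, _, _, _, h', rfl, rfl⟩

theorem lex_intro {r : A → A → Prop} (g s s' : List A) {x y : A} (hxy : r x y) :
    List.Lex r (g ++ x :: s) (g ++ y :: s') := by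
  induction g with
  | nil => exact List.Lex.rel hxy
  | cons z g ih => exact List.Lex.cons ih

theorem lex_irrefl {r : A → A → Prop} (hr : IsStrictTotalOrder A r) (u : List A) :
    ¬ List.Lex r u u := by
  intro h
  obtain ⟨g, x, y, s, s', h1, h2, h3⟩ := lex_iff rfl h
  rw [h2] at h3
  have := List.append_cancel_left h3
  simp at this
  rw [this.1] at h1
  exact hr.irrefl _ h1

theorem lex_trans {r : A → A → Prop} (hr : IsStrictTotalOrder A r) {u v w : List A}
    (h1 : List.Lex r u v) (h2 : List.Lex r v w) : List.Lex r u w := by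
  induction h1 generalizing w with
  | nil => cases h2 <;> exact List.Lex.nil
  | cons h ih =>
    cases h2 with
    | cons h' => exact List.Lex.cons (ih h')
    | rel h' => exact List.Lex.rel h'
  | rel h =>
    cases h2 with
    | cons h' => exact List.Lex.rel h
    | rel h' => exact List.Lex.rel (hr.trans _ _ _ h h')

theorem exists_min_fac [Finite A] {r : A → A → Prop} (hr : IsStrictTotalOrder A r) (t : ℕ → A)
    (k : ℕ) : ∃ m, IsFactorInf t m ∧ m.length = k ∧
      ∀ u, IsFactorInf t u → u.length = k → listLe r m u := by
  have hfin : {u : List A | u.length = k}.Finite := List.finite_length_eq A k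
  have hS : {u : List A | IsFactorInf t u ∧ u.length = k}.Finite :=
    hfin.subset fun u hu => hu.2
  haveI : IsTrans (List A) (List.Lex r) := ⟨fun _ _ _ => lex_trans hr⟩
  haveI : Std.Irrefl (List.Lex r) := ⟨lex_irrefl hr⟩
  haveI : IsStrictOrder (List A) (List.Lex r) := {}
  have hwf := hS.wellFoundedOn (r := List.Lex r)
  obtain ⟨m, hm⟩ : ∃ m : List A, m ∈ {u : List A | IsFactorInf t u ∧ u.length = k} ∧
      ∀ u ∈ {u : List A | IsFactorInf t u ∧ u.length = k}, ¬ List.Lex r u m := by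
    obtain ⟨m, -, hm⟩ := hwf.has_min Set.univ ⟨⟨seg t 0 k, isFactor_seg _ _ _, seg_length _ _ _⟩, trivial⟩
    exact ⟨m.1, m.2, fun u hu => hm ⟨u, hu⟩ trivial⟩
  refine ⟨m, hm.1.1, hm.1.2, fun u h1 h2 => ?_⟩
  exact (listLe_total hr (hm.1.2.trans h2.symm)).resolve_right (hm.2 u ⟨h1, h2⟩)

theorem exists_min [Finite A] {r : A → A → Prop} (hr : IsStrictTotalOrder A r) (t : ℕ → A) :
    ∃ m, IsMinInf r t m := by
  choose M hM1 hM2 hM3 using exists_min_fac hr t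
  have hstep : ∀ k, ∃ x, M (k + 1) = M k ++ [x] := by
    intro k
    obtain ⟨q, y, hq⟩ : ∃ q y, M (k + 1) = q ++ [y] := by
      rcases List.eq_nil_or_concat (M (k + 1)) with h | ⟨q, y, h⟩
      · have := hM2 (k + 1)
        rw [h] at this
        simp at this
      · exact ⟨q, y, by simpa using h⟩
    have hql : q.length = k := by
      have := hM2 (k + 1)
      rw [hq] at this
      simpa using this
    have hqf : IsFactorInf t q := isFactor_inf (v := M (k + 1)) ⟨[], [y], by simp [hq]⟩ (hM1 _)
    rcases hM3 k q hqf hql with h | h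
    · exact ⟨y, by rw [hq, h]⟩
    · exfalso
      obtain ⟨i, hi⟩ := hM1 k
      rw [factorAt_iff, hM2] at hi
      have hf : IsFactorInf t (M k ++ [t (i + k)]) := by
        have := isFactor_seg t i (k + 1)
        rwa [seg_add, ← hi, seg_one] at this
      obtain ⟨g, x, z, s, s', h1, h2, h3⟩ := lex_iff ((hM2 k).trans hql.symm) h
      have hlt : List.Lex r (M k ++ [t (i + k)]) (M (k + 1)) := by
        rw [hq, h2, h3, List.append_assoc, List.append_assoc]
        exact lex_intro _ _ _ h1
      rcases hM3 (k + 1) _ hf (by simp [hM2]) with h | h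
      · rw [← h] at hlt
        exact lex_irrefl hr _ hlt
      · exact lex_irrefl hr _ (lex_trans hr h hlt)
  choose m hm using hstep
  have h : ∀ k, prefixList m k = M k := by
    intro k
    induction k with
    | zero => simpa [prefixList] using (hM2 0)
    | succ k ih =>
      rw [hm, ← ih, prefixList_eq, prefixList_eq, seg_add, seg_one, Nat.zero_add]
  refine ⟨m, fun k => ?_⟩
  rw [h]
  exact ⟨hM1 k, hM3 k⟩

theorem LInf_of_lex [Finite A] {t u : ℕ → A}
    (h : ∀ (r : A → A → Prop) (a : A), AcceptablePair r a →
        ∀ m : ℕ → A, IsMinInf r t m → infLe r (consInf a u) m) : LInf t u := by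
  intro n v d hv a b hab
  by_contra hn
  push Not at hn
  obtain ⟨r, hr, hbd⟩ := exists_order a b d hn.1.symm hn.2.symm
  obtain ⟨m, hm⟩ := exists_min hr.1 t
  have hle := h r a hr m hm
  -- prefix of `a u`
  have e1 : prefixList (consInf a u) (v.length + 2) = a :: (v ++ [d]) := by
    obtain ⟨s, hs⟩ := hv
    have h1 := (seg_split hs).1
    rw [prefixList_eq, Nat.add_comm]
    have : seg (consInf a u) 0 (1 + (v.length + 1)) = a :: seg u 0 (v.length + 1) := by
      rw [seg_add, seg_one]
      simp only [consInf, List.singleton_append]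
      congr 1
      simp only [seg]
      apply List.map_congr_left
      intro j _
      rw [Nat.zero_add, Nat.zero_add, Nat.add_comm]
      rfl
    have e : 2 + v.length = 1 + (v.length + 1) := by omega
    rw [e, this]
    rw [List.length_append] at h1
    rw [h1]
    rfl
  have hlt : List.Lex r (a :: (v ++ [b])) (prefixList (consInf a u) (v.length + 2)) := by
    rw [e1]
    exact lex_intro (a :: v) [] [] hbd
  have h2 := (hm (v.length + 2)).2 _ hab (by simp)
  have hlt2 : List.Lex r (prefixList m (v.length + 2)) (prefixList (consInf a u) (v.length + 2)) := by
    rcases h2 with h2 | h2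
    · rw [h2]; exact hlt
    · exact lex_trans hr.1 h2 hlt
  rcases hle with hle | ⟨i, h3, h4⟩
  · rw [hle] at hlt2
    exact lex_irrefl hr.1 _ hlt2
  · generalize consInf a u = x at *
    have e2 : ∀ k, k ≤ i → seg x 0 k = seg m 0 k := by
      intro k hk
      simp only [seg]
      apply List.map_congr_left
      intro j hj
      rw [List.mem_range] at hj
      rw [Nat.zero_add]
      exact h3 j (by omega)
    rw [prefixList_eq, prefixList_eq] at hlt2
    by_cases hi : v.length + 2 ≤ i
    · rw [e2 _ hi] at hlt2
      exact lex_irrefl hr.1 _ hlt2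
    · obtain ⟨q, hq⟩ := Nat.exists_eq_add_of_le (show i + 1 ≤ v.length + 2 by omega)
      rw [hq] at hlt2
      refine lex_irrefl hr.1 _ (lex_trans hr.1 hlt2 ?_)
      rw [seg_add, seg_add, seg_add m, seg_add m, e2 i le_rfl, seg_one, seg_one]
      simp only [List.append_assoc, List.singleton_append]
      apply lex_intro
      simpa using h4

theorem lex_of_LInf {t u : ℕ → A} (h : LInf t u) (r : A → A → Prop) (a : A)
    (hr : AcceptablePair r a) (m : ℕ → A) (hm : IsMinInf r t m) : infLe r (consInf a u) m := by
  classical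
  by_cases he : consInf a u = m
  · exact Or.inl he
  right
  have hex : ∃ i, consInf a u i ≠ m i := by
    by_contra hn
    push Not at hn
    exact he (funext hn)
  refine ⟨Nat.find hex, fun j hj => not_not.1 (Nat.find_min hex hj), ?_⟩
  have h1 := Nat.find_spec hex
  have h2 : ∀ j, j < Nat.find hex → consInf a u j = m j :=
    fun j hj => not_not.1 (Nat.find_min hex hj)
  generalize Nat.find hex = i at h1 h2
  cases i with
  | zero => exact hr.2 _ h1.symm
  | succ i =>
    have e0 : m 0 = a := (h2 0 (by omega)).symm
    have e1 : seg m 1 i = seg u 0 i := by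
      simp only [seg]
      apply List.map_congr_left
      intro j hj
      rw [List.mem_range] at hj
      rw [Nat.zero_add, Nat.add_comm]
      exact (h2 (j + 1) (by omega)).symm
    have hf := (hm (1 + i + 1)).1
    rw [prefixList_eq, seg_add, seg_add, seg_one, seg_one, Nat.zero_add, Nat.zero_add, e0, e1,
      Nat.add_comm 1 i] at hf
    have h3 := h (i + 1) (seg u 0 i) (u i) (by rw [seg_add, seg_one, Nat.zero_add]) a (m (i + 1))
      (by simpa using hf)
    have h4 : u i ≠ m (i + 1) := h1
    have h5 : a = u i := h3.resolve_right h4.symm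
    show r (u i) (m (i + 1))
    rw [← h5] at h4 ⊢
    exact hr.2 _ h4.symm

end EpiProof

/-- An infinite word `t` is episturmian in the wide sense (all of its factors
are finite episturmian) iff there exists an infinite word `u` with `a·u ≤ min(t)` for
every acceptable pair `(a, <)`. -/
theorem episturmian_wide_iff_lex {A : Type*} [Fintype A] (t : ℕ → A) :
    (∀ w, IsFactorInf t w → FiniteEpisturmian w) ↔
      ∃ u : ℕ → A, ∀ (r : A → A → Prop) (a : A), AcceptablePair r a →
        ∀ m : ℕ → A, IsMinInf r t m → infLe r (consInf a u) m := by
  constructor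
  · intro h
    obtain ⟨u, hu⟩ := LInf_of_wide h
    exact ⟨u, fun r a hr m hm => lex_of_LInf hu r a hr m hm⟩
  · rintro ⟨u, hu⟩
    exact wide_of_LInf (LInf_of_lex hu)
end

section
/- Let t be an infinite word with Alph(t) = A (A a finite alphabet with |A| ≥ 2). Then t is non-recurrent and all of its factors are finite episturmian if and only if there exist a letter x ∈ A, a standard episturmian word s over A \ {x}, a pure epistandard morphism μ on A, a natural number p, and a non-empty suffix v of μ(s̃_p x) such that t = v·μ(s), where s_p is the prefix of s of length p and s̃_p its reversal. -/
section EpiHelpers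

variable {A : Type*}

theorem pl_length (t : ℕ → A) (k : ℕ) : (prefixList t k).length = k := by simp [prefixList]

theorem pl_add (t : ℕ → A) (i k : ℕ) :
    prefixList t (i + k) = prefixList t i ++ prefixList (fun j => t (i + j)) k := by
  simp [prefixList, List.range_add, Function.comp_def]

theorem pl_succ (t : ℕ → A) (k : ℕ) : prefixList t (k + 1) = prefixList t k ++ [t k] := by
  rw [pl_add]; simp [prefixList]

theorem pl_cons (t : ℕ → A) (k : ℕ) :
    prefixList t (k + 1) = t 0 :: prefixList (fun j => t (1 + j)) k := by
  rw [add_comm, pl_add]; simp [prefixList]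

theorem pl_mono (t : ℕ → A) {m n : ℕ} (h : m ≤ n) : prefixList t m <+: prefixList t n := by
  obtain ⟨d, rfl⟩ := Nat.exists_eq_add_of_le h
  rw [pl_add]; exact List.prefix_append _ _

theorem prefixInf_iff (t : ℕ → A) (u : List A) :
    IsPrefixInf u t ↔ ∃ k, u <+: prefixList t k := by
  constructor
  · intro h
    refine ⟨u.length, ?_⟩
    rw [← h]
  · rintro ⟨k, h⟩
    have hl : u.length ≤ k := by simpa [pl_length] using h.length_le
    have h2 := pl_mono t hl
    have := List.prefix_of_prefix_length_le h h2 (by simp [pl_length])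
    exact this.eq_of_length (by simp [pl_length])

theorem prefixInf_pl (t : ℕ → A) (k : ℕ) : IsPrefixInf (prefixList t k) t :=
  (prefixInf_iff _ _).2 ⟨k, List.prefix_rfl⟩

theorem prefixInf_of_prefix {t : ℕ → A} {u v : List A} (h : u <+: v) (hv : IsPrefixInf v t) :
    IsPrefixInf u t := by
  obtain ⟨k, hk⟩ := (prefixInf_iff _ _).1 hv
  exact (prefixInf_iff _ _).2 ⟨k, h.trans hk⟩

theorem prefixInf_append (t : ℕ → A) (u v : List A) :
    IsPrefixInf (u ++ v) t ↔ IsPrefixInf u t ∧ IsPrefixInf v (fun j => t (u.length + j)) := by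
  unfold IsPrefixInf
  rw [List.length_append, pl_add]
  constructor
  · intro h
    exact List.append_inj h (by simp [pl_length])
  · rintro ⟨h1, h2⟩
    rw [← h1, ← h2]

theorem factor_iff (t : ℕ → A) (u : List A) :
    IsFactorInf t u ↔ ∃ k, u <:+: prefixList t k := by
  constructor
  · rintro ⟨i, h⟩
    refine ⟨i + u.length, prefixList t i, [], ?_⟩
    rw [pl_add, List.append_nil]
    congr 1
  · rintro ⟨k, p, q, h⟩
    have : IsPrefixInf (p ++ u) t := (prefixInf_iff _ _).2 ⟨k, ⟨q, h⟩⟩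
    exact ⟨p.length, ((prefixInf_append _ _ _).1 this).2⟩

theorem factor_iff_prefix (t : ℕ → A) (u : List A) :
    IsFactorInf t u ↔ ∃ p, IsPrefixInf (p ++ u) t := by
  constructor
  · rintro ⟨i, h⟩
    refine ⟨prefixList t i, (prefixInf_append _ _ _).2 ⟨prefixInf_pl _ _, ?_⟩⟩
    rw [pl_length]; exact h
  · rintro ⟨p, h⟩
    exact ⟨p.length, ((prefixInf_append _ _ _).1 h).2⟩

theorem factor_of_infix {t : ℕ → A} {u v : List A} (h : u <:+: v) (hv : IsFactorInf t v) :
    IsFactorInf t u := by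
  obtain ⟨k, hk⟩ := (factor_iff _ _).1 hv
  exact (factor_iff _ _).2 ⟨k, h.trans hk⟩

theorem factor_of_prefixInf {t : ℕ → A} {u : List A} (h : IsPrefixInf u t) : IsFactorInf t u := by
  obtain ⟨k, hk⟩ := (prefixInf_iff _ _).1 h
  exact (factor_iff _ _).2 ⟨k, hk.isInfix⟩

theorem prefixInf_comparable {t : ℕ → A} {u v : List A} (hu : IsPrefixInf u t)
    (hv : IsPrefixInf v t) (h : u.length ≤ v.length) : u <+: v := by
  rw [hu, hv]; exact pl_mono _ h

theorem factor_single (t : ℕ → A) (b : A) : IsFactorInf t [b] ↔ ∃ n, t n = b := by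
  simp [IsFactorInf, FactorAt, eq_comm]

theorem factor_pair (t : ℕ → A) (i : ℕ) : IsFactorInf t [t i, t (i + 1)] :=
  ⟨i, by simp [FactorAt, List.range_succ]⟩

/-! The extended morphism `w ↦ ψ_a(w) a`. -/

variable [DecidableEq A]

def epE (a : A) (z : List A) : List A := psiW a z ++ [a]

theorem psiW_append (a : A) (u v : List A) : psiW a (u ++ v) = psiW a u ++ psiW a v := by
  simp [psiW]

theorem epE_nil (a : A) : epE a [] = [a] := rfl

theorem epE_self (a : A) (z : List A) : epE a (a :: z) = a :: epE a z := by
  simp [epE, psiW]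

theorem epE_ne {a c : A} (h : c ≠ a) (z : List A) : epE a (c :: z) = a :: c :: epE a z := by
  simp [epE, psiW, h]

theorem epE_append (a : A) (u v : List A) : epE a (u ++ v) = psiW a u ++ epE a v := by
  simp [epE, psiW_append]

theorem epE_head (a : A) (z : List A) : ∃ r, epE a z = a :: r := by
  cases z with
  | nil => exact ⟨_, rfl⟩
  | cons c z =>
    by_cases h : c = a
    · subst h; exact ⟨_, epE_self _ _⟩
    · exact ⟨_, epE_ne h _⟩

theorem psiW_length_le (a : A) (z : List A) : z.length ≤ (psiW a z).length := by
  induction z with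
  | nil => simp
  | cons c z ih =>
    have := psiW_append a [c] z
    rw [List.singleton_append] at this
    rw [this]
    by_cases h : c = a <;> simp [psiW, h] at ih ⊢ <;> omega

theorem epE_cons_suffix (a c : A) (u : List A) : c :: epE a u <:+ epE a (c :: u) := by
  by_cases h : c = a
  · subst h; rw [epE_self]
  · rw [epE_ne h]; exact List.suffix_cons _ _

theorem epE_prefix {a : A} {u v : List A} (h : u <+: v) : epE a u <+: epE a v := by
  obtain ⟨q, rfl⟩ := h
  rw [epE_append]
  obtain ⟨r, hr⟩ := epE_head a q
  rw [hr]
  exact ⟨r, by simp [epE]⟩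

theorem epE_suffix {a : A} {u v : List A} (h : u <:+ v) : epE a u <:+ epE a v := by
  obtain ⟨q, rfl⟩ := h
  rw [epE_append]; exact List.suffix_append _ _

theorem epE_infix {a : A} {u v : List A} (h : u <:+: v) : epE a u <:+: epE a v := by
  obtain ⟨p, q, rfl⟩ := h
  exact (epE_suffix (List.suffix_append p u)).isInfix.trans
    (epE_prefix (List.prefix_append (p ++ u) q)).isInfix

theorem epE_reverse (a : A) (z : List A) : epE a z.reverse = (epE a z).reverse := by
  induction z with
  | nil => rfl
  | cons c z ih =>
    rw [List.reverse_cons, epE_append]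
    by_cases h : c = a
    · subst h
      rw [epE_self c z, List.reverse_cons, ← ih]
      simp [epE, psiW]
    · rw [epE_ne h z, List.reverse_cons, List.reverse_cons, ← ih]
      simp [epE, psiW, h]

theorem epE_snoc_prefix (a b : A) (f : List A) : epE a f ++ [b] <+: epE a (f ++ [b]) := by
  rw [epE_append]
  by_cases h : b = a
  · subst h; simp [epE, psiW]
  · simp [epE, psiW, h]

/-- Prefix decoding. -/
theorem epE_prefix_inv {a : A} : ∀ {u v : List A}, epE a u <+: epE a v → u <+: v
  | [], v, _ => List.nil_prefix
  | c :: u, [], h => by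
    have := h.length_le
    have h2 := psiW_length_le a (c :: u)
    simp only [epE, psiW, List.length_append, List.map_nil, List.flatten_nil,
      List.length_nil, List.length_cons] at this h2
    omega
  | c :: u, d :: v, h => by
    obtain ⟨r, hr⟩ := epE_head a u
    obtain ⟨q, hq⟩ := epE_head a v
    by_cases hc : c = a <;> by_cases hd : d = a
    · subst hc; subst hd
      rw [epE_self, epE_self, List.cons_prefix_cons] at h
      exact List.cons_prefix_cons.2 ⟨rfl, epE_prefix_inv h.2⟩
    · subst hc
      rw [epE_self, epE_ne hd, hr] at h
      simp only [List.cons_prefix_cons] at h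
      exact absurd h.2.1.symm hd
    · subst hd
      rw [epE_self, epE_ne hc, hq] at h
      simp only [List.cons_prefix_cons] at h
      exact absurd h.2.1 hc
    · rw [epE_ne hd, epE_ne hc] at h
      simp only [List.cons_prefix_cons] at h
      exact List.cons_prefix_cons.2 ⟨h.2.1, epE_prefix_inv h.2.2⟩

/-- Suffixes of `ψ_a(z) a`. -/
theorem epE_suffix_cases {a : A} : ∀ {z v : List A}, v <:+ epE a z →
    v = [] ∨ (∃ z1, z1 <:+ z ∧ v = epE a z1) ∨
      (∃ c z1, c ≠ a ∧ c :: z1 <:+ z ∧ v = c :: epE a z1)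
  | [], v, h => by
    rw [epE_nil, List.suffix_cons_iff] at h
    rcases h with h | h
    · exact Or.inr (Or.inl ⟨[], List.suffix_rfl, h⟩)
    · exact Or.inl (List.suffix_nil.1 h)
  | c :: z, v, h => by
    have key : v <:+ epE a z → v = [] ∨ (∃ z1, z1 <:+ c :: z ∧ v = epE a z1) ∨
      (∃ d z1, d ≠ a ∧ d :: z1 <:+ c :: z ∧ v = d :: epE a z1) := by
      intro h
      rcases epE_suffix_cases h with h | ⟨z1, h1, h2⟩ | ⟨d, z1, h0, h1, h2⟩
      · exact Or.inl h
      · exact Or.inr (Or.inl ⟨z1, h1.trans (List.suffix_cons _ _), h2⟩)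
      · exact Or.inr (Or.inr ⟨d, z1, h0, h1.trans (List.suffix_cons _ _), h2⟩)
    by_cases hc : c = a
    · subst hc
      rw [epE_self, List.suffix_cons_iff] at h
      rcases h with h | h
      · exact Or.inr (Or.inl ⟨_, List.suffix_rfl, by rw [epE_self, h]⟩)
      · exact key h
    · rw [epE_ne hc, List.suffix_cons_iff, List.suffix_cons_iff] at h
      rcases h with h | h | h
      · exact Or.inr (Or.inl ⟨_, List.suffix_rfl, by rw [epE_ne hc, h]⟩)
      · exact Or.inr (Or.inr ⟨c, z, hc, List.suffix_rfl, h⟩)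
      · exact key h

/-- Decoding of an occurrence of `b w` with `w` beginning with `a`. -/
theorem epE_cons_decode {a b : A} {w z : List A} (h : b :: a :: w <:+: epE a z) :
    ∃ z1, b :: z1 <:+: z ∧ a :: w <+: epE a z1 := by
  obtain ⟨v, hv, hs⟩ := List.infix_iff_prefix_suffix.1 h
  rcases epE_suffix_cases hs with rfl | ⟨z1, h1, rfl⟩ | ⟨c, z1, h0, h1, rfl⟩
  · simp at hv
  · cases z1 with
    | nil => simp [epE_nil] at hv
    | cons d z2 =>
      by_cases hd : d = a
      · subst hd
        rw [epE_self, List.cons_prefix_cons] at hv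
        obtain ⟨rfl, hv⟩ := hv
        exact ⟨z2, h1.isInfix, hv⟩
      · rw [epE_ne hd] at hv
        simp only [List.cons_prefix_cons] at hv
        exact absurd hv.2.1.symm hd
  · rw [List.cons_prefix_cons] at hv
    obtain ⟨rfl, hv⟩ := hv
    exact ⟨z1, h1.isInfix, hv⟩

theorem epE_cons_infix_iff {a c : A} {u z : List A} :
    c :: epE a u <:+: epE a z ↔ c :: u <:+: z := by
  constructor
  · intro h
    obtain ⟨r, hr⟩ := epE_head a u
    rw [hr] at h
    obtain ⟨z1, h1, h2⟩ := epE_cons_decode h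
    rw [← hr] at h2
    exact (List.cons_prefix_cons.2 ⟨rfl, epE_prefix_inv h2⟩ : c :: u <+: c :: z1).isInfix.trans h1
  · intro h
    exact (epE_cons_suffix a c u).isInfix.trans (epE_infix h)

theorem epE_infix_iff {a : A} {u z : List A} : epE a u <:+: epE a z ↔ u <:+: z := by
  refine ⟨fun h => ?_, epE_infix⟩
  cases u with
  | nil => exact List.nil_infix
  | cons c u => exact epE_cons_infix_iff.1 ((epE_cons_suffix a c u).isInfix.trans h)

theorem epE_sep {a b c : A} {w z : List A} (h : b :: c :: w <:+: epE a z) : b = a ∨ c = a := by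
  obtain ⟨v, hv, hs⟩ := List.infix_iff_prefix_suffix.1 h
  rcases epE_suffix_cases hs with rfl | ⟨z1, h1, rfl⟩ | ⟨d, z1, h0, h1, rfl⟩
  · simp at hv
  · obtain ⟨r, hr⟩ := epE_head a z1
    rw [hr, List.cons_prefix_cons] at hv
    exact Or.inl hv.1
  · obtain ⟨r, hr⟩ := epE_head a z1
    rw [hr] at hv
    simp only [List.cons_prefix_cons] at hv
    exact Or.inr hv.2.1

/-- Canonical decoding of a prefix. -/
theorem epE_prefix_decode {a : A} : ∀ {z w : List A}, w <+: epE a z →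
    ∃ w', w <+: epE a w' ∧ w'.length ≤ w.length - 1 ∧ ∀ z2, w <+: epE a z2 → w' <+: z2
  | z, [], _ => ⟨[], List.nil_prefix, by simp, fun _ _ => List.nil_prefix⟩
  | z, [c], h => by
    obtain ⟨r, hr⟩ := epE_head a z
    rw [hr, List.cons_prefix_cons] at h
    obtain ⟨rfl, -⟩ := h
    exact ⟨[], List.prefix_rfl, by simp, fun _ _ => List.nil_prefix⟩
  | [], c :: d :: w, h => by simp [epE_nil] at h
  | e :: z, c :: d :: w, h => by
    by_cases he : e = a
    · subst he
      rw [epE_self, List.cons_prefix_cons] at h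
      obtain ⟨rfl, h⟩ := h
      obtain ⟨w1, h1, h2, h3⟩ := epE_prefix_decode h
      obtain ⟨r, hr⟩ := epE_head c z
      have hd : d = c := by
        rw [hr, List.cons_prefix_cons] at h; exact h.1
      subst hd
      refine ⟨d :: w1, ?_, by simp at h2 ⊢; omega, ?_⟩
      · rw [epE_self, List.cons_prefix_cons]; exact ⟨rfl, h1⟩
      · intro z2 hz
        cases z2 with
        | nil => simp [epE_nil] at hz
        | cons f z2 =>
          by_cases hf : f = d
          · subst hf
            rw [epE_self, List.cons_prefix_cons] at hz
            exact List.cons_prefix_cons.2 ⟨rfl, h3 _ hz.2⟩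
          · rw [epE_ne hf] at hz
            simp only [List.cons_prefix_cons] at hz
            exact absurd hz.2.1.symm hf
    · rw [epE_ne he] at h
      simp only [List.cons_prefix_cons] at h
      obtain ⟨rfl, rfl, h⟩ := h
      obtain ⟨w1, h1, h2, h3⟩ := epE_prefix_decode h
      refine ⟨d :: w1, ?_, by simp; omega, ?_⟩
      · rw [epE_ne he]; simpa using h1
      · intro z2 hz
        cases z2 with
        | nil => simp [epE_nil] at hz
        | cons f z2 =>
          by_cases hf : f = c
          · subst hf
            obtain ⟨r, hr⟩ := epE_head f z2
            rw [epE_self, hr] at hz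
            simp only [List.cons_prefix_cons] at hz
            exact absurd hz.2.1 he
          · rw [epE_ne hf] at hz
            simp only [List.cons_prefix_cons] at hz
            exact List.cons_prefix_cons.2 ⟨hz.2.1, h3 _ hz.2.2⟩

/-- Decoding of a factor. -/
theorem epE_infix_decode {a : A} {z w : List A} (h : w <:+: epE a z) :
    ∃ w', w' <:+: z ∧ w <:+: epE a w' ∧ (2 ≤ w.length → w'.length < w.length) := by
  obtain ⟨v, hv, hs⟩ := List.infix_iff_prefix_suffix.1 h
  rcases epE_suffix_cases hs with rfl | ⟨z1, h1, rfl⟩ | ⟨d, z1, h0, h1, rfl⟩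
  · rw [List.prefix_nil] at hv
    subst hv
    exact ⟨[], List.nil_infix, List.nil_infix, by simp⟩
  · obtain ⟨w', a1, a2, a3⟩ := epE_prefix_decode hv
    exact ⟨w', (a3 _ hv).isInfix.trans h1.isInfix, a1.isInfix, by omega⟩
  · cases w with
    | nil => exact ⟨[], List.nil_infix, List.nil_infix, by simp⟩
    | cons c w =>
      rw [List.cons_prefix_cons] at hv
      obtain ⟨rfl, hv⟩ := hv
      obtain ⟨w', a1, a2, a3⟩ := epE_prefix_decode hv
      refine ⟨c :: w', ?_, ?_, by simp; omega⟩
      · exact (List.cons_prefix_cons.2 ⟨rfl, a3 _ hv⟩ : c :: w' <+: c :: z1).isInfix.trans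
          h1.isInfix
      · exact (List.cons_prefix_cons.2 ⟨rfl, a1⟩ : c :: w <+: c :: epE a w').isInfix.trans
          (epE_cons_suffix a c w').isInfix

/-! Infinite words. -/

theorem img_prefix {a : A} {s y : ℕ → A} (h : IsMorphImage (psiW a) s y) (k : ℕ) :
    IsPrefixInf (epE a (prefixList s k)) y := by
  refine prefixInf_of_prefix ?_ (h (k + 1))
  rw [pl_succ, psiW_append]
  by_cases hc : s k = a
  · simp [epE, psiW, hc]
  · simp [epE, psiW, hc]

theorem img_prefix_iff {a : A} {s y : ℕ → A} (h : IsMorphImage (psiW a) s y) (w : List A) :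
    IsPrefixInf w y ↔ ∃ k, w <+: epE a (prefixList s k) := by
  constructor
  · intro hw
    refine ⟨w.length, prefixInf_comparable hw (img_prefix h _) ?_⟩
    have := psiW_length_le a (prefixList s w.length)
    rw [pl_length] at this
    simp [epE]; omega
  · rintro ⟨k, hk⟩
    exact prefixInf_of_prefix hk (img_prefix h k)

theorem img_factor_iff {a : A} {s y : ℕ → A} (h : IsMorphImage (psiW a) s y) (w : List A) :
    IsFactorInf y w ↔ ∃ k, w <:+: epE a (prefixList s k) := by
  constructor
  · intro hw
    obtain ⟨k, hk⟩ := (factor_iff _ _).1 hw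
    obtain ⟨m, hm⟩ := (img_prefix_iff h _).1 (prefixInf_pl y k)
    exact ⟨m, hk.trans hm.isInfix⟩
  · rintro ⟨k, hk⟩
    exact factor_of_infix hk (factor_of_prefixInf (img_prefix h k))

theorem img_epE_prefix {a : A} {s y : ℕ → A} (h : IsMorphImage (psiW a) s y) (u : List A) :
    IsPrefixInf (epE a u) y ↔ IsPrefixInf u s := by
  rw [img_prefix_iff h, prefixInf_iff]
  exact exists_congr fun k => ⟨epE_prefix_inv, epE_prefix⟩

theorem img_epE_factor {a : A} {s y : ℕ → A} (h : IsMorphImage (psiW a) s y) (u : List A) :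
    IsFactorInf y (epE a u) ↔ IsFactorInf s u := by
  rw [img_factor_iff h, factor_iff]
  exact exists_congr fun k => epE_infix_iff

theorem img_cons_epE_factor {a : A} {s y : ℕ → A} (h : IsMorphImage (psiW a) s y) (c : A)
    (u : List A) : IsFactorInf y (c :: epE a u) ↔ IsFactorInf s (c :: u) := by
  rw [img_factor_iff h, factor_iff]
  exact exists_congr fun k => epE_cons_infix_iff

theorem img_decode {a : A} {s y : ℕ → A} (h : IsMorphImage (psiW a) s y) {w : List A}
    (hw : IsFactorInf y w) :
    ∃ w', IsFactorInf s w' ∧ w <:+: epE a w' ∧ (2 ≤ w.length → w'.length < w.length) := by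
  obtain ⟨k, hk⟩ := (img_factor_iff h w).1 hw
  obtain ⟨w', h1, h2, h3⟩ := epE_infix_decode hk
  exact ⟨w', (factor_iff _ _).2 ⟨k, h1⟩, h2, h3⟩

theorem img_head {a : A} {s y : ℕ → A} (h : IsMorphImage (psiW a) s y) : y 0 = a := by
  have := img_prefix h 0
  simp [prefixList, epE, psiW, IsPrefixInf] at this
  exact this.symm

theorem img_exists_desub {a : A} {T : ℕ → A} (h0 : T 0 = a)
    (hs : ∀ i, T i = a ∨ T (i + 1) = a) : ∃ s, IsMorphImage (psiW a) s T := by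
  let pos : ℕ → ℕ := fun n => Nat.rec 0 (fun _ m => if T (m + 1) = a then m + 1 else m + 2) n
  have hpos : ∀ n, pos (n + 1) = if T (pos n + 1) = a then pos n + 1 else pos n + 2 :=
    fun n => rfl
  have key : ∀ k, T (pos k) = a ∧
      psiW a (prefixList (fun n => T (pos n + 1)) k) = prefixList T (pos k) := by
    intro k
    induction k with
    | zero => exact ⟨h0, rfl⟩
    | succ k ih =>
      rw [hpos, pl_succ, psiW_append, ih.2]
      by_cases hc : T (pos k + 1) = a
      · rw [if_pos hc]
        refine ⟨hc, ?_⟩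
        rw [pl_succ, ih.1]
        simp [psiW, hc]
      · rw [if_neg hc]
        refine ⟨(hs _).resolve_left hc, ?_⟩
        rw [pl_succ, pl_succ, ih.1]
        simp [psiW, hc]
  refine ⟨fun n => T (pos n + 1), fun k => ?_⟩
  rw [(key k).2]
  exact prefixInf_pl _ _

theorem exists_limit (L : ℕ → List A) (hL : ∀ k, L k <+: L (k + 1)) (hl : ∀ k, k ≤ (L k).length) :
    ∃ y, ∀ k, IsPrefixInf (L k) y := by
  have hm : ∀ m n, m ≤ n → L m <+: L n := by
    intro m n h
    induction h with
    | refl => exact List.prefix_rfl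
    | step _ ih => exact ih.trans (hL _)
  refine ⟨fun n => (L (n + 1))[n]'(hl (n + 1)), fun k => ?_⟩
  apply List.ext_getElem
  · simp [pl_length]
  · intro n h1 h2
    simp only [prefixList, List.getElem_map, List.getElem_range]
    rcases le_total k (n + 1) with h | h
    · exact (hm _ _ h).getElem _
    · exact ((hm _ _ h).getElem _).symm

theorem img_exists (a : A) (s : ℕ → A) : ∃ y, IsMorphImage (psiW a) s y := by
  apply exists_limit (fun k => psiW a (prefixList s k))
  · intro k
    rw [pl_succ, psiW_append]; exact List.prefix_append _ _
  · intro k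
    have := psiW_length_le a (prefixList s k)
    rwa [pl_length] at this

/-! Episturmian words. -/

theorem ls_prefix {t : ℕ → A} {u v : List A} (h : u <+: v) (hv : LeftSpecial t v) :
    LeftSpecial t u := by
  obtain ⟨a, b, hab, h1, h2⟩ := hv
  exact ⟨a, b, hab, factor_of_infix (List.cons_prefix_cons.2 ⟨rfl, h⟩ : a :: u <+: a :: v).isInfix h1,
    factor_of_infix (List.cons_prefix_cons.2 ⟨rfl, h⟩ : b :: u <+: b :: v).isInfix h2⟩

theorem rs_of_ls {t : ℕ → A} (hr : ∀ u, IsFactorInf t u → IsFactorInf t u.reverse) {u : List A}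
    (h : LeftSpecial t u) : RightSpecial t u.reverse := by
  obtain ⟨a, b, hab, h1, h2⟩ := h
  exact ⟨a, b, hab, by simpa using hr _ h1, by simpa using hr _ h2⟩

theorem ls_of_rs {t : ℕ → A} (hr : ∀ u, IsFactorInf t u → IsFactorInf t u.reverse) {u : List A}
    (h : RightSpecial t u) : LeftSpecial t u.reverse := by
  obtain ⟨a, b, hab, h1, h2⟩ := h
  exact ⟨a, b, hab, by simpa using hr _ h1, by simpa using hr _ h2⟩

theorem ls_prefix_of_length_le {t : ℕ → A} (ht : Episturmian t) {u v : List A}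
    (hu : LeftSpecial t u) (hv : LeftSpecial t v) (h : u.length ≤ v.length) : u <+: v := by
  have h1 := ls_prefix (List.take_prefix u.length v) hv
  have := ht.2 _ _ (rs_of_ls ht.1 hu) (rs_of_ls ht.1 h1) (by simp [h])
  rw [List.reverse_inj] at this
  rw [this]; exact List.take_prefix _ _

theorem ep_recurrent {t : ℕ → A} (hr : ∀ u, IsFactorInf t u → IsFactorInf t u.reverse) :
    Recurrent t := by
  intro u hu N
  obtain ⟨p, hp⟩ := (factor_iff_prefix _ _).1 (hr u hu)
  have h1 := prefixInf_pl t ((p ++ u.reverse).length + N)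
  rw [pl_add, ← hp] at h1
  obtain ⟨q, hq⟩ := (factor_iff_prefix _ _).1 (hr _ (factor_of_prefixInf h1))
  set R := prefixList (fun j => t ((p ++ u.reverse).length + j)) N with hR
  have hRl : R.length = N := pl_length _ _
  have h2 : IsPrefixInf ((q ++ R.reverse) ++ u) t := by
    refine prefixInf_of_prefix ⟨p.reverse, ?_⟩ hq
    simp
  refine ⟨(q ++ R.reverse).length, by simp [hRl], ((prefixInf_append _ _ _).1 h2).2⟩

theorem follow {t : ℕ → A} {b c : A} (h : IsFactorInf t [b, c]) (hb : ¬ RightSpecial t [b]) :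
    ∀ j, t j = b → t (j + 1) = c := by
  intro j hj
  by_contra hne
  exact hb ⟨_, _, hne, by simpa [hj] using factor_pair t j, h⟩

theorem ep_sep {t : ℕ → A} (ht : Episturmian t) :
    ∃ a, (a = t 0 ∨ RightSpecial t [a]) ∧ ∀ i, t i = a ∨ t (i + 1) = a := by
  by_cases h : ∃ a, RightSpecial t [a]
  · obtain ⟨a, ha⟩ := h
    refine ⟨a, Or.inr ha, ?_⟩
    by_contra hcon
    push Not at hcon
    obtain ⟨i, h1, h2⟩ := hcon
    have hn : ∀ d, d ≠ a → ¬ RightSpecial t [d] := by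
      intro d hd h
      have := ht.2 _ _ h ha rfl
      simp at this
      exact hd this
    have hp := factor_pair t i
    have f1 := follow hp (hn _ h1)
    have f2 := follow (by simpa using ht.1 _ hp) (hn _ h2)
    have hall : ∀ k, t (i + k) = t i ∨ t (i + k) = t (i + 1) := by
      intro k
      induction k with
      | zero => exact Or.inl rfl
      | succ k ih =>
        rcases ih with ih | ih
        · exact Or.inr (f1 _ ih)
        · exact Or.inl (f2 _ ih)
    obtain ⟨x, y, -, hx, -⟩ := ha
    obtain ⟨j, hj, hj2⟩ := ep_recurrent ht.1 [a] (factor_of_infix ⟨[], [x], rfl⟩ hx) i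
    obtain ⟨k, rfl⟩ := Nat.exists_eq_add_of_le hj
    have : t (i + k) = a := by simpa [FactorAt, eq_comm] using hj2
    rcases hall k with h | h
    · exact h1 (h ▸ this)
    · exact h2 (h ▸ this)
  · have hn : ∀ d, ¬ RightSpecial t [d] := fun d hd => h ⟨d, hd⟩
    have hp := factor_pair t 0
    have f1 := follow hp (hn _)
    have f2 := follow (by simpa using ht.1 _ hp) (hn _)
    have hall : ∀ k, t k = t 0 ∨ t k = t 1 := by
      intro k
      induction k with
      | zero => exact Or.inl rfl
      | succ k ih =>
        rcases ih with ih | ih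
        · exact Or.inr (f1 _ ih)
        · exact Or.inl (f2 _ ih)
    refine ⟨t 0, Or.inl rfl, fun i => ?_⟩
    rcases hall i with h | h
    · exact Or.inl h
    · exact Or.inr (f2 _ h)

theorem ls_img {a : A} {s y : ℕ → A} (h : IsMorphImage (psiW a) s y) {u : List A}
    (hu : LeftSpecial s u) : LeftSpecial y (epE a u) := by
  obtain ⟨b, c, hbc, h1, h2⟩ := hu
  exact ⟨b, c, hbc, (img_cons_epE_factor h _ _).2 h1, (img_cons_epE_factor h _ _).2 h2⟩

theorem ep_desub {a : A} {s y : ℕ → A} (h : IsMorphImage (psiW a) s y) (hy : Episturmian y) :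
    Episturmian s := by
  have hr : ∀ u, IsFactorInf s u → IsFactorInf s u.reverse := by
    intro u hu
    rw [← img_epE_factor h] at hu ⊢
    rw [epE_reverse]
    exact hy.1 _ hu
  refine ⟨hr, fun u v hu hv hl => ?_⟩
  have h1 := ls_img h (ls_of_rs hr hu)
  have h2 := ls_img h (ls_of_rs hr hv)
  apply List.reverse_injective
  rcases le_total (epE a u.reverse).length (epE a v.reverse).length with h3 | h3
  · exact (epE_prefix_inv (ls_prefix_of_length_le hy h1 h2 h3)).eq_of_length (by simp [hl])
  · exact ((epE_prefix_inv (ls_prefix_of_length_le hy h2 h1 h3)).eq_of_length (by simp [hl])).symm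

theorem std_desub {y : ℕ → A} (hy : StdEpisturmian y) :
    ∃ a s, IsMorphImage (psiW a) s y ∧ StdEpisturmian s := by
  obtain ⟨a, ha, hs⟩ := ep_sep hy.1
  have h0 : y 0 = a := by
    rcases ha with ha | ha
    · exact ha.symm
    · have := hy.2 _ (ls_of_rs hy.1.1 ha)
      simp [prefixList] at this
      exact this.symm
  obtain ⟨s, h⟩ := img_exists_desub h0 hs
  refine ⟨a, s, h, ep_desub h hy.1, fun u hu => ?_⟩
  have := hy.2 _ (ls_img h hu)
  exact (img_epE_prefix h u).1 this

theorem std_coind (P : (ℕ → A) → Prop)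
    (hP : ∀ y, P y → ∃ a s, IsMorphImage (psiW a) s y ∧ P s) :
    ∀ y, P y → StdEpisturmian y := by
  have hr : ∀ n, ∀ y, P y → ∀ u : List A, u.length ≤ n → IsFactorInf y u →
      IsFactorInf y u.reverse := by
    intro n
    induction n with
    | zero =>
      intro y _ u hu h
      have : u = [] := List.length_eq_zero_iff.1 (by omega)
      subst this; exact h
    | succ n ih =>
      intro y hy u hu h
      by_cases h2 : 2 ≤ u.length
      · obtain ⟨a, s, hs, hPs⟩ := hP y hy
        obtain ⟨w', g1, g2, g3⟩ := img_decode hs h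
        have := ih s hPs w' (by have := g3 h2; omega) g1
        rw [← img_epE_factor hs, epE_reverse] at this
        exact factor_of_infix (List.reverse_infix.2 g2) this
      · match u, h2 with
        | [], _ => exact h
        | [b], _ => exact h
        | b :: c :: u, h2 => simp at h2
  have hl : ∀ n, ∀ y, P y → ∀ u : List A, u.length ≤ n → LeftSpecial y u → IsPrefixInf u y := by
    intro n
    induction n with
    | zero =>
      intro y _ u hu h
      have : u = [] := List.length_eq_zero_iff.1 (by omega)
      subst this; rfl
    | succ n ih =>
      intro y hy u hu h
      cases u with
      | nil => rfl
      | cons d u =>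
        obtain ⟨a, s, hs, hPs⟩ := hP y hy
        obtain ⟨b, c, hbc, h1, h2⟩ := h
        obtain ⟨k1, h1⟩ := (img_factor_iff hs _).1 h1
        obtain ⟨k2, h2⟩ := (img_factor_iff hs _).1 h2
        have hd : d = a := by
          rcases epE_sep h1 with e1 | e1
          · rcases epE_sep h2 with e2 | e2
            · exact absurd (e1.trans e2.symm) hbc
            · exact e2
          · exact e1
        subst hd
        obtain ⟨z1, a1, a2⟩ := epE_cons_decode h1
        obtain ⟨z2, b1, b2⟩ := epE_cons_decode h2
        obtain ⟨w', c1, c2, c3⟩ := epE_prefix_decode a2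
        have hls : LeftSpecial s w' :=
          ls_prefix List.prefix_rfl ⟨b, c, hbc,
            (factor_iff _ _).2 ⟨k1, (List.cons_prefix_cons.2 ⟨rfl, c3 _ a2⟩ :
              b :: w' <+: b :: z1).isInfix.trans a1⟩,
            (factor_iff _ _).2 ⟨k2, (List.cons_prefix_cons.2 ⟨rfl, c3 _ b2⟩ :
              c :: w' <+: c :: z2).isInfix.trans b1⟩⟩
        have := ih s hPs w' (by simp at hu c2; omega) hls
        exact prefixInf_of_prefix c1 ((img_epE_prefix hs _).2 this)
  intro y hy
  have hr' : ∀ u, IsFactorInf y u → IsFactorInf y u.reverse := fun u => hr _ y hy u le_rfl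
  refine ⟨⟨hr', fun u v hu hv huv => ?_⟩, fun u => hl _ y hy u le_rfl⟩
  have h1 := hl _ y hy _ le_rfl (ls_of_rs hr' hu)
  have h2 := hl _ y hy _ le_rfl (ls_of_rs hr' hv)
  apply List.reverse_injective
  rw [h1, h2]; simp [huv]

theorem std_img {a : A} {s y : ℕ → A} (h : IsMorphImage (psiW a) s y) (hs : StdEpisturmian s) :
    StdEpisturmian y := by
  refine std_coind (fun y => StdEpisturmian y ∨
    ∃ a s, IsMorphImage (psiW a) s y ∧ StdEpisturmian s) ?_ y (Or.inr ⟨a, s, h, hs⟩)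
  rintro y (hy | ⟨a, s, h, hs⟩)
  · obtain ⟨a, s, h, hs⟩ := std_desub hy
    exact ⟨a, s, h, Or.inl hs⟩
  · exact ⟨a, s, h, Or.inl hs⟩

/-! Finite episturmian words. -/

inductive FEp : List A → Prop
  | nil : FEp []
  | step (a : A) (w u : List A) : FEp w → u <:+: epE a w → FEp u

theorem FEp.of_sub {u w : List A} (hw : FEp w) (h : u <:+: w) : FEp u := by
  cases hw with
  | nil => rw [List.infix_nil.1 h]; exact FEp.nil
  | step a w' _ h1 h2 => exact FEp.step a w' u h1 (h.trans h2)

theorem FEp.single (b : A) : FEp [b] := FEp.step b [] _ FEp.nil List.infix_rfl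

theorem std_const (b : A) : StdEpisturmian (fun _ => b) := by
  refine std_coind (fun y => y = fun _ => b) ?_ _ rfl
  rintro y rfl
  obtain ⟨s, hs⟩ := img_exists_desub (a := b) (T := fun _ => b) rfl (fun _ => Or.inl rfl)
  refine ⟨b, s, hs, ?_⟩
  funext n
  have h1 : IsFactorInf s [s n] := (factor_single _ _).2 ⟨n, rfl⟩
  rw [← img_cons_epE_factor hs] at h1
  have := (factor_single _ _).1 (factor_of_infix ⟨[], epE b [], rfl⟩ h1)
  obtain ⟨_, h⟩ := this
  exact h.symm

theorem FEp.finite [Nonempty A] {w : List A} (h : FEp w) : FiniteEpisturmian w := by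
  suffices ∃ t : ℕ → A, StdEpisturmian t ∧ IsFactorInf t w by
    obtain ⟨t, h1, h2⟩ := this
    exact ⟨t, h1.1, h2⟩
  induction h with
  | nil => exact ⟨_, std_const (Classical.arbitrary A), 0, rfl⟩
  | step a w u hw hu ih =>
    obtain ⟨s, h1, h2⟩ := ih
    obtain ⟨y, hy⟩ := img_exists a s
    exact ⟨y, std_img hy h1, factor_of_infix hu ((img_epE_factor hy w).2 h2)⟩

theorem factor_shift {t : ℕ → A} (hr : Recurrent t) (N : ℕ) (u : List A) :
    IsFactorInf (fun j => t (N + j)) u ↔ IsFactorInf t u := by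
  constructor
  · rintro ⟨i, h⟩
    refine ⟨N + i, ?_⟩
    unfold FactorAt at h ⊢
    simpa [add_assoc] using h
  · intro h
    obtain ⟨i, hi, h⟩ := hr u h N
    obtain ⟨k, rfl⟩ := Nat.exists_eq_add_of_le hi
    refine ⟨k, ?_⟩
    unfold FactorAt at h ⊢
    simpa [add_assoc] using h

theorem ep_shift {t : ℕ → A} (ht : Episturmian t) (N : ℕ) : Episturmian (fun j => t (N + j)) := by
  have := factor_shift (ep_recurrent ht.1) N
  unfold Episturmian RightSpecial at ht ⊢
  simpa only [this] using ht

theorem FEp.of_finite {w : List A} (h : FiniteEpisturmian w) : FEp w := by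
  induction hn : w.length using Nat.strong_induction_on generalizing w with
  | _ n ih =>
    by_cases h2 : 2 ≤ w.length
    · obtain ⟨y, hy, hw⟩ := h
      obtain ⟨a, -, hs⟩ := ep_sep hy
      obtain ⟨T, hT, hT0, hTs, hTw⟩ : ∃ T : ℕ → A, Episturmian T ∧ T 0 = a ∧
          (∀ i, T i = a ∨ T (i + 1) = a) ∧ IsFactorInf T w := by
        rcases hs 0 with h0 | h0
        · exact ⟨y, hy, h0, hs, hw⟩
        · exact ⟨_, ep_shift hy 1, h0, fun i => hs (1 + i),
            (factor_shift (ep_recurrent hy.1) 1 w).2 hw⟩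
      obtain ⟨s, hs⟩ := img_exists_desub hT0 hTs
      obtain ⟨w', g1, g2, g3⟩ := img_decode hs hTw
      exact FEp.step a w' w (ih w'.length (hn ▸ g3 h2) ⟨s, ep_desub hs hT, g1⟩ rfl) g2
    · match w, h2 with
      | [], _ => exact FEp.nil
      | [b], _ => exact FEp.single b
      | b :: c :: u, h2 => simp at h2

/-! Pure epistandard morphisms. -/

theorem pure_append {f : List A → List A} (hf : PureEpistandard f) (u v : List A) :
    f (u ++ v) = f u ++ f v := by
  induction hf with
  | id => rfl
  | comp a f _ ih => simp only [ih, psiW_append]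

theorem pure_length {f : List A → List A} (hf : PureEpistandard f) (u : List A) :
    u.length ≤ (f u).length := by
  induction hf with
  | id => exact le_rfl
  | comp a f _ ih => exact ih.trans (psiW_length_le _ _)

theorem psiW_suffix {a : A} {u v : List A} (h : u <:+ v) : psiW a u <:+ psiW a v := by
  obtain ⟨p, rfl⟩ := h
  rw [psiW_append]; exact List.suffix_append _ _

theorem pure_last {f : List A → List A} (hf : PureEpistandard f) (x : A) : [x] <:+ f [x] := by
  induction hf with
  | id => exact List.suffix_rfl
  | comp a f _ ih =>
    refine List.IsSuffix.trans ?_ (psiW_suffix ih)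
    by_cases h : x = a
    · simp [psiW, h]
    · simp [psiW, h]

theorem pure_FEp {f : List A → List A} (hf : PureEpistandard f) {w : List A} (h : FEp w) :
    FEp (f w) := by
  induction hf with
  | id => exact h
  | comp a f _ ih => exact FEp.step a _ _ ih (List.prefix_append _ _).isInfix

theorem pure_img_exists {f : List A → List A} (hf : PureEpistandard f) (s : ℕ → A) :
    ∃ y, IsMorphImage f s y := by
  apply exists_limit (fun k => f (prefixList s k))
  · intro k
    rw [pl_succ, pure_append hf]; exact List.prefix_append _ _
  · intro k
    have := pure_length hf (prefixList s k)
    rwa [pl_length] at this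

theorem pure_img_prefix {f : List A → List A} (hf : PureEpistandard f) {s y : ℕ → A}
    (h : IsMorphImage f s y) {u : List A} (hu : IsPrefixInf u y) :
    u <+: f (prefixList s u.length) := by
  apply prefixInf_comparable hu (h _)
  have := pure_length hf (prefixList s u.length)
  rwa [pl_length] at this

theorem psiW_prefix {a : A} {u v : List A} (h : u <+: v) : psiW a u <+: psiW a v := by
  obtain ⟨p, rfl⟩ := h
  rw [psiW_append]; exact List.prefix_append _ _

theorem pure_nonrec {f : List A → List A} (hf : PureEpistandard f) {s : ℕ → A} {x : A}
    (hx : ∀ n, s n ≠ x) : ∀ y, IsMorphImage f s y →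
    ∃ u, IsPrefixInf u y ∧ ¬ IsFactorInf y (x :: u) := by
  induction hf with
  | id =>
    intro y hy
    refine ⟨[], rfl, fun h => ?_⟩
    obtain ⟨n, hn⟩ := (factor_single _ _).1 h
    have h1 := hy (n + 1)
    have h2 : prefixList s (n + 1) = prefixList y (n + 1) := by
      have h3 := h1
      unfold IsPrefixInf at h3
      simpa [pl_length] using h3
    rw [pl_succ, pl_succ] at h2
    have h4 := (List.append_inj' h2 rfl).2
    simp at h4
    exact hx n (h4.trans hn)
  | comp a f hf ih =>
    intro y hy
    obtain ⟨y', hy'⟩ := pure_img_exists hf s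
    obtain ⟨u, h1, h2⟩ := ih y' hy'
    have himg : IsMorphImage (psiW a) y' y := by
      intro k
      exact prefixInf_of_prefix (psiW_prefix (pure_img_prefix hf hy' (prefixInf_pl y' k))) (hy _)
    exact ⟨epE a u, (img_epE_prefix himg u).2 h1, fun h => h2 ((img_cons_epE_factor himg _ _).1 h)⟩

theorem img_letters {a : A} {s y : ℕ → A} (h : IsMorphImage (psiW a) s y) (n : ℕ) :
    ∃ m, y m = s n := by
  have h1 : IsFactorInf s [s n] := (factor_single _ _).2 ⟨n, rfl⟩
  rw [← img_cons_epE_factor h] at h1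
  exact (factor_single _ _).1 (factor_of_infix ⟨[], epE a [], rfl⟩ h1)

theorem std_FEp {x : A} (p : ℕ) : ∀ s : ℕ → A, StdEpisturmian s → (∀ n, s n ≠ x) →
    FEp ((prefixList s p).reverse ++ x :: prefixList s p) := by
  induction p using Nat.strong_induction_on with
  | _ p ih =>
    intro s hs hx
    rcases Nat.eq_zero_or_pos p with rfl | hp
    · exact FEp.single x
    · obtain ⟨a, s', himg, hs'⟩ := std_desub hs
      obtain ⟨k, hk⟩ := (img_prefix_iff himg _).1 (prefixInf_pl s p)
      obtain ⟨w, h1, h2, h3⟩ := epE_prefix_decode hk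
      have hw : IsPrefixInf w s' := (prefixInf_iff _ _).2 ⟨k, h3 _ hk⟩
      rw [pl_length] at h2
      have hx' : ∀ n, s' n ≠ x := by
        intro n hn
        obtain ⟨m, hm⟩ := img_letters himg n
        exact hx m (hm.trans hn)
      have hxa : x ≠ a := fun h => hx 0 ((img_head himg).trans h.symm)
      have := ih w.length (by omega) s' hs' hx'
      rw [← hw] at this
      refine FEp.step a _ _ this ?_
      have e : epE a (w.reverse ++ x :: w) = (epE a w).reverse ++ x :: epE a w := by
        rw [epE_append, epE_ne hxa, ← epE_reverse]
        simp [epE]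
      rw [e]
      obtain ⟨r, hr⟩ := h1
      rw [← hr]
      exact ⟨r.reverse, r, by simp⟩

theorem wordAppend_prefix (v : List A) (y : ℕ → A) {u : List A} (hu : IsPrefixInf u y) :
    IsPrefixInf (v ++ u) (wordAppend v y) := by
  rw [prefixInf_append]
  constructor
  · apply List.ext_getElem
    · simp [pl_length]
    · intro n h1 h2
      simp [prefixList, wordAppend, h1]
  · convert hu using 2
    simp [wordAppend]

theorem wordAppend_of_prefix {v : List A} {t : ℕ → A} (h : IsPrefixInf v t) :
    t = wordAppend v (fun j => t (v.length + j)) := by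
  funext n
  unfold wordAppend
  split_ifs with hn
  · have h2 : v[n]? = (prefixList t v.length)[n]? := by rw [← h]
    simp [prefixList, hn] at h2
    simp [h2]
  · congr 1; omega

theorem form_imp [Nonempty A] {t : ℕ → A} {x : A} {s : ℕ → A} {μ : List A → List A} {p : ℕ}
    {v : List A} {y : ℕ → A} (hx : ∀ n, s n ≠ x) (hs : StdEpisturmian s)
    (hμ : PureEpistandard μ) (hv : v ≠ []) (hsuf : v <:+ μ ((prefixList s p).reverse ++ [x]))
    (hy : IsMorphImage μ s y) (ht : t = wordAppend v y) :
    ¬ Recurrent t ∧ ∀ u, IsFactorInf t u → FiniteEpisturmian u := by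
  subst ht
  constructor
  · intro hrec
    obtain ⟨u, h1, h2⟩ := pure_nonrec hμ hx y hy
    have hl : [x] <:+ v := by
      rw [pure_append hμ] at hsuf
      have h3 : [x] <:+ μ (prefixList s p).reverse ++ μ [x] :=
        (pure_last hμ x).trans (List.suffix_append _ _)
      refine List.suffix_of_suffix_length_le h3 hsuf ?_
      simpa [Nat.one_le_iff_ne_zero] using hv
    obtain ⟨v0, rfl⟩ := hl
    have h4 := wordAppend_prefix (v0 ++ [x]) y h1
    have h5 : IsFactorInf (wordAppend (v0 ++ [x]) y) (x :: u) :=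
      (factor_iff_prefix _ _).2 ⟨v0, by simpa using h4⟩
    obtain ⟨i, hi, h6⟩ := hrec _ h5 (v0 ++ [x]).length
    obtain ⟨k, rfl⟩ := Nat.exists_eq_add_of_le hi
    refine h2 ⟨k, ?_⟩
    have : ∀ j, wordAppend (v0 ++ [x]) y ((v0 ++ [x]).length + k + j) = y (k + j) := by
      intro j
      unfold wordAppend
      rw [dif_neg (by omega)]
      congr 1; omega
    unfold FactorAt at h6 ⊢
    simpa only [this] using h6
  · intro u hu
    apply FEp.finite
    obtain ⟨k, hk⟩ := (factor_iff _ _).1 hu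
    have h1 := wordAppend_prefix v y (prefixInf_pl y k)
    have h2 : prefixList (wordAppend v y) k <+: v ++ prefixList y k :=
      prefixInf_comparable (prefixInf_pl _ _) h1 (by simp [pl_length])
    have h3 := pure_img_prefix hμ hy (prefixInf_pl y k)
    rw [pl_length] at h3
    set m := max p k
    have hm := pure_FEp hμ (std_FEp m s hs hx)
    refine hm.of_sub ((hk.trans h2.isInfix).trans ?_)
    have e : μ ((prefixList s m).reverse ++ x :: prefixList s m)
        = μ ((prefixList s m).reverse ++ [x]) ++ μ (prefixList s m) := by
      rw [← pure_append hμ]; simp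
    rw [e]
    have hp1 : (prefixList s p).reverse ++ [x] <:+ (prefixList s m).reverse ++ [x] := by
      obtain ⟨r, hr⟩ := pl_mono s (le_max_left p k)
      exact ⟨r.reverse, by rw [← hr]; simp⟩
    have hp2 : v <:+ μ ((prefixList s m).reverse ++ [x]) := by
      refine hsuf.trans ?_
      obtain ⟨r, hr⟩ := hp1
      rw [← hr, pure_append hμ r]; exact List.suffix_append _ _
    have hp3 : prefixList y k <+: μ (prefixList s m) := by
      refine h3.trans ?_
      obtain ⟨r, hr⟩ := pl_mono s (le_max_right p k)
      rw [← hr, pure_append hμ]; exact List.prefix_append _ _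
    obtain ⟨r1, hr1⟩ := hp2
    obtain ⟨r2, hr2⟩ := hp3
    exact ⟨r1, r2, by rw [← hr1, ← hr2]; simp⟩

/-! The converse. -/

theorem exists_code [Fintype A] {t : ℕ → A} (ht : ∀ u, IsFactorInf t u → FEp u) :
    ∃ a, ∀ n, ∃ w, FEp w ∧ prefixList t n <:+: epE a w := by
  by_contra hcon
  push Not at hcon
  choose n hn using hcon
  set N := Finset.univ.sup n
  have h1 := ht _ (factor_of_prefixInf (prefixInf_pl t (N + 1)))
  generalize hL : prefixList t (N + 1) = L at h1
  cases h1 with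
  | nil =>
    have := congrArg List.length hL
    simp [pl_length] at this
  | step a w _ hw hu =>
    refine hn a w hw (List.IsInfix.trans ?_ hu)
    rw [← hL]
    have : n a ≤ N := Finset.le_sup (Finset.mem_univ a)
    exact (pl_mono t (by omega)).isInfix

theorem code_factor {t : ℕ → A} {a : A} (h : ∀ n, ∃ w, FEp w ∧ prefixList t n <:+: epE a w)
    {u : List A} (hu : IsFactorInf t u) : ∃ w, FEp w ∧ u <:+: epE a w := by
  obtain ⟨k, hk⟩ := (factor_iff _ _).1 hu
  obtain ⟨w, h1, h2⟩ := h k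
  exact ⟨w, h1, hk.trans h2⟩

theorem code_sep {t : ℕ → A} {a : A} (h : ∀ n, ∃ w, FEp w ∧ prefixList t n <:+: epE a w)
    (i : ℕ) : t i = a ∨ t (i + 1) = a := by
  obtain ⟨w, -, hw⟩ := code_factor h (factor_pair t i)
  exact epE_sep hw

theorem code_desubA {t t' : ℕ → A} {a : A}
    (h : ∀ n, ∃ w, FEp w ∧ prefixList t n <:+: epE a w) (himg : IsMorphImage (psiW a) t' t) :
    ∀ u, IsFactorInf t' u → FEp u := by
  intro u hu
  obtain ⟨w, h1, h2⟩ := code_factor h ((img_epE_factor himg u).2 hu)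
  exact h1.of_sub (epE_infix_iff.1 h2)

theorem consInf_prefix (a b : A) (t : ℕ → A) (u : List A) :
    IsPrefixInf (b :: u) (consInf a t) ↔ b = a ∧ IsPrefixInf u t := by
  unfold IsPrefixInf
  rw [List.length_cons, pl_cons]
  have : (fun j => consInf a t (1 + j)) = t := by
    funext j; rw [add_comm]; rfl
  rw [this]
  simp [consInf]

theorem desubB_head {t t' : ℕ → A} {a : A} (h0 : t 0 ≠ a)
    (himg : IsMorphImage (psiW a) t' (consInf a t)) : t' 0 = t 0 := by
  have h1 := img_prefix himg 1
  have e : prefixList t' 1 = [t' 0] := rfl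
  rw [e] at h1
  by_cases h : t' 0 = a
  · rw [h, epE_self, consInf_prefix] at h1
    have := h1.2
    simp [epE_nil, IsPrefixInf, prefixList] at this
    exact absurd this.symm h0
  · rw [epE_ne h, consInf_prefix] at h1
    have := prefixInf_of_prefix (⟨[a], rfl⟩ : [t' 0] <+: _) h1.2
    simpa [IsPrefixInf, prefixList] using this

theorem desubB_prefix {t t' : ℕ → A} {a : A} (h0 : t 0 ≠ a)
    (himg : IsMorphImage (psiW a) t' (consInf a t)) (z : List A) :
    IsPrefixInf (t 0 :: epE a z) t ↔ IsPrefixInf (t 0 :: z) t' := by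
  rw [← img_epE_prefix himg, epE_ne h0, consInf_prefix]
  simp

theorem code_desubB {t t' : ℕ → A} {a : A} (h0 : t 0 ≠ a)
    (h : ∀ n, ∃ w, FEp w ∧ prefixList t n <:+: epE a w)
    (himg : IsMorphImage (psiW a) t' (consInf a t)) :
    ∀ u, IsFactorInf t' u → FEp u := by
  intro u hu
  obtain ⟨k, hk⟩ := (factor_iff _ _).1 hu
  have h1 := prefixInf_pl t' (k + 1)
  have h2 := hk.trans (pl_mono t' (Nat.le_succ k)).isInfix
  rw [Nat.succ_eq_add_one, pl_cons, desubB_head h0 himg] at h2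
  rw [pl_cons, desubB_head h0 himg, ← desubB_prefix h0 himg] at h1
  obtain ⟨w, h3, h4⟩ := code_factor h (factor_of_prefixInf h1)
  exact h3.of_sub (h2.trans (epE_cons_infix_iff.1 h4))

theorem code_existsB {t : ℕ → A} {a : A} (hs : ∀ i, t i = a ∨ t (i + 1) = a) :
    ∃ t', IsMorphImage (psiW a) t' (consInf a t) := by
  refine img_exists_desub rfl ?_
  rintro (_ | i)
  · exact Or.inl rfl
  · exact hs i

theorem std_of_cons [Fintype A] {x : A} (s : ℕ → A)
    (h : (∀ u, IsFactorInf (consInf x s) u → FEp u) ∧ ∀ n, s n ≠ x) : StdEpisturmian s := by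
  refine std_coind (fun s => (∀ u, IsFactorInf (consInf x s) u → FEp u) ∧ ∀ n, s n ≠ x) ?_ s h
  rintro s ⟨hF, hx⟩
  obtain ⟨a, ha⟩ := exists_code hF
  have hsep := code_sep ha
  have h0 : consInf x s 0 ≠ a := by
    rintro rfl
    rcases hsep 1 with h | h
    · exact hx 0 h
    · exact hx 1 h
  obtain ⟨t', ht'⟩ := code_existsB hsep
  have hh := desubB_head h0 ht'
  have hFt := code_desubB h0 ha ht'
  have e : consInf x (fun n => t' (1 + n)) = t' := by
    funext n
    cases n with
    | zero => exact hh.symm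
    | succ n => simp only [consInf]; rw [add_comm]
  have himg : IsMorphImage (psiW a) (fun n => t' (1 + n)) s := by
    intro k
    have h1 := prefixInf_pl t' (k + 1)
    rw [pl_cons, hh, ← desubB_prefix h0 ht', consInf_prefix] at h1
    exact prefixInf_of_prefix (List.prefix_append _ _) h1.2
  refine ⟨a, _, himg, ?_, ?_⟩
  · rw [e]; exact hFt
  · intro n hn
    obtain ⟨m, hm⟩ := img_letters himg n
    exact hx m (hm.trans hn)

def EForm (t : ℕ → A) : Prop :=
  ∃ (x : A) (s : ℕ → A) (μ : List A → List A) (p : ℕ) (v : List A) (y : ℕ → A),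
    (∀ n, s n ≠ x) ∧ StdEpisturmian s ∧ PureEpistandard μ ∧
    v ≠ [] ∧ v <:+ μ ((prefixList s p).reverse ++ [x]) ∧
    IsMorphImage μ s y ∧ t = wordAppend v y

theorem form_step {t : ℕ → A} {a x : A} {s : ℕ → A} {μ : List A → List A} {p : ℕ}
    {v v1 : List A} {y : ℕ → A} (hx : ∀ n, s n ≠ x) (hs : StdEpisturmian s)
    (hμ : PureEpistandard μ) (hsuf : v <:+ μ ((prefixList s p).reverse ++ [x]))
    (hy : IsMorphImage μ s y) (hv1 : v1 ≠ []) (hv2 : v1 <:+ psiW a v)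
    (h : ∀ u, IsPrefixInf u y → IsPrefixInf (v1 ++ psiW a u) t) : EForm t := by
  refine ⟨x, s, fun w => psiW a (μ w), p, v1, fun j => t (v1.length + j), hx, hs,
    PureEpistandard.comp a μ hμ, hv1, hv2.trans (psiW_suffix hsuf), ?_, ?_⟩
  · intro k
    exact ((prefixInf_append _ _ _).1 (h _ (hy k))).2
  · apply wordAppend_of_prefix
    have := h [] rfl
    simpa [psiW] using this

theorem main_ind [Fintype A] (N : ℕ) : ∀ t : ℕ → A, (∀ u, IsFactorInf t u → FEp u) →
    (∀ z, z ≠ [] → ¬ IsPrefixInf (z ++ prefixList t N) t) → EForm t := by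
  induction N using Nat.strong_induction_on with
  | _ N ih =>
    intro t hF hO
    rcases Nat.lt_or_ge N 2 with hN | hN
    · have hN1 : N = 1 := by
        by_contra h
        have : N = 0 := by omega
        subst this
        refine hO [t 0] (by simp) ?_
        simp [IsPrefixInf, prefixList]
      subst hN1
      have e : consInf (t 0) (fun n => t (1 + n)) = t := by
        funext n
        cases n with
        | zero => rfl
        | succ n => simp only [consInf]; rw [add_comm]
      have hx : ∀ n, t (1 + n) ≠ t 0 := by
        intro n hn
        refine hO (prefixList t (1 + n)) ?_ ?_
        · intro h
          have := congrArg List.length h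
          simp [pl_length] at this
        · have := prefixInf_pl t (1 + n + 1)
          rw [pl_succ, hn] at this
          exact this
      refine ⟨t 0, fun n => t (1 + n), _root_.id, 0, [t 0], fun n => t (1 + n), hx,
        std_of_cons _ ⟨by rw [e]; exact hF, hx⟩, PureEpistandard.id, by simp,
        by simp [prefixList], fun k => prefixInf_pl _ _, ?_⟩
      apply wordAppend_of_prefix
      simp [IsPrefixInf, prefixList]
    · obtain ⟨a, ha⟩ := exists_code hF
      have hsep := code_sep ha
      by_cases h0 : t 0 = a
      · obtain ⟨t', himg⟩ := img_exists_desub h0 hsep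
        obtain ⟨k, hk⟩ := (img_prefix_iff himg _).1 (prefixInf_pl t N)
        obtain ⟨w, g1, g2, g3⟩ := epE_prefix_decode hk
        rw [pl_length] at g2
        have hw : IsPrefixInf w t' := (prefixInf_iff _ _).2 ⟨k, g3 _ hk⟩
        have hO' : ∀ z, z ≠ [] → ¬ IsPrefixInf (z ++ prefixList t' w.length) t' := by
          intro z hz hp
          rw [← hw, ← img_epE_prefix himg, epE_append] at hp
          refine hO (psiW a z) ?_ (prefixInf_of_prefix ((List.prefix_append_right_inj _).2 g1) hp)
          intro h
          have := psiW_length_le a z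
          rw [h] at this
          exact hz (List.length_eq_zero_iff.1 (by simpa using this))
        obtain ⟨x, s, μ, p, v, y, hx, hs, hμ, hv, hsuf, hy, hwa⟩ :=
          ih w.length (by omega) t' (code_desubA ha himg) hO'
        refine form_step (v1 := psiW a v) hx hs hμ hsuf hy ?_ List.suffix_rfl ?_
        · intro h
          have := psiW_length_le a v
          rw [h] at this
          exact hv (List.length_eq_zero_iff.1 (by simpa using this))
        · intro u hu
          have := wordAppend_prefix v y hu
          rw [← hwa, ← img_epE_prefix himg] at this
          rw [← psiW_append]
          exact prefixInf_of_prefix (List.prefix_append _ _) this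
      · obtain ⟨t', himg⟩ := code_existsB hsep
        have hh := desubB_head h0 himg
        obtain ⟨M, rfl⟩ : ∃ M, N = M + 1 := ⟨N - 1, by omega⟩
        have ht1 := prefixInf_pl t (M + 1)
        rw [pl_cons] at ht1 hO
        set r := prefixList (fun j => t (1 + j)) M with hr
        have hrl : r.length = M := pl_length _ _
        obtain ⟨k, hk⟩ := (img_prefix_iff himg _).1 ((consInf_prefix a a t _).2 ⟨rfl, ht1⟩)
        have hk2 := hk.trans (epE_prefix (pl_mono t' (Nat.le_succ k)))
        rw [Nat.succ_eq_add_one, pl_cons, hh, epE_ne h0] at hk2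
        simp only [List.cons_prefix_cons, true_and] at hk2
        obtain ⟨w, g1, g2, g3⟩ := epE_prefix_decode hk2
        have hw : IsPrefixInf (t 0 :: w) t' := by
          refine (prefixInf_iff _ _).2 ⟨k + 1, ?_⟩
          rw [pl_cons, hh]
          exact List.cons_prefix_cons.2 ⟨rfl, g3 _ hk2⟩
        have hO' : ∀ z, z ≠ [] → ¬ IsPrefixInf (z ++ prefixList t' (t 0 :: w).length) t' := by
          intro z hz hp
          rw [← hw, ← img_epE_prefix himg, epE_append, epE_ne h0] at hp
          obtain ⟨q, hq⟩ : ∃ q, psiW a z ++ [a] = a :: q := epE_head a z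
          have hp2 : IsPrefixInf (a :: (q ++ (t 0 :: epE a w))) (consInf a t) := by
            have e2 : psiW a z ++ a :: t 0 :: epE a w = a :: (q ++ (t 0 :: epE a w)) := by
              rw [← List.cons_append, ← hq]; simp
            rw [← e2]; exact hp
          rw [consInf_prefix] at hp2
          refine hO q ?_ (prefixInf_of_prefix ((List.prefix_append_right_inj _).2
            (List.cons_prefix_cons.2 ⟨rfl, g1⟩)) hp2.2)
          rintro rfl
          have := psiW_length_le a z
          have h5 := congrArg List.length hq
          simp at h5
          rw [h5] at this
          exact hz (List.length_eq_zero_iff.1 (by simpa using this))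
        obtain ⟨x, s, μ, p, v, y, hx, hs, hμ, hv, hsuf, hy, hwa⟩ :=
          ih (t 0 :: w).length (by simp; omega) t' (code_desubB h0 ha himg) hO'
        have hvp : ∀ u, IsPrefixInf u y → IsPrefixInf (v ++ u) t' := by
          intro u hu
          rw [hwa]; exact wordAppend_prefix v y hu
        cases v with
        | nil => exact absurd rfl hv
        | cons b v =>
          have hb : b = t 0 := by
            have h1 := prefixInf_of_prefix (⟨v, rfl⟩ : [b] <+: b :: v)
              (by simpa using hvp [] rfl)
            rw [← hh]
            simpa [IsPrefixInf, prefixList] using h1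
          subst hb
          refine form_step (a := a) (v1 := t 0 :: psiW a v) hx hs hμ hsuf hy (by simp) ?_ ?_
          · refine ⟨[a], ?_⟩
            simp [psiW, h0]
          · intro u hu
            have h1 := hvp u hu
            rw [List.cons_append, ← desubB_prefix h0 himg] at h1
            rw [List.cons_append, ← psiW_append]
            exact prefixInf_of_prefix
              (List.cons_prefix_cons.2 ⟨rfl, List.prefix_append _ _⟩) h1

theorem exists_once {t : ℕ → A} (h : ¬ Recurrent t) :
    ∃ N, ∀ z, z ≠ [] → ¬ IsPrefixInf (z ++ prefixList t N) t := by
  by_contra hcon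
  push Not at hcon
  apply h
  intro u hu N
  suffices ∃ p, N ≤ p.length ∧ IsPrefixInf (p ++ u) t by
    obtain ⟨p, h1, h2⟩ := this
    exact ⟨p.length, h1, ((prefixInf_append _ _ _).1 h2).2⟩
  induction N with
  | zero =>
    obtain ⟨p, hp⟩ := (factor_iff_prefix _ _).1 hu
    exact ⟨p, Nat.zero_le _, hp⟩
  | succ N ih =>
    obtain ⟨p, h1, h2⟩ := ih
    obtain ⟨z, hz, h3⟩ := hcon (p ++ u).length
    rw [← h2, ← List.append_assoc] at h3
    refine ⟨z ++ p, ?_, h3⟩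
    have : 0 < z.length := List.length_pos_of_ne_nil hz
    simp; omega

end EpiHelpers

/-- An infinite word `t` with `Alph(t) = A`, `|A| ≥ 2`, is non-recurrent with
all factors finite episturmian iff `t = v·μ(s)` where `s` is a standard episturmian word
over `A \ {x}` for some letter `x`, `μ` is a pure epistandard morphism on `A`, and `v` is
a non-empty suffix of `μ(s̃_p x)` for some `p ∈ ℕ`. -/
theorem episkew_iff_form {A : Type*} [Fintype A] [DecidableEq A] (t : ℕ → A)
    (hAlph : ∀ a : A, ∃ n, t n = a) (hcard : 2 ≤ Fintype.card A) :
    (¬ Recurrent t ∧ ∀ u, IsFactorInf t u → FiniteEpisturmian u) ↔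
      ∃ (x : A) (s : ℕ → A) (μ : List A → List A) (p : ℕ) (v : List A) (y : ℕ → A),
        (∀ n, s n ≠ x) ∧ StdEpisturmian s ∧ PureEpistandard μ ∧
        v ≠ [] ∧ v <:+ μ ((prefixList s p).reverse ++ [x]) ∧
        IsMorphImage μ s y ∧ t = wordAppend v y := by
  constructor
  · rintro ⟨h1, h2⟩
    obtain ⟨N, hN⟩ := exists_once h1
    exact main_ind N t (fun u hu => FEp.of_finite (h2 u hu)) hN
  · rintro ⟨x, s, μ, p, v, y, hx, hs, hμ, hv, hsuf, hy, ht⟩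
    have : Nonempty A := ⟨x⟩
    exact form_imp hx hs hμ hv hsuf hy ht
end

section
/- Let t be an infinite word over the two-letter alphabet {a, b} with a < b. Then t is fine if and only if either t is an aperiodic Sturmian word, or t = v·μ(x)^ω, where μ is a pure standard Sturmian morphism on {a, b}, x and y are the two distinct letters of {a, b}, and v is a non-empty suffix of μ(x^p y) for some natural number p. -/
namespace FW

/-- number of occurrences of `c` among the first `n` letters of `t` -/
def cnt (c : Bool) (t : ℕ → Bool) : ℕ → ℕ
  | 0 => 0
  | n + 1 => cnt c t n + if t n = c then 1 else 0

/-- position of the `i`-th block -/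
def pos (z : Bool) (t : ℕ → Bool) (i : ℕ) : ℕ := i + cnt (!z) t i

def NN (t s : ℕ → Bool) : Prop :=
  ∀ i k, (∀ j, j < k → t (i + 1 + j) = s j) → t (i + 1 + k) = t i → s k = t i

def PP (t s : ℕ → Bool) : Prop :=
  ∀ (x : Bool) (k : ℕ), ∃ i, t i = x ∧ ∀ j, j < k → t (i + 1 + j) = s j

def Fn (t s : ℕ → Bool) : Prop := NN t s ∧ PP t s

def Img (z : Bool) (t u : ℕ → Bool) : Prop :=
  ∀ i, u (pos z t i) = z ∧ (t i = !z → u (pos z t i + 1) = !z)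

lemma pos_zero (z t) : pos z t 0 = 0 := rfl

lemma pos_succ_eq {z : Bool} {t : ℕ → Bool} {i : ℕ} (h : t i = z) :
    pos z t (i + 1) = pos z t i + 1 := by
  have : ¬ (t i = !z) := by rw [h]; cases z <;> simp
  simp [pos, cnt, this]; omega

lemma pos_succ_ne {z : Bool} {t : ℕ → Bool} {i : ℕ} (h : t i = !z) :
    pos z t (i + 1) = pos z t i + 2 := by
  simp [pos, cnt, h]; omega

lemma eq_or (z x : Bool) : x = z ∨ x = !z := by cases z <;> cases x <;> simp

lemma pos_lt_succ (z t i) : pos z t i < pos z t (i + 1) := by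
  rcases eq_or z (t i) with h | h
  · rw [pos_succ_eq h]; omega
  · rw [pos_succ_ne h]; omega

lemma pos_strictMono (z t) : StrictMono (pos z t) := strictMono_nat_of_lt_succ (pos_lt_succ z t)

lemma le_pos (z t i) : i ≤ pos z t i := by simp [pos]

lemma Img.next {z t u} (h : Img z t u) (i : ℕ) : u (pos z t i + 1) = t i := by
  rcases eq_or z (t i) with hi | hi
  · rw [← pos_succ_eq hi, hi]; exact (h _).1
  · rw [hi]; exact (h i).2 hi

/-- the last letter of the block -/
lemma Img.last {z t u} (h : Img z t u) (i : ℕ) :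
    ∃ q, pos z t (i + 1) = q + 1 ∧ u q = t i ∧ (t i = !z → 1 ≤ q) := by
  rcases eq_or z (t i) with hi | hi
  · refine ⟨pos z t i, pos_succ_eq hi, ?_, ?_⟩
    · rw [hi]; exact (h i).1
    · intro h2; rw [hi] at h2; cases z <;> simp at h2
  · refine ⟨pos z t i + 1, pos_succ_ne hi, h.next i, fun _ => by omega⟩

lemma Img.cases {z t u} (_h : Img z t u) (n : ℕ) :
    (∃ i, n = pos z t i) ∨ (∃ i, n = pos z t i + 1 ∧ t i = !z ∧ n + 1 = pos z t (i + 1)) := by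
  induction n with
  | zero => exact Or.inl ⟨0, rfl⟩
  | succ n ih =>
    rcases ih with ⟨i, hi⟩ | ⟨i, hi, h1, h2⟩
    · rcases eq_or z (t i) with hz | hz
      · left; exact ⟨i + 1, by rw [pos_succ_eq hz, hi]⟩
      · right; exact ⟨i, by rw [hi], hz, by rw [pos_succ_ne hz, hi]⟩
    · left; exact ⟨i + 1, h2⟩

lemma not_ne {z : Bool} : z ≠ !z := by cases z <;> simp

lemma Img.of_z {z t u} (h : Img z t u) {n : ℕ} (hn : u n = z) : ∃ i, n = pos z t i := by
  rcases h.cases n with h1 | ⟨i, h1, h2, _⟩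
  · exact h1
  · exfalso
    have := (h i).2 h2
    rw [← h1, hn] at this
    exact not_ne this

lemma Img.no_two {z t u} (h : Img z t u) {n : ℕ} (hn : u n = !z) : u (n + 1) = z := by
  rcases h.cases n with ⟨i, h1⟩ | ⟨i, h1, h2, h3⟩
  · rw [h1, (h i).1] at hn; exact absurd hn not_ne
  · rw [h3]; exact (h _).1

lemma match_fwd {z t u s s1} (h : Img z t u) (hs : Img z s s1) (l : ℕ) :
    ∀ k, (∀ j, j < k → t (l + j) = s j) →
      pos z t (l + k) = pos z t l + pos z s k ∧
      ∀ m, m ≤ pos z s k → u (pos z t l + m) = s1 m := by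
  intro k
  induction k with
  | zero =>
    intro _
    refine ⟨by simp [pos_zero], ?_⟩
    intro m hm
    rw [pos_zero] at hm
    obtain rfl : m = 0 := by omega
    have := (hs 0).1
    rw [pos_zero] at this
    rw [this]; exact (h l).1
  | succ k ih =>
    intro hj
    obtain ⟨e1, e2⟩ := ih (fun j hjk => hj j (by omega))
    have hk := hj k (by omega)
    have hpos : pos z t (l + (k + 1)) = pos z t l + pos z s (k + 1) := by
      rcases eq_or z (s k) with hz | hz
      · rw [pos_succ_eq hz, ← add_assoc, pos_succ_eq (hk.trans hz), e1]; omega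
      · rw [pos_succ_ne hz, ← add_assoc, pos_succ_ne (hk.trans hz), e1]; omega
    refine ⟨hpos, ?_⟩
    intro m hm
    by_cases h1 : m ≤ pos z s k
    · exact e2 m h1
    · by_cases h2 : m = pos z s k + 1
      · rw [h2, hs.next, ← hk, ← h.next, e1]; rfl
      · have h3 : m = pos z s (k + 1) := by
          rcases eq_or z (s k) with hz | hz
          · rw [pos_succ_eq hz] at hm ⊢; omega
          · rw [pos_succ_ne hz] at hm ⊢; omega
        rw [h3, (hs _).1, ← hpos, (h _).1]

lemma match_bwd {z t u s s1} (h : Img z t u) (hs : Img z s s1) (l : ℕ) :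
    ∀ k, (∀ m, m ≤ pos z s k → u (pos z t l + m) = s1 m) → ∀ j, j < k → t (l + j) = s j := by
  intro k
  induction k with
  | zero => intro _ j hj; omega
  | succ k ih =>
    intro hm
    have hlt := pos_lt_succ z s k
    have ih' := ih (fun m hmk => hm m (by omega))
    intro j hj
    by_cases hjk : j < k
    · exact ih' j hjk
    · obtain rfl : j = k := by omega
      obtain ⟨e1, e2⟩ := match_fwd h hs l j ih'
      rw [← h.next, e1, ← hs.next, ← hm _ hlt]; rfl

/-- `t` is the image of `t1`, possibly with the first letter dropped -/
def Sub (z : Bool) (t1 t : ℕ → Bool) : Prop :=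
  ∃ u e, Img z t1 u ∧ (t = fun n => u (n + e)) ∧ (e = 0 ∨ (e = 1 ∧ t1 0 = !z))

lemma last_ge {z t1 u} {e : ℕ} (h : Img z t1 u) (he : e = 0 ∨ (e = 1 ∧ t1 0 = !z)) (l : ℕ) :
    ∃ i, pos z t1 (l + 1) = i + e + 1 ∧ u (i + e) = t1 l := by
  obtain ⟨q, h1, h2, h3⟩ := h.last l
  have hq : e ≤ q := by
    rcases he with he | ⟨he, h0⟩
    · omega
    · subst he
      cases l with
      | zero => exact h3 h0
      | succ l => have := le_pos z t1 (l + 1 + 1); omega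
  refine ⟨q - e, by omega, ?_⟩
  rw [← h2]; congr 1; omega

lemma Sub.fine_down {z t1 t s1 s} (h : Sub z t1 t) (hs : Img z s1 s) (hf : Fn t s) : Fn t1 s1 := by
  obtain ⟨u, e, hu, rfl, he⟩ := h
  obtain ⟨hN, hP⟩ := hf
  constructor
  · intro i k hj hx
    obtain ⟨q, hq1, hq2⟩ := last_ge hu he i
    obtain ⟨e1, e2⟩ := match_fwd hu hs (i + 1) k hj
    have := hN q (pos z s1 k + 1) ?_ ?_
    · simp only at this
      rw [hs.next, hq2] at this
      exact this
    · intro j hj2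
      rw [← e2 j (by omega), hq1]
      simp only; congr 1; omega
    · simp only
      rw [hq2, ← hx, ← hu.next, e1, hq1]
      congr 1; omega
  · intro x k
    obtain ⟨i, hi, hj⟩ := hP x (pos z s1 k + 1)
    simp only at hi hj
    have h0 : u (i + e + 1) = z := by
      have := hj 0 (by omega)
      have h2 := (hs 0).1
      rw [pos_zero] at h2
      rw [h2] at this
      rw [← this]; congr 1; omega
    obtain ⟨l, hl⟩ := hu.of_z h0
    cases l with
    | zero => rw [pos_zero] at hl; omega
    | succ l =>
      refine ⟨l, ?_, ?_⟩
      · obtain ⟨q, hq1, hq2, _⟩ := hu.last l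
        rw [← hq2, ← hi]; congr 1; omega
      · apply match_bwd hu hs
        intro m hm
        rw [← hj m (by omega), ← hl]; congr 1; omega

lemma Sub.fine_up {z t1 t s1 s} (h : Sub z t1 t) (hs : Img z s1 s) (hf : Fn t1 s1) : Fn t s := by
  obtain ⟨u, e, hu, rfl, he⟩ := h
  obtain ⟨hN, hP⟩ := hf
  have hs0 : s 0 = z := by have := (hs 0).1; rwa [pos_zero] at this
  constructor
  · intro i k hj hx
    simp only at hj hx ⊢
    cases k with
    | zero =>
      rcases eq_or z (u (i + e)) with hz | hz
      · rw [hs0, hz]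
      · have := hu.no_two hz
        rw [show i + 1 + 0 + e = i + e + 1 by omega, this, hz] at hx
        exact absurd hx not_ne
    | succ k =>
      have h0 : u (i + e + 1) = z := by
        have := hj 0 (by omega)
        rw [hs0] at this
        rw [← this]; congr 1; omega
      obtain ⟨l, hl⟩ := hu.of_z h0
      cases l with
      | zero => rw [pos_zero] at hl; omega
      | succ l =>
        obtain ⟨q, hq1, hq2, _⟩ := hu.last l
        have hq : q = i + e := by omega
        rw [hq] at hq2
        rcases hs.cases k with ⟨m, hm⟩ | ⟨m, hm, hm2, hm3⟩
        · have hb := match_bwd hu hs (l + 1) m (by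
            intro m1 hm1
            rw [← hj m1 (by omega), ← hl]; congr 1; omega)
          obtain ⟨e1, e2⟩ := match_fwd hu hs (l + 1) m hb
          have := hN l m hb (by
            rw [← hu.next, e1, ← hq2, ← hx, ← hl, hm]; congr 1; omega)
          rw [hm, hs.next, this, hq2]
        · rw [hm3, (hs _).1]
          have h4 := hj k (by omega)
          rw [hm, (hs m).2 hm2] at h4
          have h5 := hu.no_two h4
          rw [← hx, ← h5]; congr 1; omega
  · intro x k
    obtain ⟨l, hl, hj⟩ := hP x k
    obtain ⟨q, hq1, hq2⟩ := last_ge hu he l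
    refine ⟨q, by simp only; rw [hq2, hl], ?_⟩
    intro j hjk
    obtain ⟨_, e2⟩ := match_fwd hu hs (l + 1) k hj
    rw [← e2 j (by have := le_pos z s1 k; omega), hq1]
    simp only; congr 1; omega

/-- images exist -/
lemma exists_img (z : Bool) (t : ℕ → Bool) : ∃ u, Img z t u := by
  classical
  refine ⟨fun n => if ∃ i, n = pos z t i then z else !z, ?_⟩
  intro i
  constructor
  · simp only; rw [if_pos ⟨i, rfl⟩]
  · intro hi
    simp only; rw [if_neg]
    rintro ⟨j, hj⟩
    have h1 : i < j := (pos_strictMono z t).lt_iff_lt.1 (by omega)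
    have h2 : j < i + 1 := (pos_strictMono z t).lt_iff_lt.1 (by rw [pos_succ_ne hi]; omega)
    omega

def dpos (z : Bool) (u : ℕ → Bool) : ℕ → ℕ
  | 0 => 0
  | n + 1 => dpos z u n + if u (dpos z u n + 1) = z then 1 else 2

lemma exists_preimg {z : Bool} {u : ℕ → Bool} (h0 : u 0 = z)
    (h : ∀ n, u n = !z → u (n + 1) = z) : ∃ t, Img z t u ∧ t 0 = u 1 := by
  refine ⟨fun i => u (dpos z u i + 1), ?_, rfl⟩
  have hp : ∀ i, pos z (fun i => u (dpos z u i + 1)) i = dpos z u i := by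
    intro i
    induction i with
    | zero => rfl
    | succ i ih =>
      rcases eq_or z (u (dpos z u i + 1)) with hz | hz
      · rw [pos_succ_eq (t := fun i => u (dpos z u i + 1)) hz, ih]; simp [dpos, hz]
      · rw [pos_succ_ne (t := fun i => u (dpos z u i + 1)) hz, ih, dpos, if_neg]
        rw [hz]; exact fun h => not_ne h.symm
  have hd : ∀ i, u (dpos z u i) = z := by
    intro i
    induction i with
    | zero => exact h0
    | succ i ih =>
      rcases eq_or z (u (dpos z u i + 1)) with hz | hz
      · simp [dpos, hz]
      · rw [dpos, if_neg]
        · exact h _ hz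
        · rw [hz]; exact fun h => not_ne h.symm
  intro i
  rw [hp]
  exact ⟨hd i, fun h => h⟩

lemma Fn.desub {t s} (hf : Fn t s) :
    (∀ n, t n = !(s 0) → t (n + 1) = s 0) ∧
    ∃ t1 s1, Sub (s 0) t1 t ∧ Img (s 0) s1 s ∧ Fn t1 s1 := by
  obtain ⟨hN, hP⟩ := hf
  have ht : ∀ n, t n = !(s 0) → t (n + 1) = s 0 := by
    intro n hn
    by_contra hc
    have h2 : t (n + 1) = t n := by
      rw [hn]; rcases eq_or (s 0) (t (n + 1)) with h | h
      · exact absurd h hc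
      · exact h
    have := hN n 0 (by intro j hj; omega) h2
    rw [hn] at this
    exact not_ne this
  have hs : ∀ n, s n = !(s 0) → s (n + 1) = s 0 := by
    intro n hn
    obtain ⟨i, _, hj⟩ := hP true (n + 2)
    rw [← hj (n + 1) (by omega)]
    apply ht (i + 1 + n)
    rw [hj n (by omega), hn]
  obtain ⟨s1, hs1, _⟩ := exists_preimg rfl hs
  have hex : ∃ t1, Sub (s 0) t1 t := by
    rcases eq_or (s 0) (t 0) with h0 | h0
    · obtain ⟨t1, h1, _⟩ := exists_preimg h0 ht
      exact ⟨t1, t, 0, h1, rfl, Or.inl rfl⟩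
    · obtain ⟨t1, h1, h2⟩ := exists_preimg (z := s 0) (u := consInf (s 0) t) rfl (by
        intro n hn
        cases n with
        | zero => exact absurd hn not_ne
        | succ n => exact ht n hn)
      exact ⟨t1, _, 1, h1, rfl, Or.inr ⟨rfl, by rw [h2, ← h0]; rfl⟩⟩
  obtain ⟨t1, ht1⟩ := hex
  exact ⟨ht, t1, s1, ht1, hs1, ht1.fine_down hs1 ⟨hN, hP⟩⟩

lemma cnt_t {t : ℕ → Bool} {n : ℕ} (h : t n = true) : cnt true t (n + 1) = cnt true t n + 1 := by
  simp [cnt, h]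

lemma cnt_f {t : ℕ → Bool} {n : ℕ} (h : t n = false) : cnt true t (n + 1) = cnt true t n := by
  simp [cnt, h]

lemma NN.bal {t s} (hN : NN t s) : ∀ n i j : ℕ,
    (cnt true t (i + n) : ℤ) - cnt true t i - (cnt true t (j + n) - cnt true t j) ≤ 1 := by
  intro n
  induction n using Nat.strong_induction_on with
  | _ n ih =>
  intro i j
  by_contra hc
  have key : ∀ l, (t l = true ∧ cnt true t (l + 1) = cnt true t l + 1) ∨
      (t l = false ∧ cnt true t (l + 1) = cnt true t l) := by
    intro l
    cases h : t l
    · exact Or.inr ⟨rfl, cnt_f h⟩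
    · exact Or.inl ⟨rfl, cnt_t h⟩
  rcases n with _ | _ | m
  · simp at hc
  · have h1 := key i
    have h2 := key j
    simp only [zero_add] at hc
    omega
  · have e1 := ih (m + 1) (by omega) i j
    have e2 := ih (m + 1) (by omega) (i + 1) (j + 1)
    rw [show i + 1 + (m + 1) = i + (m + 1 + 1) by omega,
      show j + 1 + (m + 1) = j + (m + 1 + 1) by omega] at e2
    have k1 := key i
    have k2 := key j
    have k3 := key (i + (m + 1))
    have k4 := key (j + (m + 1))
    rw [← add_assoc i (m+1) 1] at hc e2
    rw [← add_assoc j (m+1) 1] at hc e2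
    have ti : t i = true := by rcases k1 with k1 | k1 <;> [exact k1.1; omega]
    have tj : t j = false := by rcases k2 with k2 | k2 <;> [omega; exact k2.1]
    have ti2 : t (i + (m + 1)) = true := by rcases k3 with k1 | k1 <;> [exact k1.1; omega]
    have tj2 : t (j + (m + 1)) = false := by rcases k4 with k2 | k2 <;> [omega; exact k2.1]
    have hfl : ∀ l, l ≤ m → (cnt true t (i + (l + 1)) : ℤ) - cnt true t i
        - (cnt true t (j + (l + 1)) - cnt true t j) = 1 := by
      intro l hl
      have a1 := ih (l + 1) (by omega) i j
      have a2 := ih (m + 1 - l) (by omega) (i + (l + 1)) (j + (l + 1))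
      rw [show i + (l + 1) + (m + 1 - l) = i + (m + 1) + 1 by omega,
        show j + (l + 1) + (m + 1 - l) = j + (m + 1) + 1 by omega] at a2
      omega
    have heq : ∀ l, l < m → t (i + 1 + l) = t (j + 1 + l) := by
      intro l hl
      have a1 := hfl l (by omega)
      have a2 := hfl (l + 1) (by omega)
      have a3 := key (i + (l + 1))
      have a4 := key (j + (l + 1))
      rw [show i + (l + 1 + 1) = i + (l + 1) + 1 by omega,
        show j + (l + 1 + 1) = j + (l + 1) + 1 by omega] at a2
      rw [show i + 1 + l = i + (l + 1) by omega, show j + 1 + l = j + (l + 1) by omega]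
      rcases a3 with ⟨a3, a3'⟩ | ⟨a3, a3'⟩ <;> rcases a4 with ⟨a4, a4'⟩ | ⟨a4, a4'⟩
      · rw [a3, a4]
      · omega
      · omega
      · rw [a3, a4]
    have hs : ∀ l, l ≤ m → ∀ l', l' < l → t (i + 1 + l') = s l' := by
      intro l
      induction l with
      | zero => intro _ l' h; omega
      | succ l ihl =>
        intro hl l' hl'
        have ihl' := ihl (by omega)
        by_cases hll : l' < l
        · exact ihl' l' hll
        · obtain rfl : l' = l := by omega
          cases hc : t (i + 1 + l')
          · have := hN j l' (fun q hq => by rw [← heq q (by omega)]; exact ihl' q hq)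
              (by rw [← heq l' (by omega), hc, tj])
            rw [this, tj]
          · have := hN i l' ihl' (by rw [hc, ti])
            rw [this, ti]
    have b1 := hN i m (hs m le_rfl) (by rw [ti, ← ti2]; congr 1; omega)
    have b2 := hN j m (fun q hq => by rw [← heq q hq]; exact hs m le_rfl q hq)
      (by rw [tj, ← tj2]; congr 1; omega)
    rw [ti] at b1
    rw [tj, b1] at b2
    cases b2

lemma slope {t : ℕ → Bool} (hb : ∀ n i j : ℕ,
    (cnt true t (i + n) : ℤ) - cnt true t i - (cnt true t (j + n) - cnt true t j) ≤ 1) :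
    ∃ α : ℝ, ∀ i n : ℕ, (cnt true t (i + n) : ℝ) - cnt true t i - 1 ≤ n * α ∧
      n * α ≤ (cnt true t (i + n) : ℝ) - cnt true t i + 1 := by
  have hb' : ∀ n i j : ℕ, (cnt true t (i + n) : ℝ) - cnt true t i
      - (cnt true t (j + n) - cnt true t j) ≤ 1 := by
    intro n i j; exact_mod_cast hb n i j
  have A : ∀ k n i : ℕ, (k : ℝ) * (cnt true t (i + n) - cnt true t i - 1) ≤ cnt true t (k * n) := by
    intro k n i
    induction k with
    | zero => simp
    | succ k ih =>
      have := hb' n i (k * n)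
      rw [show (k + 1) * n = k * n + n by ring]
      push_cast
      linarith
  have B : ∀ k n i : ℕ, (cnt true t (k * n) : ℝ) ≤ (k : ℝ) * (cnt true t (i + n) - cnt true t i + 1) := by
    intro k n i
    induction k with
    | zero => simp [cnt]
    | succ k ih =>
      have := hb' n (k * n) i
      rw [show (k + 1) * n = k * n + n by ring]
      push_cast
      linarith
  let X : Set ℝ := {x | ∃ i n : ℕ, 0 < n ∧ x = ((cnt true t (i + n) : ℝ) - cnt true t i - 1) / n}
  have hX : ∀ j m : ℕ, 0 < m → ∀ x ∈ X, x ≤ ((cnt true t (j + m) : ℝ) - cnt true t j + 1) / m := by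
    rintro j m hm x ⟨i, n, hn, rfl⟩
    have hm' : (0 : ℝ) < m := by exact_mod_cast hm
    have hn' : (0 : ℝ) < n := by exact_mod_cast hn
    rw [div_le_div_iff₀ hn' hm']
    have a := A m n i
    have b := B n m j
    rw [mul_comm n m] at b
    linarith
  have hne : X.Nonempty := ⟨_, 0, 1, one_pos, rfl⟩
  have hbd : BddAbove X := ⟨_, hX 0 1 one_pos⟩
  refine ⟨sSup X, ?_⟩
  intro i n
  rcases Nat.eq_zero_or_pos n with rfl | hn
  · simp
  have hn' : (0 : ℝ) < n := by exact_mod_cast hn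
  constructor
  · have : ((cnt true t (i + n) : ℝ) - cnt true t i - 1) / n ≤ sSup X := le_csSup hbd ⟨i, n, hn, rfl⟩
    rw [div_le_iff₀ hn'] at this
    linarith
  · have := csSup_le hne (hX i n hn)
    rw [le_div_iff₀ hn'] at this
    linarith

lemma cnt_le (c t n) : cnt c t n ≤ n := by
  induction n with
  | zero => simp [cnt]
  | succ n ih => simp only [cnt]; split_ifs <;> omega

lemma nonneg_of_arch {x c : ℝ} (h : ∀ n : ℕ, -c ≤ n * x) : 0 ≤ x := by
  by_contra hx
  push Not at hx
  obtain ⟨n, hn⟩ := exists_nat_gt (c / (-x))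
  rw [div_lt_iff₀ (by linarith)] at hn
  have := h n
  linarith

lemma iff_cnt (t : ℕ → Bool) (n : ℕ) : t n = true ↔ (cnt true t (n + 1) : ℤ) ≠ cnt true t n := by
  cases h : t n
  · simp [cnt_f h]
  · simp [cnt_t h]

/-- `t` is mechanical in a weak sense -/
def Mech (α ρ : ℝ) (t : ℕ → Bool) : Prop :=
  ∀ n : ℕ, (cnt true t n : ℝ) ≤ n * α + ρ ∧ n * α + ρ ≤ cnt true t n + 1

lemma irr_unique {α ρ : ℝ} (hα : Irrational α) {m n : ℕ} {a b : ℤ} (hm : m * α + ρ = a)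
    (hn : n * α + ρ = b) : m = n := by
  by_contra hne
  have h1 : ((m : ℤ) - n : ℤ) ≠ 0 := by omega
  have h2 : Irrational ((((m : ℤ) - n : ℤ) : ℝ) * α) := hα.intCast_mul h1
  apply h2.ne_int (a - b)
  push_cast
  linarith

lemma Mech.sturm {α ρ : ℝ} {t} (hα : Irrational α) (h : Mech α ρ t) :
    SturmianFloor α ρ t ∨ SturmianCeil α ρ t := by
  by_cases hx : ∃ n : ℕ, n * α + ρ = cnt true t n + 1
  · right
    obtain ⟨n0, hn0⟩ := hx
    have hS : ∀ n : ℕ, ⌈(n : ℝ) * α + ρ⌉ = cnt true t n + 1 := by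
      intro n
      rw [Int.ceil_eq_iff]
      push_cast
      refine ⟨?_, (h n).2⟩
      have h1 := (h n).1
      rcases h1.lt_or_eq with h2 | h2
      · linarith
      · have := irr_unique (a := (cnt true t n : ℤ)) (b := cnt true t n0 + 1) hα
          (by push_cast; exact h2.symm) (by push_cast; exact hn0)
        subst this
        linarith
    intro n
    have h2 := hS (n + 1)
    push_cast at h2
    rw [h2, hS n, iff_cnt]
    omega
  · left
    push Not at hx
    have hS : ∀ n : ℕ, ⌊(n : ℝ) * α + ρ⌋ = cnt true t n := by
      intro n
      rw [Int.floor_eq_iff]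
      push_cast
      exact ⟨(h n).1, lt_of_le_of_ne (h n).2 (hx n)⟩
    intro n
    have h2 := hS (n + 1)
    push_cast at h2
    rw [h2, hS n, iff_cnt]

lemma mech_of_slope {t : ℕ → Bool} {α : ℝ} (h : ∀ i n : ℕ,
    (cnt true t (i + n) : ℝ) - cnt true t i - 1 ≤ n * α ∧
      n * α ≤ (cnt true t (i + n) : ℝ) - cnt true t i + 1) :
    α ∈ Set.Icc (0 : ℝ) 1 ∧ ∃ ρ ∈ Set.Icc (0 : ℝ) 1, Mech α ρ t := by
  have hα0 : 0 ≤ α := by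
    apply nonneg_of_arch (c := 1)
    intro n
    have := (h 0 n).1
    have h2 : (0 : ℝ) ≤ cnt true t (0 + n) := Nat.cast_nonneg _
    have h3 : cnt true t 0 = 0 := rfl
    rw [h3] at this
    push_cast at this
    linarith
  have hα1 : 0 ≤ 1 - α := by
    apply nonneg_of_arch (c := 1)
    intro n
    have := (h 0 n).2
    have h2 : (cnt true t (0 + n) : ℝ) ≤ n := by rw [zero_add]; exact_mod_cast cnt_le _ _ _
    have h3 : cnt true t 0 = 0 := rfl
    rw [h3] at this
    push_cast at this
    linarith
  refine ⟨⟨hα0, by linarith⟩, ?_⟩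
  have hD : ∀ m n : ℕ, (cnt true t m : ℝ) - m * α ≤ cnt true t n - n * α + 1 := by
    intro m n
    rcases le_total m n with hmn | hmn
    · obtain ⟨k, rfl⟩ := Nat.exists_eq_add_of_le hmn
      have := (h m k).2
      push_cast
      linarith
    · obtain ⟨k, rfl⟩ := Nat.exists_eq_add_of_le hmn
      have := (h n k).1
      push_cast
      linarith
  let X : Set ℝ := Set.range fun m : ℕ => (cnt true t m : ℝ) - m * α
  have hbd : BddAbove X := ⟨cnt true t 0 - (0 : ℕ) * α + 1, by rintro _ ⟨m, rfl⟩; exact hD m 0⟩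
  have h1 : ∀ n : ℕ, (cnt true t n : ℝ) - n * α ≤ sSup X := fun n => le_csSup hbd ⟨n, rfl⟩
  have h2 : ∀ n : ℕ, sSup X ≤ cnt true t n - n * α + 1 := by
    intro n
    apply csSup_le (Set.range_nonempty _)
    rintro _ ⟨m, rfl⟩
    exact hD m n
  have h3 : cnt true t 0 = 0 := rfl
  refine ⟨sSup X, ⟨?_, ?_⟩, ?_⟩
  · have := h1 0
    rw [h3] at this
    simpa using this
  · have := h2 0
    rw [h3] at this
    simpa using this
  · intro n
    have := h1 n
    have := h2 n
    constructor <;> linarith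

lemma floor_cnt {α ρ : ℝ} {t} (h0 : 0 ≤ α) (h1 : α ≤ 1) (h : SturmianFloor α ρ t) (n : ℕ) :
    (cnt true t n : ℤ) = ⌊(n : ℝ) * α + ρ⌋ - ⌊ρ⌋ := by
  induction n with
  | zero => simp [cnt]
  | succ n ih =>
    have hn := h n
    have a1 : ⌊(n : ℝ) * α + ρ⌋ ≤ ⌊((n : ℝ) + 1) * α + ρ⌋ := Int.floor_le_floor (by linarith)
    have a2 : ⌊((n : ℝ) + 1) * α + ρ⌋ ≤ ⌊(n : ℝ) * α + ρ + 1⌋ := Int.floor_le_floor (by linarith)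
    rw [Int.floor_add_one] at a2
    push_cast
    cases hc : t n
    · rw [cnt_f hc, ih]
      rw [hc] at hn
      simp at hn
      rw [hn]
    · rw [cnt_t hc]
      have := hn.1 hc
      push_cast
      omega

/-- the converse: Sturmian words are mechanical -/
lemma mech_of_sturm {α ρ : ℝ} {t} (h0 : 0 ≤ α) (h1 : α ≤ 1)
    (h : SturmianFloor α ρ t ∨ SturmianCeil α ρ t) : ∃ ρ', Mech α ρ' t := by
  rcases h with h | h
  · refine ⟨ρ - ⌊ρ⌋, ?_⟩
    have hS := floor_cnt h0 h1 h
    intro n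
    have h2 := hS n
    have h3 : ((cnt true t n : ℤ) : ℝ) = (⌊(n : ℝ) * α + ρ⌋ - ⌊ρ⌋ : ℤ) := by rw [h2]
    push_cast at h3
    rw [h3]
    have := Int.floor_le ((n : ℝ) * α + ρ)
    have := Int.lt_floor_add_one ((n : ℝ) * α + ρ)
    constructor <;> linarith
  · refine ⟨ρ - ⌈ρ⌉ + 1, ?_⟩
    have hS : ∀ n : ℕ, (cnt true t n : ℤ) = ⌈(n : ℝ) * α + ρ⌉ - ⌈ρ⌉ := by
      intro n
      induction n with
      | zero => simp [cnt]
      | succ n ih =>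
        have hn := h n
        have a1 : ⌈(n : ℝ) * α + ρ⌉ ≤ ⌈((n : ℝ) + 1) * α + ρ⌉ := Int.ceil_le_ceil (by linarith)
        have a2 : ⌈((n : ℝ) + 1) * α + ρ⌉ ≤ ⌈(n : ℝ) * α + ρ + 1⌉ := Int.ceil_le_ceil (by linarith)
        rw [Int.ceil_add_one] at a2
        push_cast
        cases hc : t n
        · rw [cnt_f hc, ih]
          rw [hc] at hn
          simp at hn
          rw [hn]
        · rw [cnt_t hc]
          have := hn.1 hc
          push_cast
          omega
    intro n
    have h2 := hS n
    have h3 : ((cnt true t n : ℤ) : ℝ) = (⌈(n : ℝ) * α + ρ⌉ - ⌈ρ⌉ : ℤ) := by rw [h2]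
    push_cast at h3
    rw [h3]
    have := Int.le_ceil ((n : ℝ) * α + ρ)
    have := Int.ceil_lt_add_one ((n : ℝ) * α + ρ)
    constructor <;> linarith

lemma dense_nat {α : ℝ} (hα : Irrational α) (a b : ℝ) (hab : a < b) :
    ∃ (n : ℕ) (m : ℤ), a < n * α + m ∧ n * α + m < b := by
  have h1 : DenseRange (fun n : ℕ => n • (α : AddCircle (1 : ℝ))) := by
    rw [← denseRange_zsmul_iff_nsmul]
    exact AddCircle.denseRange_zsmul_coe_iff.2 (by simpa using hα)
  have h2 := QuotientAddGroup.dense_preimage_mk.2 h1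
  obtain ⟨x, ⟨n, hn⟩, hx⟩ := h2.exists_mem_open isOpen_Ioo (Set.nonempty_Ioo.2 hab)
  have h3 : ((n * α : ℝ) : AddCircle (1 : ℝ)) = (x : AddCircle (1 : ℝ)) := by
    rw [← nsmul_eq_mul]; exact hn
  have h4 : ((x - n * α : ℝ) : AddCircle (1 : ℝ)) = 0 := by rw [AddCircle.coe_sub, h3, sub_self]
  obtain ⟨m, hm⟩ := AddCircle.coe_eq_zero_iff _ |>.1 h4
  have h5 : n * α + m = x := by simp at hm; linarith
  exact ⟨n, m, by rw [h5]; exact hx.1, by rw [h5]; exact hx.2⟩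

lemma eps {α : ℝ} (hα : Irrational α) (K : ℕ) : ∃ ε > 0, ∀ l : ℕ, 1 ≤ l → l ≤ K →
    (⌊(l : ℝ) * α⌋ : ℝ) + ε ≤ l * α ∧ l * α + ε ≤ ⌊(l : ℝ) * α⌋ + 1 := by
  induction K with
  | zero => exact ⟨1, one_pos, fun l h1 h2 => by omega⟩
  | succ K ih =>
    obtain ⟨ε, he, h⟩ := ih
    have h1 : (⌊((K + 1 : ℕ) : ℝ) * α⌋ : ℝ) < (K + 1 : ℕ) * α := by
      apply lt_of_le_of_ne (Int.floor_le _)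
      exact ((hα.natCast_mul (Nat.succ_ne_zero K)).ne_int _).symm
    have h2 := Int.lt_floor_add_one (((K + 1 : ℕ) : ℝ) * α)
    refine ⟨min ε (min (((K + 1 : ℕ) : ℝ) * α - ⌊((K + 1 : ℕ) : ℝ) * α⌋)
      (⌊((K + 1 : ℕ) : ℝ) * α⌋ + 1 - ((K + 1 : ℕ) : ℝ) * α)), ?_, ?_⟩
    · refine lt_min he (lt_min ?_ ?_) <;> linarith
    · intro l hl1 hl2
      have m1 := min_le_left ε (min (((K + 1 : ℕ) : ℝ) * α - ⌊((K + 1 : ℕ) : ℝ) * α⌋)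
        (⌊((K + 1 : ℕ) : ℝ) * α⌋ + 1 - ((K + 1 : ℕ) : ℝ) * α))
      have m2 := min_le_right ε (min (((K + 1 : ℕ) : ℝ) * α - ⌊((K + 1 : ℕ) : ℝ) * α⌋)
        (⌊((K + 1 : ℕ) : ℝ) * α⌋ + 1 - ((K + 1 : ℕ) : ℝ) * α))
      have m3 := m2.trans (min_le_left _ _)
      have m4 := m2.trans (min_le_right _ _)
      by_cases hlK : l ≤ K
      · have := h l hl1 hlK
        constructor <;> linarith
      · obtain rfl : l = K + 1 := by omega
        constructor <;> linarith

lemma cnt_match {t s : ℕ → Bool} (i k : ℕ) (h : ∀ j, j < k → t (i + j) = s j) :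
    cnt true t (i + k) = cnt true t i + cnt true s k := by
  induction k with
  | zero => simp [cnt]
  | succ k ih =>
    rw [← add_assoc]
    simp only [cnt]
    rw [ih (fun j hj => h j (by omega)), h k (by omega)]
    omega

lemma Mech.fine {α ρ : ℝ} {t} (hα : Irrational α) (h0 : 0 ≤ α) (h1 : α ≤ 1) (h : Mech α ρ t) :
    ∃ s, Fn t s := by
  have h0' : 0 < α := lt_of_le_of_ne h0 (hα.ne_zero.symm)
  have h1' : α < 1 := lt_of_le_of_ne h1 hα.ne_one
  have hfl : ⌊α⌋ = 0 := by rw [Int.floor_eq_iff]; simp [h0, h1']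
  let s : ℕ → Bool := fun n => decide (⌊((n : ℝ) + 1) * α + α⌋ ≠ ⌊(n : ℝ) * α + α⌋)
  have hs : SturmianFloor α α s := by intro n; simp [s]
  have hc : ∀ n : ℕ, (cnt true s n : ℤ) = ⌊((n + 1 : ℕ) : ℝ) * α⌋ := by
    intro n
    rw [floor_cnt h0 h1 hs, hfl, sub_zero]
    congr 1; push_cast; ring
  have hc1 : ∀ n : ℕ, (cnt true s n : ℝ) ≤ ((n : ℝ) + 1) * α ∧ ((n : ℝ) + 1) * α < cnt true s n + 1 := by
    intro n
    have a := Int.floor_le (((n + 1 : ℕ) : ℝ) * α)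
    have b := Int.lt_floor_add_one (((n + 1 : ℕ) : ℝ) * α)
    rw [← hc] at a b
    push_cast at a b
    exact ⟨a, b⟩
  refine ⟨s, ?_, ?_⟩
  · intro i k hj hx
    by_contra hne
    have hcm := cnt_match (i + 1) k hj
    have e1 := h i
    have e2 := h (i + 1 + k + 1)
    have e3 := hc1 (k + 1)
    push_cast at e2 e3
    cases hi : t i
    · rw [hi] at hne hx
      simp only [Bool.not_eq_false] at hne
      rw [cnt_t hne] at e3
      rw [cnt_f hx, hcm, cnt_f hi] at e2
      push_cast at e2 e3
      apply (hα.natCast_mul (Nat.succ_ne_zero (k + 1))).ne_int (cnt true s k + 1)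
      push_cast
      linarith
    · rw [hi] at hne hx
      simp only [Bool.not_eq_true] at hne
      rw [cnt_f hne] at e3
      rw [cnt_t hx, hcm, cnt_t hi] at e2
      push_cast at e2 e3
      linarith
  · intro x k
    obtain ⟨ε, he, hε⟩ := eps hα (k + 1)
    have hε' : ∀ j : ℕ, j ≤ k → (cnt true s j : ℝ) + ε ≤ ((j : ℝ) + 1) * α ∧
        ((j : ℝ) + 1) * α + ε ≤ cnt true s j + 1 := by
      intro j hj
      have := hε (j + 1) (by omega) (by omega)
      rw [← hc] at this
      push_cast at this
      exact this
    have hε1 : ε < 1 := by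
      have := (hε' 0 (by omega)).2
      simp [cnt] at this
      linarith
    suffices hmain : ∃ n : ℕ, ∀ j, j ≤ k →
        cnt true t (n + 1 + j) = cnt true t n + (if x = true then 1 else 0) + cnt true s j by
      obtain ⟨n, hn⟩ := hmain
      refine ⟨n, ?_, ?_⟩
      · have := hn 0 (by omega)
        simp [cnt] at this
        cases hx : x <;> cases ht : t n <;> simp_all
      · intro j hj
        have a := hn j (by omega)
        have b := hn (j + 1) (by omega)
        rw [← add_assoc] at b
        cases ht : t (n + 1 + j) <;> cases hs' : s j
        · rfl
        · rw [cnt_f ht, cnt_t hs'] at b; omega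
        · rw [cnt_t ht, cnt_f hs'] at b; omega
        · rfl
    cases x
    · obtain ⟨n, m, a, b⟩ := dense_nat hα (-ρ) (-ρ + ε) (by linarith)
      have hn := h n
      have hm : (cnt true t n : ℤ) + m = 0 := by
        have u1 : ((cnt true t n + m : ℤ) : ℝ) < (1 : ℤ) := by push_cast; linarith
        have u2 : ((-1 : ℤ) : ℝ) < ((cnt true t n + m : ℤ) : ℝ) := by push_cast; linarith
        have u3 := Int.cast_lt.1 u1
        have u4 := Int.cast_lt.1 u2
        omega
      have hm' : (cnt true t n : ℝ) + m = 0 := by exact_mod_cast hm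
      refine ⟨n, fun j hj => ?_⟩
      have e1 := hε' j hj
      have e2 := h (n + 1 + j)
      push_cast at e2
      have u1 : (cnt true t (n + 1 + j) : ℝ) < (cnt true t n + cnt true s j + 1 : ℕ) := by
        push_cast; linarith
      have u2 : ((cnt true t n + cnt true s j : ℕ) : ℝ) < (cnt true t (n + 1 + j) + 1 : ℕ) := by
        push_cast; linarith
      have u3 := Nat.cast_lt.1 u1
      have u4 := Nat.cast_lt.1 u2
      simp; omega
    · obtain ⟨n, m, a, b⟩ := dense_nat hα (1 - ρ - ε) (1 - ρ) (by linarith)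
      have hn := h n
      have hm : (cnt true t n : ℤ) + m = 0 := by
        have u1 : ((cnt true t n + m : ℤ) : ℝ) < (1 : ℤ) := by push_cast; linarith
        have u2 : ((-1 : ℤ) : ℝ) < ((cnt true t n + m : ℤ) : ℝ) := by push_cast; linarith
        have u3 := Int.cast_lt.1 u1
        have u4 := Int.cast_lt.1 u2
        omega
      have hm' : (cnt true t n : ℝ) + m = 0 := by exact_mod_cast hm
      refine ⟨n, fun j hj => ?_⟩
      have e1 := hε' j hj
      have e2 := h (n + 1 + j)
      push_cast at e2
      have u1 : (cnt true t (n + 1 + j) : ℝ) < (cnt true t n + cnt true s j + 2 : ℕ) := by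
        push_cast; linarith
      have u2 : ((cnt true t n + cnt true s j : ℕ) : ℝ) < (cnt true t (n + 1 + j) : ℕ) := by
        push_cast; linarith
      have u3 := Nat.cast_lt.1 u1
      have u4 := Nat.cast_lt.1 u2
      simp; omega

/-- inductive description of skew words -/
inductive Sk : (ℕ → Bool) → Prop
  | base (x : Bool) (q : ℕ) (t : ℕ → Bool) (h : ∀ n, t n = if n = q then !x else x) : Sk t
  | step (z : Bool) (t1 t : ℕ → Bool) : Sk t1 → Sub z t1 t → Sk t

lemma Sk.fine {t} (h : Sk t) : ∃ s, Fn t s := by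
  induction h with
  | base x q t h =>
    refine ⟨fun _ => x, ?_, ?_⟩
    · intro i k _ hx
      by_cases hi : i = q
      · rw [h, h, if_neg (by omega), if_pos hi] at hx
        exact absurd hx not_ne
      · rw [h, if_neg hi]
    · intro y k
      rcases eq_or x y with rfl | rfl
      · refine ⟨q + 1, by rw [h, if_neg (by omega)], fun j _ => ?_⟩
        rw [h, if_neg (by omega)]
      · refine ⟨q, by rw [h, if_pos rfl], fun j _ => ?_⟩
        rw [h, if_neg (by omega)]
  | step z t1 t _ hsub ih =>
    obtain ⟨s1, hs1⟩ := ih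
    obtain ⟨s, hs⟩ := exists_img z s1
    exact ⟨s, hsub.fine_up hs hs1⟩

lemma cnt_add (z t n) : cnt z t n + cnt (!z) t n = n := by
  induction n with
  | zero => simp [cnt]
  | succ n ih =>
    simp only [cnt]
    cases z <;> cases t n <;> simp at * <;> omega

lemma cnt_shift (c u e n) : cnt c u (n + e) = cnt c (fun m => u (m + e)) n + cnt c u e := by
  induction n with
  | zero => simp [cnt]
  | succ n ih =>
    rw [show n + 1 + e = n + e + 1 by omega]
    simp only [cnt]
    rw [ih]; omega

lemma Img.cnt_pos {z t u} (h : Img z t u) (i : ℕ) : cnt (!z) u (pos z t i) = cnt (!z) t i := by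
  induction i with
  | zero => rfl
  | succ i ih =>
    have h1 := (h i).1
    have hne : ¬ (z = !z) := not_ne
    rcases eq_or z (t i) with hz | hz
    · rw [pos_succ_eq hz]
      simp only [cnt]
      rw [ih, h1, hz]
    · rw [pos_succ_ne hz]
      simp only [cnt]
      rw [ih, h1, (h i).2 hz, hz]
      simp [hne]

def BD (t : ℕ → Bool) (z : Bool) (a b C : ℤ) : Prop :=
  ∀ n, |a * cnt z t n - b * cnt (!z) t n| ≤ C

lemma BD.swap {t z a b C} (h : BD t z a b C) : BD t (!z) b a C := by
  intro n
  rw [abs_sub_comm, Bool.not_not]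
  exact h n

lemma int_arch {x c : ℤ} (h : ∀ n : ℕ, n * x ≤ c) : x ≤ 0 := by
  by_contra hx
  push Not at hx
  have h1 := h (c.toNat + 1)
  have h2 : c ≤ c.toNat := Int.self_le_toNat c
  push_cast at h1
  nlinarith

lemma cnt_unbounded {t : ℕ → Bool} {c : Bool} (h : ∀ n0, ∃ n, n0 ≤ n ∧ t n = c) (k : ℕ) :
    ∃ n, k ≤ cnt c t n := by
  induction k with
  | zero => exact ⟨0, by omega⟩
  | succ k ih =>
    obtain ⟨n, hn⟩ := ih
    obtain ⟨m, hm, hc⟩ := h n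
    refine ⟨m + 1, ?_⟩
    have hmono : cnt c t n ≤ cnt c t m := by
      obtain ⟨d, rfl⟩ := Nat.exists_eq_add_of_le hm
      rw [add_comm n d, cnt_shift]; omega
    simp [cnt, hc]; omega

lemma rat_base {t s : ℕ → Bool} {z : Bool} {b C : ℤ} (hb : 0 < b) (h : BD t z 0 b C)
    (hf : Fn t s) : Sk t := by
  obtain ⟨hN, hP⟩ := hf
  have h1 : ∃ n0, ∀ n, n0 ≤ n → t n = z := by
    by_contra hc
    push Not at hc
    obtain ⟨n, hn⟩ := cnt_unbounded (t := t) (c := !z) (fun n0 => by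
      obtain ⟨n, a, b⟩ := hc n0
      exact ⟨n, a, (eq_or z (t n)).resolve_left b⟩) (C.toNat + 1)
    have h2 := h n
    have h3 : C ≤ C.toNat := Int.self_le_toNat C
    rw [zero_mul, zero_sub, abs_neg] at h2
    have h4 := (le_abs_self _).trans h2
    have h5 : ((C.toNat + 1 : ℕ) : ℤ) ≤ cnt (!z) t n := by exact_mod_cast hn
    push_cast at h5
    nlinarith
  obtain ⟨n0, hn0⟩ := h1
  have hs : ∀ k, s k = z := by
    intro k
    induction k using Nat.strong_induction_on with
    | _ k ih =>
      rw [← hn0 n0 le_rfl]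
      apply hN
      · intro j hj
        rw [ih j hj, hn0 _ (by omega)]
      · rw [hn0 _ (by omega), hn0 _ (by omega)]
  have ht : ∀ i, t i = !z → ∀ k, t (i + 1 + k) = z := by
    intro i hi k
    induction k using Nat.strong_induction_on with
    | _ k ih =>
      by_contra hc
      have h2 := (eq_or z _).resolve_left hc
      have := hN i k (fun j hj => by rw [ih j hj, hs]) (by rw [h2, hi])
      rw [hs, hi] at this
      exact not_ne this
  obtain ⟨q, hq, _⟩ := hP (!z) 0
  refine Sk.base z q t (fun n => ?_)
  split_ifs with hnq
  · rw [hnq, hq]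
  · by_contra hc
    have h2 := (eq_or z _).resolve_left hc
    rcases Nat.lt_or_gt_of_ne hnq with hlt | hlt
    · have := ht n h2 (q - n - 1)
      rw [show n + 1 + (q - n - 1) = q by omega, hq] at this
      exact not_ne this.symm
    · have := ht q hq (n - q - 1)
      rw [show q + 1 + (n - q - 1) = n by omega, h2] at this
      exact not_ne this.symm

lemma rat_step {t t1 : ℕ → Bool} {z : Bool} {a b C : ℤ} (ha : 0 ≤ a) (hb : 0 ≤ b)
    (h : BD t z a b C) (hs : Sub z t1 t) : a ≤ b ∧ BD t1 z a (b - a) (C + a + b) := by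
  obtain ⟨u, e, hu, rfl, he⟩ := hs
  have hC : 0 ≤ C := (abs_nonneg _).trans (h 0)
  have hub : ∀ n, |a * cnt z u n - b * cnt (!z) u n| ≤ C + a + b := by
    intro n
    rcases he with rfl | ⟨rfl, _⟩
    · have := h n
      simp only [add_zero] at this
      linarith
    · cases n with
      | zero => simp [cnt]; linarith
      | succ n =>
        rw [cnt_shift, cnt_shift]
        have h2 := h n
        have c1 : (cnt z u 1 : ℤ) ≤ 1 := by exact_mod_cast cnt_le z u 1
        have c2 : (cnt (!z) u 1 : ℤ) ≤ 1 := by exact_mod_cast cnt_le (!z) u 1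
        have c3 : (0 : ℤ) ≤ cnt z u 1 := by positivity
        have c4 : (0 : ℤ) ≤ cnt (!z) u 1 := by positivity
        rw [abs_le] at h2 ⊢
        push_cast
        constructor <;> nlinarith
  have h1 : ∀ i : ℕ, |a * i - b * cnt (!z) t1 i| ≤ C + a + b := by
    intro i
    have h2 := hub (pos z t1 i)
    have h3 := cnt_add z u (pos z t1 i)
    rw [hu.cnt_pos] at h2 h3
    have h4 : cnt z u (pos z t1 i) = i := by unfold pos at h3 ⊢; omega
    rw [h4] at h2
    exact h2
  constructor
  · have : a - b ≤ 0 := by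
      apply int_arch (c := C + a + b)
      intro n
      have h2 := (le_abs_self _).trans (h1 n)
      have h3 : (cnt (!z) t1 n : ℤ) ≤ n := by exact_mod_cast cnt_le _ _ _
      nlinarith
    linarith
  · intro n
    have h2 := h1 n
    have h3 := cnt_add z t1 n
    have h4 : (n : ℤ) = cnt z t1 n + cnt (!z) t1 n := by exact_mod_cast h3.symm
    rw [h4] at h2
    convert h2 using 2
    ring

lemma rat_main : ∀ (N : ℕ) (t s : ℕ → Bool) (z : Bool) (a b C : ℤ), 0 ≤ a → 0 ≤ b → 0 < a + b →
    a + b ≤ N → BD t z a b C → Fn t s → Sk t := by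
  intro N
  induction N with
  | zero => intro t s z a b C _ _ h1 h2; push_cast at h2; omega
  | succ N ih =>
    have key : ∀ (t s : ℕ → Bool) (a b C : ℤ), 0 ≤ a → 0 ≤ b → 0 < a + b →
        a + b ≤ (N + 1 : ℕ) → BD t (s 0) a b C → Fn t s → Sk t := by
      intro t s a b C ha hb hab hN h hf
      rcases ha.lt_or_eq with ha' | ha'
      · obtain ⟨_, t1, s1, h1, h2, h3⟩ := hf.desub
        obtain ⟨h4, h5⟩ := rat_step ha hb h h1
        push_cast at hN
        exact Sk.step _ _ _ (ih t1 s1 (s 0) a (b - a) _ ha (by omega) (by omega) (by omega) h5 h3) h1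
      · subst ha'
        exact rat_base (by omega) h hf
    intro t s z a b C ha hb hab hN h hf
    rcases eq_or (s 0) z with hz | hz
    · subst hz; exact key t s a b C ha hb hab hN h hf
    · have h2 := h.swap
      rw [hz, Bool.not_not] at h2
      exact key t s b a C hb ha (by omega) (by omega) h2 hf

lemma Fn.classify {t s} (hf : Fn t s) : IsAperiodicSturmian t ∨ Sk t := by
  obtain ⟨α, hα⟩ := slope hf.1.bal
  obtain ⟨hα01, ρ, hρ, hM⟩ := mech_of_slope hα
  by_cases hirr : Irrational α
  · left
    exact ⟨α, ρ, hα01, hρ, hirr, hM.sturm hirr⟩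
  · right
    unfold Irrational at hirr
    push Not at hirr
    obtain ⟨r, rfl⟩ := hirr
    have hr0 : 0 ≤ r := by exact_mod_cast hα01.1
    have hr1 : r ≤ 1 := by exact_mod_cast hα01.2
    have hn0 : 0 ≤ r.num := Rat.num_nonneg.2 hr0
    have hn1 : r.num ≤ r.den := by
      have h1 := Rat.mul_den_eq_num r
      have h2 : (0 : ℚ) < r.den := by exact_mod_cast r.den_pos
      have h3 : (r.num : ℚ) ≤ r.den := by nlinarith
      exact_mod_cast h3
    have hd : 0 < (r.den : ℤ) := by exact_mod_cast r.den_pos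
    refine rat_main ((r.den : ℤ).toNat) t s true (r.den - r.num) r.num r.den (by omega) hn0
      (by omega) (by omega) ?_ hf
    intro n
    have h1 := hα 0 n
    have h3 : cnt true t 0 = 0 := rfl
    rw [h3, zero_add] at h1
    have h4 : (n : ℝ) = cnt true t n + cnt (!true) t n := by exact_mod_cast (cnt_add true t n).symm
    have hd' : (0 : ℝ) < r.den := by exact_mod_cast r.den_pos
    have hr : (r : ℝ) * r.den = r.num := by
      exact_mod_cast Rat.mul_den_eq_num r
    obtain ⟨ha, hb⟩ := h1
    have ha' := mul_le_mul_of_nonneg_right ha hd'.le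
    have hb' := mul_le_mul_of_nonneg_right hb hd'.le
    rw [mul_assoc, hr, h4] at ha' hb'
    have : |((r.den : ℝ) - r.num) * cnt true t n - r.num * cnt (!true) t n| ≤ r.den := by
      rw [abs_le]
      push_cast at ha' hb'
      constructor <;> linarith
    exact_mod_cast this

lemma prefix_iff {w : List Bool} {t : ℕ → Bool} :
    IsPrefixInf w t ↔ ∀ i (h : i < w.length), w[i] = t i := by
  unfold IsPrefixInf prefixList
  constructor
  · intro h i hi
    rw [List.getElem_of_eq h hi]
    simp
  · intro h
    apply List.ext_getElem
    · simp
    · intro i h1 h2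
      rw [h i h1]; simp

lemma prefix_append {v w : List Bool} {t : ℕ → Bool} :
    IsPrefixInf (v ++ w) t ↔ IsPrefixInf v t ∧ IsPrefixInf w (fun n => t (n + v.length)) := by
  simp only [prefix_iff]
  constructor
  · intro h
    constructor
    · intro i hi
      have := h i (by simp; omega)
      rwa [List.getElem_append_left hi] at this
    · intro i hi
      have := h (i + v.length) (by simp; omega)
      rw [← this, List.getElem_append_right (by omega)]
      simp
  · rintro ⟨h1, h2⟩ i hi
    by_cases hiv : i < v.length
    · rw [List.getElem_append_left hiv]; exact h1 i hiv
    · rw [List.getElem_append_right (by omega)]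
      rw [h2 (i - v.length) (by simp at hi; omega)]
      congr 1; omega

lemma prefix_cons {c : Bool} {w : List Bool} {t : ℕ → Bool} :
    IsPrefixInf (c :: w) t ↔ c = t 0 ∧ IsPrefixInf w (fun n => t (n + 1)) := by
  have := prefix_append (v := [c]) (w := w) (t := t)
  simp only [List.singleton_append, List.length_singleton] at this
  rw [this]
  simp [prefix_iff]

lemma prefix_nil {t : ℕ → Bool} : IsPrefixInf [] t := by simp [prefix_iff]

lemma wordAppend_iff {v : List Bool} {z t : ℕ → Bool} :
    t = wordAppend v z ↔ IsPrefixInf v t ∧ z = fun n => t (n + v.length) := by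
  constructor
  · rintro rfl
    constructor
    · rw [prefix_iff]
      intro i hi
      simp [wordAppend, hi]
    · funext n; simp [wordAppend]
  · rintro ⟨h1, rfl⟩
    rw [prefix_iff] at h1
    funext n
    unfold wordAppend
    split_ifs with h
    · rw [← h1 n h]; rfl
    · simp only; congr 1; omega

lemma psi_nil (z : Bool) : psiW z [] = [] := rfl

lemma psi_cons (z c : Bool) (w : List Bool) :
    psiW z (c :: w) = (if c = z then [z] else [z, c]) ++ psiW z w := rfl

lemma psi_append (z : Bool) (v w : List Bool) : psiW z (v ++ w) = psiW z v ++ psiW z w := by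
  simp [psiW]

lemma psi_pow (z : Bool) (k : ℕ) (L : List Bool) :
    psiW z (List.replicate k L).flatten = (List.replicate k (psiW z L)).flatten := by
  induction k with
  | zero => rfl
  | succ k ih => simp only [List.replicate_succ, List.flatten_cons, psi_append, ih]

lemma Img.pref_img {z t u} (h : Img z t u) : ∀ (w : List Bool) (l : ℕ),
    IsPrefixInf w (fun n => t (n + l)) → IsPrefixInf (psiW z w) (fun n => u (n + pos z t l)) := by
  intro w
  induction w with
  | nil => intro l _; exact prefix_nil
  | cons c w ih =>
    intro l hw
    rw [prefix_cons] at hw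
    obtain ⟨h1, h2⟩ := hw
    simp only [zero_add] at h1
    have h3 := ih (l + 1) (by convert h2 using 3; omega)
    rw [psi_cons]
    rcases eq_or z (t l) with hz | hz
    · rw [if_pos (h1.trans hz), List.singleton_append, prefix_cons]
      refine ⟨by simp only [zero_add]; exact (h l).1.symm, ?_⟩
      rw [pos_succ_eq hz] at h3
      convert h3 using 3; omega
    · rw [if_neg (by rw [h1, hz]; exact not_ne.symm)]
      simp only [List.cons_append, List.nil_append, prefix_cons]
      refine ⟨by simp only [zero_add]; exact (h l).1.symm, ?_, ?_⟩
      · rw [h1, ← h.next l]; congr 1; omega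
      · rw [pos_succ_ne hz] at h3
        convert h3 using 3; omega

lemma mu_append {μ : List Bool → List Bool} (h : PureEpistandard μ) (v w : List Bool) :
    μ (v ++ w) = μ v ++ μ w := by
  induction h with
  | id => rfl
  | comp a f _ ih => simp only [ih, psi_append]

lemma psi_ne_nil {z : Bool} {w : List Bool} (h : w ≠ []) : psiW z w ≠ [] := by
  cases w with
  | nil => exact absurd rfl h
  | cons c w => rw [psi_cons]; split_ifs <;> simp

lemma mu_ne_nil {μ : List Bool → List Bool} (h : PureEpistandard μ) (x : Bool) : μ [x] ≠ [] := by
  induction h with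
  | id => simp
  | comp a f _ ih => exact psi_ne_nil ih

def Skw (t : ℕ → Bool) : Prop :=
  ∃ (μ : List Bool → List Bool) (x y : Bool) (p : ℕ) (v : List Bool),
    PureEpistandard μ ∧ x ≠ y ∧ v ≠ [] ∧ v <:+ μ (List.replicate p x ++ [y]) ∧
    ∀ k, IsPrefixInf (v ++ (List.replicate k (μ [x])).flatten) t

lemma pow_singleton (k : ℕ) (x : Bool) :
    (List.replicate k [x]).flatten = List.replicate k x := by
  induction k with
  | zero => rfl
  | succ k ih => simp only [List.replicate_succ, List.flatten_cons, ih]; rfl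

lemma base_pref_iff {x : Bool} {q : ℕ} {t : ℕ → Bool} :
    (∀ k, IsPrefixInf ((List.replicate q x ++ [!x]) ++ (List.replicate k [x]).flatten) t) ↔
    ∀ n, t n = if n = q then !x else x := by
  simp only [pow_singleton, prefix_iff]
  constructor
  · intro h n
    rw [← h (n + 1) n (by simp; omega)]
    rcases lt_trichotomy n q with hn | hn | hn
    · rw [if_neg (by omega)]
      simp [List.getElem_append, hn, Nat.lt_succ_of_lt hn]
    · subst hn
      simp [List.getElem_append]
    · rw [if_neg (by omega)]
      rw [List.getElem_append_right (by simp; omega)]; simp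
  · intro h k n hn
    rw [h]
    rcases lt_trichotomy n q with hn | hn | hn
    · rw [if_neg (by omega)]
      simp [List.getElem_append, hn, Nat.lt_succ_of_lt hn]
    · subst hn
      simp [List.getElem_append]
    · rw [if_neg (by omega)]
      rw [List.getElem_append_right (by simp; omega)]; simp

lemma Sk.skw {t} (h : Sk t) : Skw t := by
  induction h with
  | base x q t h =>
    exact ⟨_, x, !x, q, List.replicate q x ++ [!x], PureEpistandard.id, not_ne, by simp,
      List.suffix_rfl, base_pref_iff.2 h⟩
  | step z t1 t _ hsub ih =>
    obtain ⟨μ, x, y, p, v, hμ, hxy, hv, hsuf, hpre⟩ := ih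
    obtain ⟨u, e, hu, rfl, he⟩ := hsub
    have hpre2 : ∀ k, IsPrefixInf (psiW z v ++ (List.replicate k (psiW z (μ [x]))).flatten) u := by
      intro k
      have := hu.pref_img _ 0 (hpre k)
      rw [psi_append, psi_pow] at this
      exact this
    have hsuf2 : psiW z v <:+ psiW z (μ (List.replicate p x ++ [y])) := by
      obtain ⟨r, hr⟩ := hsuf
      exact ⟨psiW z r, by rw [← psi_append, hr]⟩
    rcases he with rfl | ⟨rfl, h0⟩
    · exact ⟨_, x, y, p, psiW z v, PureEpistandard.comp z μ hμ, hxy, psi_ne_nil hv, hsuf2, hpre2⟩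
    · obtain ⟨c, r, rfl⟩ := List.exists_cons_of_ne_nil hv
      have hc : c = !z := by
        have := hpre 0
        rw [List.cons_append, prefix_cons] at this
        rw [this.1, h0]
      have hE : psiW z (c :: r) = z :: c :: psiW z r := by
        rw [psi_cons, if_neg (by rw [hc]; exact not_ne.symm)]; rfl
      rw [hE] at hpre2 hsuf2
      refine ⟨_, x, y, p, c :: psiW z r, PureEpistandard.comp z μ hμ, hxy, by simp,
        (List.suffix_cons _ _).trans hsuf2, ?_⟩
      intro k
      have := hpre2 k
      rw [List.cons_append, prefix_cons] at this
      exact this.2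

lemma suffix_psi {z : Bool} {v : List Bool} (hv : v ≠ []) : ∀ w, v <:+ psiW z w →
    ∃ v', v' ≠ [] ∧ v' <:+ w ∧ (v = psiW z v' ∨ (∃ r, v' = (!z) :: r ∧ psiW z v' = z :: v)) := by
  intro w
  induction w with
  | nil => intro h; rw [psi_nil, List.suffix_nil] at h; exact absurd h hv
  | cons c w ih =>
    intro h
    have hrec : v <:+ psiW z w → ∃ v', v' ≠ [] ∧ v' <:+ c :: w ∧
        (v = psiW z v' ∨ (∃ r, v' = (!z) :: r ∧ psiW z v' = z :: v)) := by
      intro h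
      obtain ⟨v', h1, h2, h3⟩ := ih h
      exact ⟨v', h1, h2.trans (List.suffix_cons _ _), h3⟩
    rcases eq_or z c with hc | hc
    · have hE : psiW z (c :: w) = z :: psiW z w := by rw [psi_cons, if_pos hc]; rfl
      rw [hE, List.suffix_cons_iff] at h
      rcases h with h | h
      · exact ⟨c :: w, by simp, List.suffix_rfl, Or.inl (by rw [h, hE])⟩
      · exact hrec h
    · have hE : psiW z (c :: w) = z :: c :: psiW z w := by
        rw [psi_cons, if_neg (by rw [hc]; exact not_ne.symm)]; rfl
      rw [hE, List.suffix_cons_iff, List.suffix_cons_iff] at h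
      rcases h with h | h | h
      · exact ⟨c :: w, by simp, List.suffix_rfl, Or.inl (by rw [h, hE])⟩
      · exact ⟨c :: w, by simp, List.suffix_rfl, Or.inr ⟨w, by rw [hc], by rw [h, hE]⟩⟩
      · exact hrec h

lemma suffix_rep {x y : Bool} {v : List Bool} (hv : v ≠ []) : ∀ p,
    v <:+ List.replicate p x ++ [y] → ∃ q, v = List.replicate q x ++ [y] := by
  intro p
  induction p with
  | zero =>
    intro h
    simp only [List.replicate_zero, List.nil_append, List.suffix_cons_iff, List.suffix_nil] at h
    exact ⟨0, by simpa using h.resolve_right hv⟩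
  | succ p ih =>
    intro h
    rw [List.replicate_succ, List.cons_append, List.suffix_cons_iff] at h
    rcases h with h | h
    · exact ⟨p + 1, by rw [h, List.replicate_succ, List.cons_append]⟩
    · exact ih h

lemma exists_pow (L : List Bool) (hL : L ≠ []) (v : List Bool) :
    ∃ t, ∀ k, IsPrefixInf (v ++ (List.replicate k L).flatten) t := by
  have hpos : 0 < L.length := List.length_pos_iff.2 hL
  let z : ℕ → Bool := fun n => L[n % L.length]'(Nat.mod_lt _ hpos)
  have hz : ∀ k, IsPrefixInf ((List.replicate k L).flatten) z := by
    intro k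
    induction k with
    | zero => exact prefix_nil
    | succ k ih =>
      rw [List.replicate_succ, List.flatten_cons, prefix_append]
      constructor
      · rw [prefix_iff]
        intro i hi
        simp only [z]
        congr 1
        rw [Nat.mod_eq_of_lt hi]
      · have : (fun n => z (n + L.length)) = z := by funext n; simp [z]
        rw [this]; exact ih
  refine ⟨wordAppend v z, fun k => ?_⟩
  obtain ⟨h1, h2⟩ := (wordAppend_iff (v := v) (z := z)).1 rfl
  rw [prefix_append, ← h2]
  exact ⟨h1, hz k⟩

lemma eq_of_pref {v L : List Bool} (hL : L ≠ []) {t u : ℕ → Bool}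
    (ht : ∀ k, IsPrefixInf (v ++ (List.replicate k L).flatten) t)
    (hu : ∀ k, IsPrefixInf (v ++ (List.replicate k L).flatten) u) : t = u := by
  have hpos : 0 < L.length := List.length_pos_iff.2 hL
  funext n
  have a := ht (n + 1)
  have b := hu (n + 1)
  rw [prefix_iff] at a b
  have hn : n < (v ++ (List.replicate (n + 1) L).flatten).length := by
    simp; nlinarith
  rw [← a n hn, ← b n hn]

lemma Skw.sk {t} (h : Skw t) : Sk t := by
  obtain ⟨μ, x, y, p, v, hμ, hxy, hv, hsuf, hpre⟩ := h
  induction hμ generalizing t v with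
  | id =>
    obtain ⟨q, rfl⟩ := suffix_rep hv p hsuf
    have hy : y = !x := (eq_or x y).resolve_left hxy.symm
    subst hy
    exact Sk.base x q t (base_pref_iff.1 hpre)
  | comp z μ hμ ih =>
    obtain ⟨v', hv', hs', hc⟩ := suffix_psi hv _ hsuf
    obtain ⟨t1, ht1⟩ := exists_pow (μ [x]) (mu_ne_nil hμ x) v'
    obtain ⟨u, hu⟩ := exists_img z t1
    have hpre2 : ∀ k, IsPrefixInf (psiW z v' ++ (List.replicate k (psiW z (μ [x]))).flatten) u := by
      intro k
      have := hu.pref_img _ 0 (ht1 k)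
      rw [psi_append, psi_pow] at this
      exact this
    refine Sk.step z t1 t (ih v' hv' hs' ht1) ?_
    have hne := psi_ne_nil (z := z) (mu_ne_nil hμ x)
    rcases hc with rfl | ⟨r, hr, hE⟩
    · exact ⟨u, 0, hu, eq_of_pref hne hpre hpre2, Or.inl rfl⟩
    · refine ⟨u, 1, hu, ?_, Or.inr ⟨rfl, ?_⟩⟩
      · apply eq_of_pref hne hpre
        intro k
        have := hpre2 k
        rw [hE, List.cons_append, prefix_cons] at this
        exact this.2
      · have := ht1 0
        rw [hr, List.cons_append, prefix_cons] at this
        exact this.1.symm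

lemma prefixList_succ (t : ℕ → Bool) (k : ℕ) :
    prefixList t (k + 1) = t 0 :: prefixList (fun n => t (n + 1)) k := by
  simp [prefixList, List.range_succ_eq_map, Function.comp_def]

lemma length_prefixList (t : ℕ → Bool) (k : ℕ) : (prefixList t k).length = k := by
  simp [prefixList]

lemma prefixList_eq_iff {t u : ℕ → Bool} {k : ℕ} :
    prefixList t k = prefixList u k ↔ ∀ j, j < k → t j = u j := by
  simp [prefixList]

lemma factorAt_iff {t : ℕ → Bool} {u : List Bool} {i : ℕ} :
    FactorAt t u i ↔ u = prefixList (fun j => t (i + j)) u.length := Iff.rfl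

lemma fac_iff {t m : ℕ → Bool} {k : ℕ} :
    IsFactorInf t (prefixList m k) ↔ ∃ i, ∀ j, j < k → t (i + j) = m j := by
  simp only [IsFactorInf, factorAt_iff, length_prefixList, prefixList_eq_iff]
  exact exists_congr fun i => forall_congr' fun j => forall_congr' fun _ => eq_comm

lemma lex_iff (k : ℕ) : ∀ {m w : ℕ → Bool},
    listLe (· < ·) (prefixList m k) (prefixList w k) ↔
      ∀ n, n < k → (∀ j, j < n → m j = w j) → m n ≤ w n := by
  induction k with
  | zero => intro m w; simp [listLe, prefixList]
  | succ k ih =>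
    intro m w
    have step : listLe (· < ·) (prefixList m (k + 1)) (prefixList w (k + 1)) ↔
        m 0 < w 0 ∨ (m 0 = w 0 ∧ listLe (· < ·) (prefixList (fun n => m (n + 1)) k)
          (prefixList (fun n => w (n + 1)) k)) := by
      rw [prefixList_succ, prefixList_succ]
      unfold listLe
      rw [List.cons_eq_cons, List.cons_lex_cons_iff]
      tauto
    rw [step, ih]
    constructor
    · rintro (h | ⟨h, h2⟩) n hn hj
      · cases n with
        | zero => exact h.le
        | succ n => exact absurd (hj 0 (by omega)) h.ne
      · cases n with
        | zero => exact h.le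
        | succ n => exact h2 n (by omega) (fun j hj' => hj (j + 1) (by omega))
    · intro h
      rcases (h 0 (by omega) (by intro j hj; omega)).lt_or_eq with h0 | h0
      · exact Or.inl h0
      · refine Or.inr ⟨h0, fun n hn hj => h (n + 1) (by omega) (fun j hj' => ?_)⟩
        cases j with
        | zero => exact h0
        | succ j => exact hj j (by omega)

lemma min_iff {t m : ℕ → Bool} : IsMinInf (· < ·) t m ↔
    (∀ k, ∃ i, ∀ j, j < k → t (i + j) = m j) ∧
    ∀ i n, (∀ j, j < n → m j = t (i + j)) → m n ≤ t (i + n) := by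
  constructor
  · intro h
    refine ⟨fun k => fac_iff.1 (h k).1, fun i n hj => ?_⟩
    have := (h (n + 1)).2 (prefixList (fun j => t (i + j)) (n + 1))
      (fac_iff.2 ⟨i, fun _ _ => rfl⟩) (length_prefixList _ _)
    exact (lex_iff _).1 this n (by omega) hj
  · rintro ⟨h1, h2⟩ k
    refine ⟨fac_iff.2 (h1 k), ?_⟩
    rintro u ⟨i, hi⟩ rfl
    rw [factorAt_iff] at hi
    rw [hi, length_prefixList, lex_iff]
    exact fun n _ hj => h2 i n hj

lemma max_iff {t m : ℕ → Bool} : IsMaxInf (· < ·) t m ↔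
    (∀ k, ∃ i, ∀ j, j < k → t (i + j) = m j) ∧
    ∀ i n, (∀ j, j < n → t (i + j) = m j) → t (i + n) ≤ m n := by
  constructor
  · intro h
    refine ⟨fun k => fac_iff.1 (h k).1, fun i n hj => ?_⟩
    have := (h (n + 1)).2 (prefixList (fun j => t (i + j)) (n + 1))
      (fac_iff.2 ⟨i, fun _ _ => rfl⟩) (length_prefixList _ _)
    exact (lex_iff _).1 this n (by omega) hj
  · rintro ⟨h1, h2⟩ k
    refine ⟨fac_iff.2 (h1 k), ?_⟩
    rintro u ⟨i, hi⟩ rfl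
    rw [factorAt_iff] at hi
    rw [hi, length_prefixList, lex_iff]
    exact fun n _ hj => h2 i n hj

lemma occ_iff {t s : ℕ → Bool} {x : Bool} :
    (∀ k, ∃ i, ∀ j, j < k → t (i + j) = consInf x s j) ↔
    ∀ k, ∃ i, t i = x ∧ ∀ j, j < k → t (i + 1 + j) = s j := by
  constructor
  · intro h k
    obtain ⟨i, hi⟩ := h (k + 1)
    refine ⟨i, hi 0 (by omega), fun j hj => ?_⟩
    have := hi (j + 1) (by omega)
    rw [show i + 1 + j = i + (j + 1) by omega, this]; rfl
  · intro h k
    obtain ⟨i, h0, hi⟩ := h k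
    refine ⟨i, fun j hj => ?_⟩
    cases j with
    | zero => exact h0
    | succ j =>
      rw [show i + (j + 1) = i + 1 + j by omega, hi j (by omega)]; rfl

lemma fine_iff (t : ℕ → Bool) : FineBool t ↔ ∃ s, Fn t s := by
  unfold FineBool
  refine exists_congr fun s => ?_
  rw [min_iff, max_iff, occ_iff, occ_iff]
  constructor
  · rintro ⟨⟨a1, a2⟩, b1, b2⟩
    refine ⟨?_, ?_⟩
    · intro i k hj hx
      cases hi : t i
      · have := a2 i (k + 1) (fun j hj' => by
          cases j with
          | zero => exact hi.symm
          | succ j =>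
            rw [show i + (j + 1) = i + 1 + j by omega, hj j (by omega)]; rfl)
        rw [show i + (k + 1) = i + 1 + k by omega, hx, hi] at this
        exact le_bot_iff.1 this
      · have := b2 i (k + 1) (fun j hj' => by
          cases j with
          | zero => exact hi
          | succ j =>
            rw [show i + (j + 1) = i + 1 + j by omega, hj j (by omega)]; rfl)
        rw [show i + (k + 1) = i + 1 + k by omega, hx, hi] at this
        exact top_le_iff.1 this
    · intro x
      cases x
      · exact a1
      · exact b1
  · rintro ⟨hN, hP⟩
    refine ⟨⟨hP false, ?_⟩, hP true, ?_⟩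
    · intro i n hj
      cases n with
      | zero => exact bot_le
      | succ n =>
        have hi : t i = false := (hj 0 (by omega)).symm
        have h2 := hN i n (fun j hj' => by
          have := hj (j + 1) (by omega)
          rw [show i + 1 + j = i + (j + 1) by omega, ← this]; rfl)
        rw [show i + (n + 1) = i + 1 + n by omega]
        cases hc : t (i + 1 + n)
        · rw [hc, hi] at h2
          exact (h2 rfl).le
        · exact le_top
    · intro i n hj
      cases n with
      | zero => exact le_top
      | succ n =>
        have hi : t i = true := hj 0 (by omega)
        have h2 := hN i n (fun j hj' => by
          have := hj (j + 1) (by omega)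
          rw [show i + 1 + j = i + (j + 1) by omega, this]; rfl)
        rw [show i + (n + 1) = i + 1 + n by omega]
        cases hc : t (i + 1 + n)
        · exact bot_le
        · rw [hc, hi] at h2
          exact (h2 rfl).ge

lemma skw_iff (t : ℕ → Bool) : Skw t ↔
    ∃ (μ : List Bool → List Bool) (x y : Bool) (p : ℕ) (v : List Bool) (z : ℕ → Bool),
        PureEpistandard μ ∧ x ≠ y ∧
        v ≠ [] ∧ v <:+ μ (List.replicate p x ++ [y]) ∧
        (∀ k, IsPrefixInf ((List.replicate k (μ [x])).flatten) z) ∧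
        t = wordAppend v z := by
  constructor
  · rintro ⟨μ, x, y, p, v, h1, h2, h3, h4, h5⟩
    refine ⟨μ, x, y, p, v, fun n => t (n + v.length), h1, h2, h3, h4, ?_, ?_⟩
    · intro k; exact (prefix_append.1 (h5 k)).2
    · rw [wordAppend_iff]
      exact ⟨(prefix_append.1 (h5 0)).1, rfl⟩
  · rintro ⟨μ, x, y, p, v, z, h1, h2, h3, h4, h5, h6⟩
    obtain ⟨h7, h8⟩ := wordAppend_iff.1 h6
    refine ⟨μ, x, y, p, v, h1, h2, h3, h4, fun k => ?_⟩
    rw [prefix_append, ← h8]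
    exact ⟨h7, h5 k⟩

end FW

/-- An infinite binary word `t` (with `a = false < b = true`) is fine iff it
is aperiodic Sturmian or `t = v·μ(x)^ω` where `μ` is a pure standard Sturmian morphism,
`x ≠ y` are the two letters, and `v` is a non-empty suffix of `μ(xᵖy)` for some `p ∈ ℕ`. -/
theorem fine_iff_sturmian_or_skew (t : ℕ → Bool) :
    FineBool t ↔
      IsAperiodicSturmian t ∨
      ∃ (μ : List Bool → List Bool) (x y : Bool) (p : ℕ) (v : List Bool) (z : ℕ → Bool),
        PureEpistandard μ ∧ x ≠ y ∧
        v ≠ [] ∧ v <:+ μ (List.replicate p x ++ [y]) ∧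
        (∀ k, IsPrefixInf ((List.replicate k (μ [x])).flatten) z) ∧
        t = wordAppend v z := by
  rw [FW.fine_iff, ← FW.skw_iff]
  constructor
  · rintro ⟨s, hs⟩
    exact hs.classify.imp_right FW.Sk.skw
  · rintro (⟨α, ρ, hα, _, hirr, h⟩ | h)
    · obtain ⟨r, hr⟩ := FW.mech_of_sturm hα.1 hα.2 h
      exact hr.fine hirr hα.1 hα.2
    · exact h.sk.fine
end
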